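/- arXiv:0811.4144 — 12 statements merged into one kernel-verified Lean document; each statement's English description precedes it below -/
import Mathlib

section
/- Let K be a compact line. Then the set G(K), consisting of all points of K which are either isolated in K or are the limit of an injective sequence (x_n)_{n∈ℕ} of points of K, is dense in K. -/
universe u

open Set Filter Topology

/-- `GSet K` is the set of points of `K` which are either isolated or are the limit of an
injective sequence. -/
def GSet (K : Type u) [TopologicalSpace K] : Set K :=
  {x | IsOpen ({x} : Set K) ∨
    ∃ f : ℕ → K, Function.Injective f ∧ Tendsto f atTop (𝓝 x)}

theorem Monotone.exists_tendsto_of_compactSpace {K : Type*} [TopologicalSpace K] [LinearOrder K]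
    [OrderTopology K] [CompactSpace K] {f : ℕ → K} (hf : Monotone f) :
    ∃ x, Tendsto f atTop (𝓝 x) := by
  obtain ⟨x, hx : MapClusterPt x atTop f⟩ := exists_clusterPt_of_compactSpace (map f atTop)
  have hle : ∀ n, f n ≤ x := by
    intro n
    by_contra! h
    obtain ⟨m, hm, hnm⟩ :=
      ((hx.frequently (Iio_mem_nhds h)).and_eventually (eventually_ge_atTop n)).exists
    exact (hf hnm).not_gt hm
  refine ⟨x, tendsto_order.2 ⟨fun a ha => ?_, fun a ha => .of_forall fun n => (hle n).trans_lt ha⟩⟩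
  obtain ⟨m, hm⟩ := (hx.frequently (Ioi_mem_nhds ha)).exists
  filter_upwards [eventually_ge_atTop m] with n hn
  exact lt_of_lt_of_le hm (hf hn)

theorem Antitone.exists_tendsto_of_compactSpace {K : Type*} [TopologicalSpace K] [LinearOrder K]
    [OrderTopology K] [CompactSpace K] {f : ℕ → K} (hf : Antitone f) :
    ∃ x, Tendsto f atTop (𝓝 x) :=
  haveI : CompactSpace Kᵒᵈ := ‹CompactSpace K›
  Monotone.exists_tendsto_of_compactSpace (K := Kᵒᵈ) hf.dual_right

theorem exists_subseq_tendsto_of_compactSpace_linearOrder {K : Type*} [TopologicalSpace K]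
    [LinearOrder K] [OrderTopology K] [CompactSpace K] (f : ℕ → K) :
    ∃ g : ℕ ↪o ℕ, ∃ x, Tendsto (f ∘ g) atTop (𝓝 x) := by
  obtain ⟨g, hg | hg⟩ := exists_increasing_or_nonincreasing_subseq (· < ·) f
  · have hmono : StrictMono (f ∘ g) := fun m n h => hg m n h
    exact ⟨g, hmono.monotone.exists_tendsto_of_compactSpace⟩
  · have hanti : Antitone (f ∘ g) := by
      intro m n h
      obtain rfl | h := h.eq_or_lt
      · exact le_rfl
      · exact not_lt.1 (hg m n h)
    exact ⟨g, hanti.exists_tendsto_of_compactSpace⟩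

theorem IsOpen.isOpen_singleton_of_finite {X : Type*} [TopologicalSpace X] [T1Space X] {V : Set X}
    (hV : IsOpen V) (hfin : V.Finite) {x : X} (hx : x ∈ V) : IsOpen ({x} : Set X) := by
  have h := hV.sdiff (hfin.subset (sdiff_subset (t := {x}))).isClosed
  rwa [sdiff_sdiff_cancel_left (singleton_subset_iff.2 hx)] at h

theorem GSet_dense (K : Type u) [TopologicalSpace K] [LinearOrder K] [OrderTopology K]
    [CompactSpace K] : Dense (GSet K) := by
  refine dense_iff_inter_open.2 fun U hU ⟨x, hx⟩ => ?_
  obtain ⟨C, hC, hCcl, hCU⟩ := exists_mem_nhds_isClosed_subset (hU.mem_nhds hx)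
  obtain ⟨V, hVC, hV, hxV⟩ := mem_nhds_iff.1 hC
  by_cases hfin : V.Finite
  · exact ⟨x, hx, Or.inl (hV.isOpen_singleton_of_finite hfin hxV)⟩
  · let e := Set.Infinite.natEmbedding V hfin
    obtain ⟨g, y, hy⟩ := exists_subseq_tendsto_of_compactSpace_linearOrder fun n => (e n : K)
    exact ⟨y, hCU (hCcl.mem_of_tendsto hy (.of_forall fun n => hVC (e (g n)).2)),
      Or.inr ⟨_, (Subtype.val_injective.comp e.injective).comp g.injective, hy⟩⟩
end

section
/- Let K be a Valdivia compact line. Then G(K) is a dense Σ-subset of K, it is the unique dense Σ-subset of K, and it coincides with the set of all Gδ points of K (points x such that {x} is a countable intersection of open sets). -/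
universe u

open Set Filter Topology

/-- A compact space `K` is *Valdivia* if it embeds into some `ℝ^Γ` so that the points of the
image with countable support form a dense subset (of the image, equivalently the preimage of
`Σ(Γ)` is dense in `K`). -/
def IsValdivia (K : Type u) [TopologicalSpace K] : Prop :=
  ∃ (Γ : Type u) (h : K → Γ → ℝ),
    Topology.IsEmbedding h ∧ Dense {x : K | {γ : Γ | h x γ ≠ 0}.Countable}

/-- `A` is a `Σ`-subset of `K` if it is the preimage of `Σ(Γ)` under some embedding of `K`
into `ℝ^Γ`. -/
def IsSigmaSubset (K : Type u) [TopologicalSpace K] (A : Set K) : Prop :=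
  ∃ (Γ : Type u) (h : K → Γ → ℝ),
    Topology.IsEmbedding h ∧ A = {x : K | {γ : Γ | h x γ ≠ 0}.Countable}

/-- Points in the closure of a subset of a `Σ`-subset which themselves lie in the `Σ`-subset are
limits of sequences. -/
theorem exists_seq_tendsto_of_countable_support {X Γ : Type*} [TopologicalSpace X]
    {h : X → Γ → ℝ} (hh : IsInducing h) {B : Set X} {x : X}
    (hB : ∀ y ∈ B, {γ | h y γ ≠ 0}.Countable) (hx : {γ | h x γ ≠ 0}.Countable)
    (hxB : x ∈ closure B) :
    ∃ y : ℕ → X, (∀ n, y n ∈ B) ∧ Tendsto y atTop (𝓝 x) := by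
  classical
  have hcode : ∀ z : X, ∃ c : Γ → ℕ, {γ | h z γ ≠ 0}.Countable → InjOn c {γ | h z γ ≠ 0} := by
    intro z
    by_cases hz : {γ | h z γ ≠ 0}.Countable
    · obtain ⟨c, hc⟩ := Set.countable_iff_exists_injOn.1 hz
      exact ⟨c, fun _ => hc⟩
    · exact ⟨fun _ => 0, fun h' => absurd h' hz⟩
  choose c hc using hcode
  let part : X → ℕ → Set Γ := fun z m => {γ | h z γ ≠ 0 ∧ c z γ ≤ m}
  have hfin : ∀ z, {γ | h z γ ≠ 0}.Countable → ∀ m, (part z m).Finite := by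
    intro z hz m
    refine Set.Finite.of_finite_image ((Set.finite_Iic m).subset ?_)
      ((hc z hz).mono fun γ hγ => hγ.1)
    rintro _ ⟨γ, hγ, rfl⟩
    exact hγ.2
  have happrox : ∀ F : Set Γ, F.Finite → ∀ m : ℕ,
      ∃ y ∈ B, ∀ γ ∈ F, dist (h y γ) (h x γ) < 1 / ((m : ℝ) + 1) := by
    intro F hF m
    have hev : ∀ᶠ y in 𝓝 x, ∀ γ ∈ F, dist (h y γ) (h x γ) < 1 / ((m : ℝ) + 1) := by
      rw [hF.eventually_all]
      intro γ _
      have hcont : Continuous fun y => h y γ := (continuous_apply γ).comp hh.continuous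
      exact hcont.continuousAt.eventually (Metric.ball_mem_nhds _ Nat.one_div_pos_of_nat)
    obtain ⟨y, hy, hyB⟩ := ((mem_closure_iff_frequently.1 hxB).and_eventually hev).exists
    exact ⟨y, hy, hyB⟩
  obtain ⟨f, hfP, hfr⟩ := exists_seq_of_forall_finset_exists
    (fun p : ℕ × X => p.2 ∈ B ∧
      ∀ γ ∈ part x p.1, dist (h p.2 γ) (h x γ) < 1 / ((p.1 : ℝ) + 1))
    (fun p q => p.1 < q.1 ∧
      ∀ γ ∈ part p.2 q.1, dist (h q.2 γ) (h x γ) < 1 / ((q.1 : ℝ) + 1)) (by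
    intro s hs
    have hF : (part x (s.sup Prod.fst + 1) ∪
        ⋃ p ∈ s, part p.2 (s.sup Prod.fst + 1)).Finite :=
      (hfin x hx _).union
        (s.finite_toSet.biUnion fun p hp => hfin p.2 (hB _ (hs p hp).1) _)
    obtain ⟨y, hyB, hy⟩ := happrox _ hF (s.sup Prod.fst + 1)
    refine ⟨(s.sup Prod.fst + 1, y), ⟨hyB, fun γ hγ => hy γ (Or.inl hγ)⟩, fun p hp =>
      ⟨Nat.lt_succ_of_le (Finset.le_sup (f := Prod.fst) hp),
        fun γ hγ => hy γ (Or.inr (mem_biUnion hp hγ))⟩⟩)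
  have hmono : StrictMono fun n => (f n).1 := fun m n hmn => (hfr m n hmn).1
  have hlim : Tendsto (fun n => 1 / (((f n).1 : ℝ) + 1)) atTop (𝓝 0) :=
    tendsto_one_div_add_atTop_nhds_zero_nat.comp hmono.tendsto_atTop
  refine ⟨fun n => (f n).2, fun n => (hfP n).1, ?_⟩
  rw [hh.tendsto_nhds_iff, tendsto_pi_nhds]
  intro γ
  by_cases hγ : h x γ ≠ 0
  · refine tendsto_iff_dist_tendsto_zero.2 (squeeze_zero' (.of_forall fun _ => dist_nonneg) ?_ hlim)
    filter_upwards [hmono.tendsto_atTop.eventually_ge_atTop (c x γ)] with n hn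
    exact ((hfP n).2 γ ⟨hγ, hn⟩).le
  by_cases hex : ∃ k, h (f k).2 γ ≠ 0
  · obtain ⟨k, hk⟩ := hex
    refine tendsto_iff_dist_tendsto_zero.2 (squeeze_zero' (.of_forall fun _ => dist_nonneg) ?_ hlim)
    filter_upwards [hmono.tendsto_atTop.eventually_ge_atTop (c (f k).2 γ),
      eventually_gt_atTop k] with n hn hkn
    exact ((hfr k n hkn).2 γ ⟨hk, hn⟩).le
  · push Not at hex hγ
    simp [hex, hγ]

/-- `Σ`-subsets are closed under limits of sequences. -/
theorem countable_support_of_tendsto {X Γ : Type*} [TopologicalSpace X]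
    {h : X → Γ → ℝ} (hh : Continuous h) {x : X} {y : ℕ → X}
    (hy : ∀ n, {γ | h (y n) γ ≠ 0}.Countable) (hlim : Tendsto y atTop (𝓝 x)) :
    {γ | h x γ ≠ 0}.Countable := by
  refine (countable_iUnion hy).mono fun γ hγ => ?_
  by_contra hn
  simp only [mem_iUnion, mem_ofPred_eq, not_exists, not_not] at hn
  have h1 : Tendsto (fun n => h (y n) γ) atTop (𝓝 (h x γ)) :=
    (((continuous_apply γ).comp hh).tendsto x).comp hlim
  simp only [hn] at h1
  exact hγ (tendsto_nhds_unique h1 tendsto_const_nhds)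

/-- In a compact Hausdorff space, every `Gδ` point has a countable neighbourhood base. -/
theorem IsGδ.isCountablyGenerated_nhds_of_compactSpace {X : Type*} [TopologicalSpace X]
    [CompactSpace X] [T2Space X] {x : X} (hx : IsGδ ({x} : Set X)) :
    (𝓝 x).IsCountablyGenerated := by
  obtain ⟨U, hUo, hU⟩ := isGδ_iff_eq_iInter_nat.1 hx
  have hxU : ∀ n, U n ∈ 𝓝 x := fun n =>
    (hUo n).mem_nhds (mem_iInter.1 (hU ▸ mem_singleton x) n)
  choose V hV hVc hVU using fun n => exists_mem_nhds_isClosed_subset (hxU n)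
  have hEq : 𝓝 x = ⨅ n, 𝓟 (V n) := by
    refine le_antisymm (le_iInf fun n => le_principal_iff.2 (hV n)) ?_
    refine isCompact_univ.le_nhds_of_unique_clusterPt (by simp) fun y _ hy => ?_
    have hyU : y ∈ ⋂ n, U n := mem_iInter.2 fun n => hVU n <| by
      rw [← (hVc n).closure_eq, mem_closure_iff_clusterPt]
      exact hy.mono (iInf_le _ n)
    rwa [← hU] at hyU
  rw [hEq]
  infer_instance

section LinearOrder

variable {K : Type*} [TopologicalSpace K] [LinearOrder K] [OrderTopology K]

theorem exists_isGδ_disjoint_Iio {Γ : Type*} {h : K → Γ → ℝ} (hh : IsInducing h)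
    (hd : Dense {x : K | {γ | h x γ ≠ 0}.Countable}) {x : K}
    (hx : {γ | h x γ ≠ 0}.Countable) :
    ∃ L : Set K, IsGδ L ∧ x ∈ L ∧ Disjoint L (Iio x) := by
  by_cases hcl : x ∈ closure (Iio x)
  · have hcl' : x ∈ closure (Iio x ∩ {x : K | {γ | h x γ ≠ 0}.Countable}) :=
      closure_minimal (hd.open_subset_closure_inter isOpen_Iio) isClosed_closure hcl
    obtain ⟨y, hyB, hy⟩ := exists_seq_tendsto_of_countable_support hh (fun _ hy => hy.2) hx hcl'
    refine ⟨⋂ n, Ioi (y n), .iInter_of_isOpen fun n => isOpen_Ioi,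
      mem_iInter.2 fun n => (hyB n).1, disjoint_left.2 fun z hz hzx => ?_⟩
    obtain ⟨n, hn⟩ := (hy.eventually (lt_mem_nhds hzx)).exists
    exact lt_asymm hn (mem_iInter.1 hz n)
  · exact ⟨(closure (Iio x))ᶜ, isClosed_closure.isOpen_compl.isGδ, hcl,
      disjoint_compl_left.mono_right subset_closure⟩

theorem isGδ_singleton_of_countable_support {Γ : Type*} {h : K → Γ → ℝ} (hh : IsInducing h)
    (hd : Dense {x : K | {γ | h x γ ≠ 0}.Countable}) {x : K}
    (hx : {γ | h x γ ≠ 0}.Countable) : IsGδ ({x} : Set K) := by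
  obtain ⟨L, hL, hxL, hLd⟩ := exists_isGδ_disjoint_Iio hh hd hx
  obtain ⟨R, hR, hxR, hRd⟩ := exists_isGδ_disjoint_Iio (K := Kᵒᵈ) (h := h) hh hd hx
  have hEq : ({x} : Set K) = L ∩ R := by
    refine Subset.antisymm (singleton_subset_iff.2 ⟨hxL, hxR⟩) fun z hz => ?_
    exact le_antisymm (not_lt.1 fun hlt => disjoint_left.1 hRd hz.2 hlt)
      (not_lt.1 fun hlt => disjoint_left.1 hLd hz.1 hlt)
  rw [hEq]
  exact hL.inter hR

theorem StrictMono.exists_seq_mem_dense_tendsto {A : Set K} (hA : Dense A) {f : ℕ → K} {x : K}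
    (hf : StrictMono f) (hlim : Tendsto f atTop (𝓝 x)) :
    ∃ a : ℕ → K, (∀ n, a n ∈ A) ∧ Tendsto a atTop (𝓝 x) := by
  have hex : ∀ n, ∃ a ∈ A, a ∈ Ioo (f n) (f (n + 2)) := fun n => by
    obtain ⟨a, ha, haA⟩ := hA.inter_open_nonempty (Ioo (f n) (f (n + 2))) isOpen_Ioo
      ⟨f (n + 1), hf (by lia), hf (by lia)⟩
    exact ⟨a, haA, ha⟩
  choose a haA ha using hex
  exact ⟨a, haA, tendsto_of_tendsto_of_tendsto_of_le_of_le hlim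
    (hlim.comp (tendsto_add_atTop_nat 2)) (fun n => (ha n).1.le) fun n => (ha n).2.le⟩

theorem exists_seq_mem_dense_tendsto_of_injective {A : Set K} (hA : Dense A) {f : ℕ → K} {x : K}
    (hf : Function.Injective f) (hlim : Tendsto f atTop (𝓝 x)) :
    ∃ a : ℕ → K, (∀ n, a n ∈ A) ∧ Tendsto a atTop (𝓝 x) := by
  obtain ⟨g, hg | hg⟩ := exists_increasing_or_nonincreasing_subseq (· < ·) f
  · exact StrictMono.exists_seq_mem_dense_tendsto hA (f := f ∘ g) (fun m n => hg m n)
      (hlim.comp g.strictMono.tendsto_atTop)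
  · refine StrictMono.exists_seq_mem_dense_tendsto (K := Kᵒᵈ) hA (f := f ∘ g) (fun m n hmn => ?_)
      (hlim.comp g.strictMono.tendsto_atTop)
    exact lt_of_le_of_ne (not_lt.1 (hg m n hmn) : f (g n) ≤ f (g m))
      ((hf.comp g.injective).ne hmn.ne)

theorem isOpen_singleton_or_exists_injective_tendsto {x : K} [(𝓝 x).IsCountablyGenerated] :
    IsOpen ({x} : Set K) ∨ ∃ f : ℕ → K, Function.Injective f ∧ Tendsto f atTop (𝓝 x) := by
  by_cases ho : IsOpen ({x} : Set K)
  · exact .inl ho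
  right
  have hcl : x ∈ closure (Iio x) ∪ closure (Ioi x) := by
    rw [← closure_union, Iio_union_Ioi, closure_compl, mem_compl_iff, mem_interior_iff_mem_nhds]
    exact fun h => ho (isOpen_singleton_iff_nhds_eq_pure x |>.2
      (le_antisymm (le_pure_iff.2 h) (pure_le_nhds x)))
  rcases hcl with hcl | hcl
  · obtain ⟨u, hu, -, hlim, -⟩ := (isLUB_of_mem_closure (fun _ h => le_of_lt h)
      hcl).exists_seq_strictMono_tendsto_of_notMem self_notMem_Iio (closure_nonempty_iff.1 ⟨x, hcl⟩)
    exact ⟨u, hu.injective, hlim⟩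
  · obtain ⟨u, hu, -, hlim, -⟩ := (isGLB_of_mem_closure (fun _ h => le_of_lt h)
      hcl).exists_seq_strictAnti_tendsto_of_notMem self_notMem_Ioi (closure_nonempty_iff.1 ⟨x, hcl⟩)
    exact ⟨u, hu.injective, hlim⟩

end LinearOrder

/-- A dense `Σ`-subset of a compact line consists of all of its `Gδ` points, and these are exactly
the points of `GSet`. -/
theorem dense_sigma_subset_eq {K Γ : Type u} [TopologicalSpace K] [LinearOrder K]
    [OrderTopology K] [CompactSpace K] {h : K → Γ → ℝ} (hh : IsInducing h)
    (hd : Dense {x : K | {γ : Γ | h x γ ≠ 0}.Countable}) :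
    {x : K | {γ : Γ | h x γ ≠ 0}.Countable} = GSet K ∧
      GSet K = {x : K | IsGδ ({x} : Set K)} := by
  have hAG : {x : K | {γ : Γ | h x γ ≠ 0}.Countable} ⊆ {x : K | IsGδ ({x} : Set K)} :=
    fun x hx => isGδ_singleton_of_countable_support hh hd hx
  have hGδ : {x : K | IsGδ ({x} : Set K)} ⊆ GSet K := fun x hx => by
    have := IsGδ.isCountablyGenerated_nhds_of_compactSpace hx
    exact isOpen_singleton_or_exists_injective_tendsto
  have hGA : GSet K ⊆ {x : K | {γ : Γ | h x γ ≠ 0}.Countable} := by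
    rintro x (ho | ⟨f, hf, hlim⟩)
    · obtain ⟨y, rfl, hy⟩ := hd.inter_open_nonempty _ ho ⟨x, rfl⟩
      exact hy
    · obtain ⟨a, haA, ha⟩ := exists_seq_mem_dense_tendsto_of_injective hd hf hlim
      exact countable_support_of_tendsto hh.continuous haA ha
  exact ⟨(hAG.trans hGδ).antisymm hGA, (hGA.trans hAG).antisymm hGδ⟩

theorem GSet_unique_dense_sigma_subset (K : Type u) [TopologicalSpace K] [LinearOrder K]
    [OrderTopology K] [CompactSpace K] (hK : IsValdivia K) :
    (IsSigmaSubset K (GSet K) ∧ Dense (GSet K)) ∧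
      (∀ A : Set K, IsSigmaSubset K A → Dense A → A = GSet K) ∧
      GSet K = {x : K | IsGδ ({x} : Set K)} := by
  obtain ⟨Γ, h, hh, hd⟩ := hK
  obtain ⟨hA, hG⟩ := dense_sigma_subset_eq hh.isInducing hd
  refine ⟨⟨⟨Γ, h, hh, hA.symm⟩, hA ▸ hd⟩, ?_, hG⟩
  rintro A ⟨Γ', h', hh', rfl⟩ hd'
  exact (dense_sigma_subset_eq hh'.isInducing hd').1
end

section
/- Let K be a compact line. Then K is Valdivia if and only if there is a family 𝒜 of open Fσ intervals in K such that (a) 𝒜 separates the points of K, i.e. for all distinct x, y ∈ K there is I ∈ 𝒜 containing exactly one of x, y, and (b) each x ∈ G(K) belongs to only countably many members of 𝒜. Moreover, for any family 𝒜 satisfying (a) and (b), one has G(K) = {x ∈ K : the set {I ∈ 𝒜 : x ∈ I} is countable}. -/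
universe u

open Set Filter Topology

/-- An open `Fσ` interval of `K`: an order-convex subset which is open and is a countable
union of closed sets. -/
def IsOpenFSigmaInterval (K : Type u) [TopologicalSpace K] [LinearOrder K] (I : Set K) : Prop :=
  IsOpen I ∧ (∃ F : ℕ → Set K, (∀ n, IsClosed (F n)) ∧ I = ⋃ n, F n) ∧ I.OrdConnected

/-- An injective sequence in a linear order has a strictly monotone or strictly antitone
subsequence. -/
theorem exists_strictMono_or_strictAnti_subseq {α : Type*} [LinearOrder α] {f : ℕ → α}
    (hf : Function.Injective f) :
    ∃ g : ℕ → ℕ, StrictMono g ∧ (StrictMono (f ∘ g) ∨ StrictAnti (f ∘ g)) := by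
  obtain ⟨g, hg⟩ := exists_increasing_or_nonincreasing_subseq (· < ·) f
  refine ⟨g, g.strictMono, hg.imp (fun h m n hmn => h m n hmn) fun h m n hmn => ?_⟩
  exact lt_of_le_of_ne (not_lt.1 (h m n hmn))
    fun h' => hmn.ne' (g.injective (hf h'))

section CompactLine

variable {K : Type*} [TopologicalSpace K] [LinearOrder K] [OrderTopology K] [CompactSpace K]

theorem StrictMono.exists_isLUB_tendsto_of_compactSpace {f : ℕ → K} (hf : StrictMono f) :
    ∃ x, IsLUB (range f) x ∧ Tendsto f atTop (𝓝 x) := by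
  obtain ⟨x, -, hx⟩ := (isClosed_closure (s := range f)).isCompact.exists_isLUB
    (range_nonempty f).closure
  rw [IsLUB, upperBounds_closure] at hx
  exact ⟨x, hx, tendsto_atTop_isLUB hf.monotone hx⟩

theorem Function.Injective.exists_subseq_tendsto_of_compactLine {f : ℕ → K}
    (hf : Function.Injective f) :
    ∃ g : ℕ → ℕ, StrictMono g ∧ ∃ x, Tendsto (f ∘ g) atTop (𝓝 x) := by
  obtain ⟨g, hg, h | h⟩ := exists_strictMono_or_strictAnti_subseq hf
  · exact ⟨g, hg, h.exists_isLUB_tendsto_of_compactSpace.imp fun _ => And.right⟩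
  · have : CompactSpace Kᵒᵈ := ‹CompactSpace K›
    have h' : StrictMono (OrderDual.toDual ∘ f ∘ g) := fun m n hmn => h hmn
    obtain ⟨x, -, hx⟩ := h'.exists_isLUB_tendsto_of_compactSpace
    exact ⟨g, hg, OrderDual.ofDual x, hx⟩

end CompactLine

section GSet

variable {K : Type u} [TopologicalSpace K] [LinearOrder K] [OrderTopology K]

theorem dense_GSet [CompactSpace K] : Dense (GSet K) := by
  rw [dense_iff_inter_open]
  rintro U hU ⟨u, hu⟩
  by_cases hiso : IsOpen ({u} : Set K)
  · exact ⟨u, hu, Or.inl hiso⟩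
  have : (𝓝[≠] u).NeBot := by
    rw [neBot_iff, Ne, ← isOpen_singleton_iff_punctured_nhds]
    exact hiso
  obtain ⟨N, hN, hNc, hNU⟩ := exists_mem_nhds_isClosed_subset (hU.mem_nhds hu)
  have hinf := infinite_of_mem_nhds u hN
  have hinj : Function.Injective fun n => (hinf.natEmbedding N n : K) :=
    Subtype.val_injective.comp (hinf.natEmbedding N).injective
  obtain ⟨g, hg, x, hx⟩ := hinj.exists_subseq_tendsto_of_compactLine
  refine ⟨x, hNU (hNc.mem_of_tendsto hx (Eventually.of_forall fun n => ?_)),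
    Or.inr ⟨_, hinj.comp hg.injective, hx⟩⟩
  exact (hinf.natEmbedding N (g n)).2

theorem exists_lt_forall_le_of_notMem_GSet {x : K} (hx : x ∉ GSet K) [(𝓝[<] x).NeBot]
    (c : ℕ → K) (hc : ∀ n, c n < x) : ∃ b < x, ∀ n, c n ≤ b := by
  by_contra! H
  have hstep : ∀ (y : Iio x) (n : ℕ), ∃ z : Iio x, y < z ∧ c n < z := by
    rintro ⟨y, hy⟩ n
    obtain ⟨z, hz, hzx⟩ := Filter.nonempty_of_mem
      (Ioo_mem_nhdsLT (max_lt hy (hc n)))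
    exact ⟨⟨z, hzx⟩, (le_max_left y (c n)).trans_lt hz, (le_max_right y (c n)).trans_lt hz⟩
  choose s hs hsc using hstep
  let f : ℕ → Iio x := fun n => Nat.rec ⟨c 0, hc 0⟩ (fun n y => s y n) n
  have hf : StrictMono fun n => (f n).1 :=
    strictMono_nat_of_lt_succ fun n => hs (f n) n
  have hlub : IsLUB (range fun n => (f n).1) x := by
    refine ⟨?_, fun b hb => ?_⟩
    · rintro _ ⟨n, rfl⟩
      exact (f n).2.le
    · by_contra! hbx
      obtain ⟨n, hn⟩ := H b hbx
      exact absurd (hb ⟨n + 1, rfl⟩) (not_le.2 (hn.trans (hsc (f n) n)))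
  exact hx (Or.inr ⟨_, hf.injective, tendsto_atTop_isLUB hf.monotone hlub⟩)

theorem Set.Countable.exists_lt_forall_of_notMem_GSet {ι : Type*} {S : Set ι} (hS : S.Countable)
    {x : K} (hx : x ∉ GSet K) [(𝓝[<] x).NeBot] {p : ι → K → Prop}
    (hp : ∀ i ∈ S, ∃ c < x, ∀ z, c < z → z < x → p i z) :
    ∃ b < x, ∀ z, b < z → z < x → ∀ i ∈ S, p i z := by
  rcases S.eq_empty_or_nonempty with rfl | hne
  · obtain ⟨b, hb⟩ := Filter.nonempty_of_mem (self_mem_nhdsWithin (a := x) (s := Iio x))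
    exact ⟨b, hb, by simp⟩
  obtain ⟨e, rfl⟩ := hS.exists_eq_range hne
  choose c hc hcp using fun n => hp (e n) ⟨n, rfl⟩
  obtain ⟨b, hb, hcb⟩ := exists_lt_forall_le_of_notMem_GSet hx c hc
  refine ⟨b, hb, ?_⟩
  rintro z hbz hzx _ ⟨n, rfl⟩
  exact hcp n z ((hcb n).trans_lt hbz) hzx

theorem exists_lt_Ioo_subset_of_isOpen {x : K} [(𝓝[<] x).NeBot] {I : Set K} (hI : IsOpen I)
    (hxI : x ∈ I) : ∃ c < x, ∀ z, c < z → z < x → z ∈ I := by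
  obtain ⟨b, hb⟩ := Filter.nonempty_of_mem (self_mem_nhdsWithin (a := x) (s := Iio x))
  obtain ⟨c, hc, hcI⟩ := exists_Ioc_subset_of_mem_nhds (hI.mem_nhds hxI) ⟨b, hb⟩
  exact ⟨c, hc, fun z hz hzx => hcI ⟨hz, hzx.le⟩⟩

theorem not_countable_of_notMem_GSet_of_nhdsLT_neBot [CompactSpace K] {𝒜 : Set (Set K)}
    (hopen : ∀ I ∈ 𝒜, IsOpen I)
    (hsigma : ∀ I ∈ 𝒜, ∃ F : ℕ → Set K, (∀ n, IsClosed (F n)) ∧ I = ⋃ n, F n)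
    (hsep : ∀ x y : K, x ≠ y → ∃ I ∈ 𝒜, (x ∈ I ∧ y ∉ I) ∨ (y ∈ I ∧ x ∉ I))
    (hG : ∀ x ∈ GSet K, {I : Set K | I ∈ 𝒜 ∧ x ∈ I}.Countable)
    {x : K} (hx : x ∉ GSet K) [(𝓝[<] x).NeBot] :
    ¬ {I : Set K | I ∈ 𝒜 ∧ x ∈ I}.Countable := by
  intro hcount
  obtain ⟨a, hax, ha⟩ := hcount.exists_lt_forall_of_notMem_GSet hx (p := fun I z => z ∈ I)
    fun I hI => exists_lt_Ioo_subset_of_isOpen (hopen I hI.1) hI.2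
  have havoid : ∀ I ∈ 𝒜, x ∉ I → ∃ c < x, ∀ z, c < z → z < x → z ∉ I := by
    intro I hI hxI
    obtain ⟨F, hF, rfl⟩ := hsigma I hI
    obtain ⟨b, hb, hbF⟩ := (countable_univ (α := ℕ)).exists_lt_forall_of_notMem_GSet hx
      (p := fun n z => z ∉ F n) fun n _ =>
        exists_lt_Ioo_subset_of_isOpen (hF n).isOpen_compl fun h => hxI (mem_iUnion_of_mem n h)
    refine ⟨b, hb, fun z hbz hzx hz => ?_⟩
    obtain ⟨n, hn⟩ := mem_iUnion.1 hz
    exact hbF z hbz hzx n (mem_univ n) hn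
  have hbetween : ∀ b < x, ∃ z ∈ GSet K, b < z ∧ z < x := by
    intro b hb
    obtain ⟨z, hz, hzG⟩ := dense_GSet.inter_open_nonempty _ isOpen_Ioo
      (Filter.nonempty_of_mem (Ioo_mem_nhdsLT hb))
    exact ⟨z, hzG, hz⟩
  have hstep : ∀ y : {y : K // y ∈ GSet K ∧ a < y ∧ y < x},
      ∃ z : {z : K // z ∈ GSet K ∧ a < z ∧ z < x},
        y < z ∧ ∀ I ∈ 𝒜, (y : K) ∈ I → x ∉ I → (z : K) ∉ I := by
    rintro ⟨y, hyG, hay, hyx⟩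
    have hS : {I : Set K | (I ∈ 𝒜 ∧ y ∈ I) ∧ x ∉ I}.Countable :=
      (hG y hyG).mono fun I hI => hI.1
    obtain ⟨b, hb, hbI⟩ := hS.exists_lt_forall_of_notMem_GSet hx (p := fun I z => z ∉ I)
      fun I hI => havoid I hI.1.1 hI.2
    obtain ⟨z, hzG, hz, hzx⟩ := hbetween (max b y) (max_lt hb hyx)
    have hyz := (le_max_right _ _).trans_lt hz
    exact ⟨⟨z, hzG, hay.trans hyz, hzx⟩, hyz, fun I hI hyI hxI =>
      hbI z ((le_max_left _ _).trans_lt hz) hzx I ⟨⟨hI, hyI⟩, hxI⟩⟩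
  choose s hs hsI using hstep
  obtain ⟨y₀, hy₀⟩ := hbetween a hax
  let f : ℕ → {y : K // y ∈ GSet K ∧ a < y ∧ y < x} := fun n => Nat.rec ⟨y₀, hy₀⟩ (fun _ => s) n
  have hf : StrictMono fun n => (f n).1 :=
    strictMono_nat_of_lt_succ fun n => hs (f n)
  obtain ⟨y, hylub, hy⟩ := hf.exists_isLUB_tendsto_of_compactSpace
  obtain ⟨b, hb, hfb⟩ := exists_lt_forall_le_of_notMem_GSet hx _ fun n => (f n).2.2.2
  have hyx : y < x := (hylub.2 (by rintro _ ⟨n, rfl⟩; exact hfb n)).trans_lt hb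
  have hay : a < y := (f 0).2.2.1.trans_le (hylub.1 ⟨0, rfl⟩)
  obtain ⟨I, hI, ⟨hxI, hyI⟩ | ⟨hyI, hxI⟩⟩ := hsep x y hyx.ne'
  · exact hyI (ha y hay hyx I ⟨hI, hxI⟩)
  · obtain ⟨n, hn⟩ := eventually_atTop.1 (hy.eventually_mem ((hopen I hI).mem_nhds hyI))
    exact hsI (f n) I hI (hn n le_rfl) hxI (hn (n + 1) n.le_succ)

theorem GSet_eq_setOf_countable [CompactSpace K] {𝒜 : Set (Set K)}
    (hopen : ∀ I ∈ 𝒜, IsOpen I)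
    (hsigma : ∀ I ∈ 𝒜, ∃ F : ℕ → Set K, (∀ n, IsClosed (F n)) ∧ I = ⋃ n, F n)
    (hsep : ∀ x y : K, x ≠ y → ∃ I ∈ 𝒜, (x ∈ I ∧ y ∉ I) ∨ (y ∈ I ∧ x ∉ I))
    (hG : ∀ x ∈ GSet K, {I : Set K | I ∈ 𝒜 ∧ x ∈ I}.Countable) :
    GSet K = {x : K | {I : Set K | I ∈ 𝒜 ∧ x ∈ I}.Countable} := by
  refine Subset.antisymm hG fun x hcount => ?_
  by_contra hx
  have hne : (𝓝[≠] x).NeBot := by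
    rw [neBot_iff, Ne, ← isOpen_singleton_iff_punctured_nhds]
    exact fun h => hx (Or.inl h)
  rw [← Iio_union_Ioi, nhdsWithin_union, sup_neBot] at hne
  rcases hne with hne | hne
  · exact not_countable_of_notMem_GSet_of_nhdsLT_neBot hopen hsigma hsep hG hx hcount
  · have : CompactSpace Kᵒᵈ := ‹CompactSpace K›
    exact @not_countable_of_notMem_GSet_of_nhdsLT_neBot Kᵒᵈ _ _ _ _ 𝒜 hopen hsigma hsep hG x hx
      hne hcount

theorem mem_of_mem_GSet_of_dense {D : Set K} (hD : Dense D)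
    (hseq : ∀ (d : ℕ → K) (x : K), (∀ n, d n ∈ D) → Tendsto d atTop (𝓝 x) → x ∈ D)
    {x : K} (hx : x ∈ GSet K) : x ∈ D := by
  rcases hx with hx | ⟨f, hf, hfx⟩
  · obtain ⟨y, rfl, hy⟩ := hD.inter_open_nonempty _ hx (singleton_nonempty x)
    exact hy
  obtain ⟨g, hg, hmono⟩ := exists_strictMono_or_strictAnti_subseq hf
  have hlim : ∀ k, Tendsto (fun n => (f ∘ g) (n + k)) atTop (𝓝 x) := fun k =>
    (hfx.comp hg.tendsto_atTop).comp (tendsto_add_atTop_nat k)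
  rcases hmono with hmono | hanti
  · have hex : ∀ n, ∃ d ∈ D, (f ∘ g) (n + 0) < d ∧ d < (f ∘ g) (n + 2) := fun n => by
      obtain ⟨d, hd, hdD⟩ := hD.inter_open_nonempty _ isOpen_Ioo
        ⟨(f ∘ g) (n + 1), hmono (by omega : n + 0 < n + 1), hmono (by omega : n + 1 < n + 2)⟩
      exact ⟨d, hdD, hd⟩
    choose d hdD h₁ h₂ using hex
    exact hseq d x hdD (tendsto_of_tendsto_of_tendsto_of_le_of_le (hlim 0) (hlim 2)
      (fun n => (h₁ n).le) fun n => (h₂ n).le)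
  · have hex : ∀ n, ∃ d ∈ D, (f ∘ g) (n + 2) < d ∧ d < (f ∘ g) (n + 0) := fun n => by
      obtain ⟨d, hd, hdD⟩ := hD.inter_open_nonempty _ isOpen_Ioo
        ⟨(f ∘ g) (n + 1), hanti (by omega : n + 1 < n + 2), hanti (by omega : n + 0 < n + 1)⟩
      exact ⟨d, hdD, hd⟩
    choose d hdD h₁ h₂ using hex
    exact hseq d x hdD (tendsto_of_tendsto_of_tendsto_of_le_of_le (hlim 2) (hlim 0)
      (fun n => (h₁ n).le) fun n => (h₂ n).le)

end GSet

section OrdConnectedComponent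

variable {K : Type u} [TopologicalSpace K] [LinearOrder K] [OrderTopology K]

theorem IsOpen.ordConnectedComponent {U : Set K} (hU : IsOpen U) (x : K) :
    IsOpen (U.ordConnectedComponent x) := by
  rw [isOpen_iff_mem_nhds]
  intro y hy
  rw [ordConnectedComponent_eq hy]
  exact ordConnectedComponent_mem_nhds.2 (hU.mem_nhds (ordConnectedComponent_subset hy))

theorem IsClosed.inter_ordConnectedComponent {U F : Set K} (hU : IsOpen U) (hF : IsClosed F)
    (hFU : F ⊆ U) (x : K) : IsClosed (F ∩ U.ordConnectedComponent x) := by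
  have : F ∩ U.ordConnectedComponent x =
      F ∩ (⋃ y ∈ U \ U.ordConnectedComponent x, U.ordConnectedComponent y)ᶜ := by
    ext z
    simp only [mem_inter_iff, mem_compl_iff, mem_iUnion, not_exists, and_congr_right_iff]
    refine fun hz => ⟨fun hzx y hy hzy => hy.2 ?_, fun h => ?_⟩
    · rw [ordConnectedComponent_eq hzx, ← ordConnectedComponent_eq hzy]
      exact self_mem_ordConnectedComponent.2 hy.1
    · by_contra hzx
      exact h z ⟨hFU hz, hzx⟩ (self_mem_ordConnectedComponent.2 (hFU hz))
  rw [this]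
  exact hF.inter (isOpen_biUnion fun y _ => hU.ordConnectedComponent y).isClosed_compl

theorem isOpenFSigmaInterval_ordConnectedComponent {U : Set K} (hU : IsOpen U) {F : ℕ → Set K}
    (hF : ∀ n, IsClosed (F n)) (hUF : U = ⋃ n, F n) (x : K) :
    IsOpenFSigmaInterval K (U.ordConnectedComponent x) := by
  refine ⟨hU.ordConnectedComponent x, ⟨fun n => F n ∩ U.ordConnectedComponent x,
    fun n => (hF n).inter_ordConnectedComponent hU (hUF ▸ subset_iUnion F n) x, ?_⟩,
    inferInstance⟩
  rw [← iUnion_inter, ← hUF, inter_eq_right.2 ordConnectedComponent_subset]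

end OrdConnectedComponent

theorem Real.exists_rat_Ioo_mem_notMem {a b : ℝ} (hab : a ≠ b) :
    ∃ q : ℚ × ℚ, (0 : ℝ) ∉ Ioo (q.1 : ℝ) q.2 ∧
      ((a ∈ Ioo (q.1 : ℝ) q.2 ∧ b ∉ Ioo (q.1 : ℝ) q.2) ∨
        (b ∈ Ioo (q.1 : ℝ) q.2 ∧ a ∉ Ioo (q.1 : ℝ) q.2)) := by
  wlog h : a < b generalizing a b
  · exact (this hab.symm (lt_of_le_of_ne (not_lt.1 h) hab.symm)).imp fun q hq => ⟨hq.1, hq.2.symm⟩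
  rcases lt_or_ge 0 b with hb | hb
  · obtain ⟨r, hr, hrb⟩ := exists_rat_btwn (max_lt h hb)
    obtain ⟨s, hs⟩ := exists_rat_gt b
    rw [max_lt_iff] at hr
    exact ⟨(r, s), fun h => hr.2.not_gt h.1, Or.inr ⟨⟨hrb, hs⟩, fun h => hr.1.not_gt h.1⟩⟩
  · obtain ⟨s, has, hs⟩ := exists_rat_btwn h
    obtain ⟨r, hr⟩ := exists_rat_lt a
    exact ⟨(r, s), fun h => (hs.trans_le hb).not_gt h.2,
      Or.inl ⟨⟨hr, has⟩, fun h => hs.not_gt h.2⟩⟩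

section Valdivia

variable {K : Type u} [TopologicalSpace K] [LinearOrder K] [OrderTopology K]

theorem IsValdivia.exists_separating_family (hK : IsValdivia K) :
    ∃ 𝒜 : Set (Set K), (∀ I ∈ 𝒜, IsOpenFSigmaInterval K I) ∧
      (∀ x y : K, x ≠ y → ∃ I ∈ 𝒜, (x ∈ I ∧ y ∉ I) ∨ (y ∈ I ∧ x ∉ I)) ∧
      (∀ x ∈ GSet K, {I : Set K | I ∈ 𝒜 ∧ x ∈ I}.Countable) := by
  obtain ⟨Γ, h, hemb, hdense⟩ := hK
  have hcont : ∀ γ, Continuous fun x => h x γ := continuous_pi_iff.1 hemb.continuous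
  let U : Γ × ℚ × ℚ → Set K := fun p => (fun x => h x p.1) ⁻¹' Ioo (p.2.1 : ℝ) p.2.2
  have hUopen : ∀ p, IsOpen (U p) := fun p => isOpen_Ioo.preimage (hcont p.1)
  refine ⟨{I | ∃ p x, (0 : ℝ) ∉ Ioo (p.2.1 : ℝ) p.2.2 ∧ I = (U p).ordConnectedComponent x},
    ?_, ?_, ?_⟩
  · rintro _ ⟨p, x, -, rfl⟩
    obtain ⟨F, hF, -, hUF, -⟩ :=
      (isOpen_Ioo (a := (p.2.1 : ℝ)) (b := p.2.2)).exists_iUnion_isClosed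
    refine isOpenFSigmaInterval_ordConnectedComponent (hUopen p)
      (fun n => (hF n).preimage (hcont p.1)) ?_ x
    rw [← preimage_iUnion, hUF]
  · intro x y hxy
    obtain ⟨γ, hγ⟩ := Function.ne_iff.1 (hemb.injective.ne hxy)
    obtain ⟨q, hq0, hq⟩ := Real.exists_rat_Ioo_mem_notMem hγ
    rcases hq with ⟨hx, hy⟩ | ⟨hy, hx⟩
    · exact ⟨_, ⟨(γ, q), x, hq0, rfl⟩, Or.inl ⟨self_mem_ordConnectedComponent.2 hx,
        fun h => hy (ordConnectedComponent_subset (s := U (γ, q)) h)⟩⟩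
    · exact ⟨_, ⟨(γ, q), y, hq0, rfl⟩, Or.inr ⟨self_mem_ordConnectedComponent.2 hy,
        fun h => hx (ordConnectedComponent_subset (s := U (γ, q)) h)⟩⟩
  · intro x hx
    have hxD : {γ : Γ | h x γ ≠ 0}.Countable := by
      refine mem_of_mem_GSet_of_dense hdense (fun d y hd hdy => ?_) hx
      refine (countable_iUnion hd).mono fun γ hγ => ?_
      by_contra hzero
      simp only [mem_iUnion, mem_ofPred_eq, not_exists, not_not] at hzero
      refine hγ (tendsto_nhds_unique (((hcont γ).tendsto y).comp hdy) ?_)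
      simp [Function.comp_def, hzero]
    refine ((hxD.prod (countable_univ (α := ℚ × ℚ))).image
      fun p => (U p).ordConnectedComponent x).mono ?_
    rintro _ ⟨⟨p, y, hp, rfl⟩, hxy⟩
    refine ⟨p, ⟨fun h0 => hp ?_, mem_univ _⟩, (ordConnectedComponent_eq hxy).symm⟩
    exact h0 ▸ ordConnectedComponent_subset (s := U p) hxy

theorem IsValdivia.of_separating_family [CompactSpace K] {𝒜 : Set (Set K)}
    (hopen : ∀ I ∈ 𝒜, IsOpen I)
    (hsigma : ∀ I ∈ 𝒜, ∃ F : ℕ → Set K, (∀ n, IsClosed (F n)) ∧ I = ⋃ n, F n)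
    (hsep : ∀ x y : K, x ≠ y → ∃ I ∈ 𝒜, (x ∈ I ∧ y ∉ I) ∨ (y ∈ I ∧ x ∉ I))
    (hG : ∀ x ∈ GSet K, {I : Set K | I ∈ 𝒜 ∧ x ∈ I}.Countable) : IsValdivia K := by
  choose F hF hIF using fun I : 𝒜 => hsigma I I.2
  have hfun : ∀ p : 𝒜 × ℕ, ∃ f : C(K, ℝ), EqOn f 0 (p.1 : Set K)ᶜ ∧ EqOn f 1 (F p.1 p.2) := by
    rintro ⟨I, n⟩
    obtain ⟨f, h₀, h₁, -⟩ := exists_continuous_zero_one_of_isClosed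
      (hopen I I.2).isClosed_compl (hF I n)
      (disjoint_compl_left_iff_subset.2 ((subset_iUnion (F I) n).trans (hIF I).ge))
    exact ⟨f, h₀, h₁⟩
  choose f hf₀ hf₁ using hfun
  have hinj : ∀ x y : K, (∃ I ∈ 𝒜, x ∈ I ∧ y ∉ I) → ∃ p, f p x ≠ f p y := by
    rintro x y ⟨I, hI, hx, hy⟩
    obtain ⟨n, hn⟩ := mem_iUnion.1 ((hIF ⟨I, hI⟩).subset hx)
    exact ⟨(⟨I, hI⟩, n), by rw [hf₁ _ hn, hf₀ (⟨I, hI⟩, n) hy]; simp⟩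
  refine ⟨𝒜 × ℕ, fun x p => f p x, Continuous.isClosedEmbedding
    (continuous_pi fun p => (f p).continuous) (fun x y hxy => ?_) |>.isEmbedding,
    dense_GSet.mono fun x hx => ?_⟩
  · by_contra hne
    obtain ⟨I, hI, h | h⟩ := hsep x y hne
    · obtain ⟨p, hp⟩ := hinj x y ⟨I, hI, h⟩
      exact hp (congrFun hxy p)
    · obtain ⟨p, hp⟩ := hinj y x ⟨I, hI, h⟩
      exact hp (congrFun hxy p).symm
  · have hc : {I : 𝒜 | x ∈ (I : Set K)}.Countable :=
      ((hG x hx).preimage Subtype.val_injective).mono fun I hI =>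
        show (I : Set K) ∈ 𝒜 ∧ x ∈ (I : Set K) from ⟨I.2, hI⟩
    refine (hc.prod (countable_univ (α := ℕ))).mono fun p hp => mem_prod.2 ⟨?_, mem_univ _⟩
    by_contra hxp
    exact hp (hf₀ p hxp)

end Valdivia

theorem valdivia_iff_separating_family (K : Type u) [TopologicalSpace K] [LinearOrder K]
    [OrderTopology K] [CompactSpace K] :
    (IsValdivia K ↔
      ∃ 𝒜 : Set (Set K), (∀ I ∈ 𝒜, IsOpenFSigmaInterval K I) ∧
        (∀ x y : K, x ≠ y → ∃ I ∈ 𝒜, (x ∈ I ∧ y ∉ I) ∨ (y ∈ I ∧ x ∉ I)) ∧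
        (∀ x ∈ GSet K, {I : Set K | I ∈ 𝒜 ∧ x ∈ I}.Countable)) ∧
      ∀ 𝒜 : Set (Set K), (∀ I ∈ 𝒜, IsOpenFSigmaInterval K I) →
        (∀ x y : K, x ≠ y → ∃ I ∈ 𝒜, (x ∈ I ∧ y ∉ I) ∨ (y ∈ I ∧ x ∉ I)) →
        (∀ x ∈ GSet K, {I : Set K | I ∈ 𝒜 ∧ x ∈ I}.Countable) →
        GSet K = {x : K | {I : Set K | I ∈ 𝒜 ∧ x ∈ I}.Countable} := by
  refine ⟨⟨IsValdivia.exists_separating_family, ?_⟩, ?_⟩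
  · rintro ⟨𝒜, hI, hsep, hG⟩
    exact .of_separating_family (fun I h => (hI I h).1) (fun I h => (hI I h).2.1) hsep hG
  · intro 𝒜 hI hsep hG
    exact GSet_eq_setOf_countable (fun I h => (hI I h).1) (fun I h => (hI I h).2.1) hsep hG
end

section
/- Let K be a compact line which is Valdivia. Then every closed subset of K (with the subspace topology) is Valdivia. -/
universe u

open Set Filter Topology

/-- Cutting a continuous function down to an order-connected component of its support leaves it
continuous. -/
theorem continuous_indicator_ordConnectedComponent {K : Type u} [TopologicalSpace K]
    [LinearOrder K] [OrderTopology K] {f : K → ℝ} (hf : Continuous f) (k : K) :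
    Continuous ((ordConnectedComponent (Function.support f) k).indicator f) := by
  have hopen : IsOpen (Function.support f) := isOpen_ne_fun hf continuous_const
  refine hf.indicator fun a ha => ?_
  by_contra hfa
  have hnhds : ordConnectedComponent (Function.support f) a ∈ 𝓝 a :=
    ordConnectedComponent_mem_nhds.2 (hopen.mem_nhds hfa)
  obtain ⟨b, hba, hbk⟩ := mem_closure_iff_nhds.1 (frontier_subset_closure ha) _ hnhds
  have heq : ordConnectedComponent (Function.support f) a =
      ordConnectedComponent (Function.support f) k :=
    (ordConnectedComponent_eq hba).trans (ordConnectedComponent_eq hbk).symm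
  rw [heq] at hnhds
  exact ha.2 (mem_interior_iff_mem_nhds.2 hnhds)

/-- On a line, the coordinate functions of a Valdivia embedding may be replaced by functions
with order-connected support. -/
theorem IsValdivia.exists_ordConnected_support {K : Type u} [TopologicalSpace K] [LinearOrder K]
    [OrderTopology K] (hK : IsValdivia K) :
    ∃ (Γ : Type u) (g : Γ → K → ℝ), (∀ i, Continuous (g i)) ∧
      (∀ i, OrdConnected (Function.support (g i))) ∧
      (∀ x y, x ≠ y → ∃ i, g i x ≠ g i y) ∧ Dense {x : K | {i | g i x ≠ 0}.Countable} := by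
  obtain ⟨Γ, h, hemb, hdense⟩ := hK
  have hcont (γ : Γ) : Continuous fun x => h x γ := (continuous_apply γ).comp hemb.continuous
  let c (γ : Γ) (k : K) : Set K := ordConnectedComponent (Function.support fun x => h x γ) k
  have hc {γ : Γ} {k x : K} (hx : x ∈ c γ k) : c γ k = c γ x := ordConnectedComponent_eq hx
  let ι : Type u := Set.range fun p : Γ × K => (p.1, c p.1 p.2)
  refine ⟨ι, fun p => p.1.2.indicator fun x => h x p.1.1, ?_, ?_, ?_, ?_⟩
  · rintro ⟨_, ⟨γ, k⟩, rfl⟩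
    exact continuous_indicator_ordConnectedComponent (hcont γ) k
  · rintro ⟨_, ⟨γ, k⟩, rfl⟩
    have hsub : c γ k ⊆ Function.support fun x => h x γ := ordConnectedComponent_subset
    simp only [Set.support_indicator]
    rw [Set.inter_eq_left.2 hsub]
    exact inferInstanceAs (OrdConnected (ordConnectedComponent _ _))
  · have key (x y : K) (γ : Γ) (hxy : h x γ ≠ h y γ) (hx : h x γ ≠ 0) :
        ∃ p : ι, p.1.2.indicator (fun x => h x p.1.1) x ≠
          p.1.2.indicator (fun x => h x p.1.1) y := by
      refine ⟨⟨(γ, c γ x), (γ, x), rfl⟩, ?_⟩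
      have hxc : x ∈ c γ x := self_mem_ordConnectedComponent.2 hx
      simp only [Set.indicator_of_mem hxc]
      by_cases hy : y ∈ c γ x
      · simpa only [Set.indicator_of_mem hy] using hxy
      · simpa only [Set.indicator_of_notMem hy] using hx
    intro x y hne
    obtain ⟨γ, hγ⟩ := Function.ne_iff.1 (hemb.injective.ne hne)
    by_cases hx : h x γ = 0
    · obtain ⟨p, hp⟩ := key y x γ hγ.symm fun hy => hγ (hx.trans hy.symm)
      exact ⟨p, hp.symm⟩
    · exact key x y γ hγ hx
  · refine hdense.mono fun x hx => ?_
    refine (Set.Countable.image hx fun γ => (⟨(γ, c γ x), (γ, x), rfl⟩ : ι)).mono ?_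
    rintro ⟨_, ⟨γ, k⟩, rfl⟩ hp
    obtain ⟨hxk, hx0⟩ := Set.indicator_apply_ne_zero.1 hp
    exact ⟨γ, hx0, Subtype.ext (Prod.ext rfl (hc hxk).symm)⟩

/-- The set of points at which only countably many of the given continuous functions are nonzero
is closed under limits of its countable subsets. -/
theorem countable_ne_zero_of_mem_closure {X ι : Type*} [TopologicalSpace X] {g : ι → X → ℝ}
    (hg : ∀ i, Continuous (g i)) {E : Set X} (hE : E.Countable)
    (hED : ∀ x ∈ E, {i | g i x ≠ 0}.Countable) {z : X} (hz : z ∈ closure E) :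
    {i | g i z ≠ 0}.Countable := by
  refine (hE.biUnion hED).mono fun i hi => ?_
  obtain ⟨x, hxi, hxE⟩ := mem_closure_iff.1 hz _ (isOpen_ne_fun (hg i) continuous_const) hi
  exact Set.mem_biUnion hxE hxi

/-- In a line with a dense set `D`, accumulation points of countable sets are limits of countable
subsets of `D`. -/
theorem exists_countable_subset_mem_closure_of_accPt {K : Type*} [TopologicalSpace K]
    [LinearOrder K] [OrderTopology K] {D : Set K} (hD : Dense D) {C : Set K} (hC : C.Countable)
    {z : K} (hz : AccPt z (𝓟 C)) : ∃ E ⊆ D, E.Countable ∧ z ∈ closure E := by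
  have hsel (p : K × K) : ∃ d, (Ioo p.1 p.2).Nonempty → d ∈ Ioo p.1 p.2 ∧ d ∈ D := by
    by_cases hp : (Ioo p.1 p.2).Nonempty
    · obtain ⟨d, hd⟩ := hD.inter_open_nonempty _ isOpen_Ioo hp
      exact ⟨d, fun _ => hd⟩
    · exact ⟨p.1, fun h => absurd h hp⟩
  choose d hd using hsel
  refine ⟨d '' {p | p ∈ C ×ˢ C ∧ (Ioo p.1 p.2).Nonempty}, ?_, ?_, ?_⟩
  · rintro _ ⟨p, hp, rfl⟩
    exact (hd p hp.2).2
  · exact ((hC.prod hC).mono fun p hp => hp.1).image d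
  · refine mem_closure_iff_nhds.2 fun t ht => ?_
    have hinf : (ordConnectedComponent t z ∩ C).Infinite :=
      Set.Infinite.of_accPt (hz.nhds_inter (ordConnectedComponent_mem_nhds.2 ht))
    obtain ⟨s, hs, hcard⟩ := hinf.exists_subset_card_eq 3
    let e := s.orderIsoOfFin hcard
    have hlt₁ : (e 0 : K) < e 1 := e.strictMono (by decide)
    have hlt₂ : (e 1 : K) < e 2 := e.strictMono (by decide)
    have hne : (Ioo (e 0 : K) (e 2)).Nonempty := ⟨e 1, hlt₁, hlt₂⟩
    have hmem := (hd (e 0, e 2) hne).1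
    refine ⟨d (e 0, e 2), ?_, (e 0, e 2), ⟨⟨(hs (e 0).2).2, (hs (e 2).2).2⟩, hne⟩, rfl⟩
    exact ordConnectedComponent_subset
      (OrdConnected.out inferInstance (hs (e 0).2).1 (hs (e 2).2).1 ⟨hmem.1.le, hmem.2.le⟩)

theorem isValdivia_of_closedSubset (K : Type u) [TopologicalSpace K] [LinearOrder K]
    [OrderTopology K] [CompactSpace K] (hK : IsValdivia K) (F : Set K) (hF : IsClosed F) :
    IsValdivia F := by
  obtain ⟨Γ, g, hg, hconv, hsep, hdense⟩ := hK.exists_ordConnected_support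
  have : CompactSpace F := isCompact_iff_compactSpace.1 hF.isCompact
  set D : Set K := {x : K | {i | g i x ≠ 0}.Countable}
  let S (i : Γ) : Set F := {x | g i x ≠ 0}
  let B : Set F := {y | IsOpen {y} ∧ (y : K) ∉ D}
  let R (i : Γ) : Set F := {y | y ∈ B ∧ (IsLeast (S i) y ∨ IsGreatest (S i) y)}
  have hR (i : Γ) : IsClopen (R i) := by
    constructor
    · refine Set.Finite.isClosed ?_
      have h₁ : {y | IsLeast (S i) y}.Subsingleton := fun a ha b hb => ha.unique hb
      have h₂ : {y | IsGreatest (S i) y}.Subsingleton := fun a ha b hb => ha.unique hb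
      exact (h₁.finite.union h₂.finite).subset fun y hy => hy.2
    · exact isOpen_iff_mem_nhds.2 fun y hy =>
        Filter.mem_of_superset (hy.1.1.mem_nhds rfl) (Set.singleton_subset_iff.2 hy)
  have hBsing (y : F) : IsClopen (B ∩ {y}) := by
    by_cases hy : y ∈ B
    · rw [Set.inter_eq_right.2 (Set.singleton_subset_iff.2 hy)]
      exact ⟨isClosed_singleton, hy.1⟩
    · rw [Set.inter_singleton_eq_empty.2 hy]
      exact isClopen_empty
  let H : F → Γ ⊕ F → ℝ := fun x => Sum.elim
    (fun i => (R i)ᶜ.indicator (fun x : F => g i x) x)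
    (fun y => (B ∩ {y}).indicator (fun _ => 1) x)
  have hcont : Continuous H := by
    refine continuous_pi ?_
    rintro (i | y)
    · refine ((hg i).comp continuous_subtype_val).indicator fun a ha => ?_
      simp [(hR i).compl.frontier_eq] at ha
    · refine continuous_const.indicator fun a ha => ?_
      simp [(hBsing y).frontier_eq] at ha
  have hinj : Function.Injective H := by
    have hB {x y : F} (hx : x ∈ B) (hxy : H x = H y) : x = y := by
      have h := congrFun hxy (Sum.inr x)
      by_contra hne
      have hy : y ∉ B ∩ {x} := fun hy => hne hy.2.symm
      have hx' : x ∈ B ∩ {x} := ⟨hx, rfl⟩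
      simp only [H, Sum.elim_inr, Set.indicator_of_mem hx', Set.indicator_of_notMem hy] at h
      exact one_ne_zero h
    intro x y hxy
    by_cases hx : x ∈ B
    · exact hB hx hxy
    by_cases hy : y ∈ B
    · exact (hB hy hxy.symm).symm
    by_contra hne
    obtain ⟨i, hi⟩ := hsep x y (Subtype.coe_injective.ne hne)
    have hxR : x ∈ (R i)ᶜ := fun h => hx h.1
    have hyR : y ∈ (R i)ᶜ := fun h => hy h.1
    have h := congrFun hxy (Sum.inl i)
    simp only [H, Sum.elim_inl, Set.indicator_of_mem hxR, Set.indicator_of_mem hyR] at h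
    exact hi h
  have hinl {x : F} {i : Γ} (h : H x (Sum.inl i) ≠ 0) : x ∈ (R i)ᶜ ∧ g i x ≠ 0 :=
    Set.indicator_apply_ne_zero (f := fun x : F => g i x).1 h
  have hinr {x y : F} (h : H x (Sum.inr y) ≠ 0) : x ∈ B ∩ {y} :=
    (Set.indicator_apply_ne_zero (f := fun _ : F => (1 : ℝ)).1 h).1
  have hcountD (x : F) (hx : (x : K) ∈ D) : {j | H x j ≠ 0}.Countable := by
    refine (Set.Countable.image hx Sum.inl).mono ?_
    rintro (i | y) hj
    · exact ⟨i, (hinl hj).2, rfl⟩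
    · exact absurd hx (hinr hj).1.2
  have hcountB (y : F) (hy : y ∈ B) : {j | H y j ≠ 0}.Countable := by
    obtain ⟨O, hO, hOy⟩ := isOpen_induced_iff.1 hy.1
    have hmemO (x : F) : (x : K) ∈ O ↔ x = y := by
      rw [← Set.mem_singleton_iff, ← hOy, Set.mem_preimage]
    obtain ⟨d, hdD, hdO⟩ := hdense.inter_nhds_nonempty
      (ordConnectedComponent_mem_nhds.2 (hO.mem_nhds ((hmemO y).2 rfl)))
    refine ((Set.Countable.image hdD Sum.inl).union (Set.countable_singleton (Sum.inr y))).mono ?_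
    rintro (i | x) hj
    · obtain ⟨hyR, hyi⟩ := hinl hj
      refine Or.inl ⟨i, ?_, rfl⟩
      have hnot : ¬ (IsLeast (S i) y ∨ IsGreatest (S i) y) := fun h => hyR ⟨hy, h⟩
      rw [not_or] at hnot
      rcases le_total d y with hdy | hyd
      · obtain ⟨z, hz, hzy⟩ : ∃ z ∈ S i, z < y := by
          by_contra! h
          exact hnot.1 ⟨hyi, h⟩
        have hzd : (z : K) ≤ d := by
          by_contra! h
          exact hzy.ne ((hmemO z).1 (hdO (Set.mem_uIcc.2 (Or.inr ⟨h.le, hzy.le⟩))))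
        exact (hconv i).out hz hyi ⟨hzd, hdy⟩
      · obtain ⟨z, hz, hyz⟩ : ∃ z ∈ S i, y < z := by
          by_contra! h
          exact hnot.2 ⟨hyi, h⟩
        have hdz : d ≤ (z : K) := by
          by_contra! h
          exact hyz.ne' ((hmemO z).1 (hdO (Set.mem_uIcc.2 (Or.inl ⟨hyz.le, h.le⟩))))
        exact (hconv i).out hyi hz ⟨hyd, hdz⟩
    · exact Or.inr (congrArg Sum.inr (hinr hj).2.symm)
  refine ⟨Γ ⊕ F, H, (hcont.isClosedEmbedding hinj).isEmbedding, fun y => ?_⟩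
  by_cases hyD : (y : K) ∈ D
  · exact subset_closure (hcountD y hyD)
  by_cases hiso : IsOpen {y}
  · exact subset_closure (hcountB y ⟨hiso, hyD⟩)
  refine mem_closure_iff_nhds.2 fun t ht => ?_
  obtain ⟨T, hT, hTclosed, hTt⟩ := exists_mem_nhds_isClosed_subset ht
  have hTinf : T.Infinite := by
    have : (𝓝[≠] y).NeBot := neBot_iff.2 (mt (isOpen_singleton_iff_punctured_nhds y).2 hiso)
    exact infinite_of_mem_nhds y hT
  let u : ℕ → K := fun n => (hTinf.natEmbedding T n : F)
  have hu : Function.Injective u := fun m n h =>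
    (hTinf.natEmbedding T).injective (Subtype.ext (Subtype.ext h))
  have hcompact : IsCompact (Subtype.val '' T) :=
    hTclosed.isCompact.image continuous_subtype_val
  obtain ⟨_, ⟨z, hzT, rfl⟩, hz⟩ :=
    (Set.infinite_range_of_injective hu).exists_accPt_of_subset_isCompact hcompact (by
      rintro _ ⟨n, rfl⟩
      exact ⟨_, (hTinf.natEmbedding T n).2, rfl⟩)
  obtain ⟨E, hED, hE, hzE⟩ :=
    exists_countable_subset_mem_closure_of_accPt hdense (Set.countable_range u) hz
  exact ⟨z, hTt hzT, hcountD z (countable_ne_zero_of_mem_closure hg hE hED hzE)⟩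
end

section
/- Let K be a compact line which is a continuous image of a Valdivia compact space. Then every closed subset of K (with the subspace topology) is a continuous image of a Valdivia compact space. -/
universe u

open Set Filter Topology

/-- `K` is a continuous image of a Valdivia compact space. -/
def IsValdiviaImage (K : Type u) [TopologicalSpace K] : Prop :=
  ∃ (L : Type u) (tL : TopologicalSpace L),
    @CompactSpace L tL ∧ @IsValdivia L tL ∧
      ∃ f : L → K, @Continuous L K tL _ f ∧ Function.Surjective f

/-- The points `a < b` of `F` are consecutive in `F`. -/
def IsGap {K : Type u} [LinearOrder K] (F : Set K) (a b : K) : Prop :=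
  a ∈ F ∧ b ∈ F ∧ a < b ∧ ∀ q ∈ F, q ≤ a ∨ b ≤ q

/-- Cutting an interval `[a, b]` of a compact line into two closed pieces, whose intersection is
recognised by a bump function supported in `(a, b)`. -/
theorem exists_cut {K : Type u} [TopologicalSpace K] [LinearOrder K] [OrderTopology K]
    [CompactSpace K] {a b : K} (hab : a < b) :
    ∃ (l r : K) (v : K → unitInterval), Continuous v ∧ a ≤ l ∧ l < b ∧ a < r ∧ r ≤ b ∧
      (∀ z, z ≤ l ∨ r ≤ z) ∧ (∀ z, v z ≠ 0 → z ∈ Ioo a b) ∧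
      ∀ z, r ≤ z → z ≤ l → v z = 1 := by
  rcases (Ioo a b).eq_empty_or_nonempty with he | ⟨c, hc⟩
  · refine ⟨a, b, fun _ => 0, continuous_const, le_rfl, hab, hab, le_rfl, fun z => ?_,
      fun z hz => absurd rfl hz, fun z h1 h2 => absurd (h1.trans h2) hab.not_ge⟩
    by_contra! h
    exact (he ▸ (show z ∈ Ioo a b from h) : z ∈ (∅ : Set K))
  · obtain ⟨g, hg0, hg1, hg⟩ := exists_continuous_zero_one_of_isClosed
      (isOpen_Ioo (a := a) (b := b)).isClosed_compl (isClosed_singleton (x := c))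
      (by simpa using hc)
    refine ⟨c, c, fun z => ⟨g z, hg z⟩, by fun_prop, hc.1.le, hc.2, hc.1, hc.2.le,
      fun z => le_total z c, fun z hz => ?_, fun z h1 h2 => ?_⟩
    · by_contra h
      exact hz (Subtype.ext (hg0 h))
    · obtain rfl := le_antisymm h1 h2
      exact Subtype.ext (hg1 rfl)

/-- Consecutive pairs of points of `F` determined by an interior point are unique. -/
theorem IsGap.eq_of_mem_Ioo {K : Type u} [LinearOrder K] {F : Set K} {a b a' b' z : K}
    (h : IsGap F a b) (h' : IsGap F a' b') (hz : z ∈ Ioo a b) (hz' : z ∈ Ioo a' b') :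
    a = a' ∧ b = b' := by
  obtain ⟨ha, hb, -, h⟩ := h
  obtain ⟨ha', hb', -, h'⟩ := h'
  have h1 := h a' ha'
  have h2 := h b' hb'
  have h3 := h' a ha
  have h4 := h' b hb
  obtain ⟨h5, h6⟩ := hz
  obtain ⟨h7, h8⟩ := hz'
  rcases h1 with h1 | h1 <;> rcases h2 with h2 | h2 <;> rcases h3 with h3 | h3 <;>
    rcases h4 with h4 | h4 <;> constructor <;> order

/-- Every point of a compact line can be moved to a nonempty closed subset `F` along
prescribed cuts of the gaps of `F`. -/
theorem exists_mem_compatible_with_cuts {K : Type u} [TopologicalSpace K] [LinearOrder K]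
    [OrderTopology K] [CompactSpace K] {F : Set K} (hF : IsClosed F) (hne : F.Nonempty)
    (l r : {i : K × K // IsGap F i.1 i.2} → K)
    (hal : ∀ i, i.1.1 ≤ l i) (hrb : ∀ i, r i ≤ i.1.2) (hlr : ∀ i z, z ≤ l i ∨ r i ≤ z) (z : K) :
    ∃ p ∈ F, (∀ q ∈ F, (z ≤ q ∧ p ≤ q) ∨ (q ≤ z ∧ q ≤ p)) ∧
      ∀ i, (z ≤ l i ∧ p ≤ i.1.1) ∨ (r i ≤ z ∧ i.1.2 ≤ p) := by
  by_cases hz : z ∈ F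
  · refine ⟨z, hz, fun q _ => (le_total z q).imp (fun h => ⟨h, h⟩) fun h => ⟨h, h⟩, fun i => ?_⟩
    exact (i.2.2.2.2 z hz).imp (fun h => ⟨h.trans (hal i), h⟩) fun h => ⟨(hrb i).trans h, h⟩
  rcases (F ∩ Iic z).eq_empty_or_nonempty with hD | hD
  · have hlt : ∀ q ∈ F, z < q := fun q hq => by
      by_contra! h
      exact (hD ▸ (show q ∈ F ∩ Iic z from ⟨hq, h⟩) : q ∈ (∅ : Set K))
    obtain ⟨p, hp, hmin⟩ := hF.isCompact.exists_isLeast hne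
    exact ⟨p, hp, fun q hq => Or.inl ⟨(hlt q hq).le, hmin hq⟩, fun i =>
      Or.inl ⟨(hlt _ i.2.1).le.trans (hal i), hmin i.2.1⟩⟩
  obtain ⟨a, ⟨haF, haz⟩, hmax⟩ := (hF.inter isClosed_Iic).isCompact.exists_isGreatest hD
  rcases (F ∩ Ici z).eq_empty_or_nonempty with hE | hE
  · have hlt : ∀ q ∈ F, q < z := fun q hq => by
      by_contra! h
      exact (hE ▸ (show q ∈ F ∩ Ici z from ⟨hq, h⟩) : q ∈ (∅ : Set K))
    exact ⟨a, haF, fun q hq => Or.inr ⟨(hlt q hq).le, hmax ⟨hq, (hlt q hq).le⟩⟩, fun i =>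
      Or.inr ⟨(hrb i).trans (hlt _ i.2.2.1).le, hmax ⟨i.2.2.1, (hlt _ i.2.2.1).le⟩⟩⟩
  obtain ⟨b, ⟨hbF, hzb⟩, hmin⟩ := (hF.inter isClosed_Ici).isCompact.exists_isLeast hE
  have haz' : a < z := lt_of_le_of_ne haz fun h => hz (h ▸ haF)
  have hzb' : z < b := lt_of_le_of_ne hzb fun h => hz (h ▸ hbF)
  have hgap : ∀ q ∈ F, q ≤ a ∨ b ≤ q := fun q hq =>
    (le_total q z).imp (fun h => hmax ⟨hq, h⟩) fun h => hmin ⟨hq, h⟩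
  have key : ∀ i : {i : K × K // IsGap F i.1 i.2},
      i.1 = (a, b) ∨ i.1.2 ≤ a ∨ b ≤ i.1.1 := by
    intro i
    rcases hgap _ i.2.1 with h1 | h1
    · rcases hgap _ i.2.2.1 with h2 | h2
      · exact Or.inr (Or.inl h2)
      · obtain ⟨h3, h4⟩ := i.2.eq_of_mem_Ioo ⟨haF, hbF, haz'.trans hzb', hgap⟩
          ⟨h1.trans_lt haz', hzb'.trans_le h2⟩ ⟨haz', hzb'⟩
        exact Or.inl (Prod.ext h3 h4)
    · exact Or.inr (Or.inr h1)
  rcases hlr ⟨(a, b), haF, hbF, haz'.trans hzb', hgap⟩ z with hs | hs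
  · refine ⟨a, haF, fun q hq => ?_, fun i => ?_⟩
    · exact (hgap q hq).symm.imp (fun h => ⟨hzb.trans h, by order⟩) fun h => ⟨h.trans haz, h⟩
    · rcases key i with h | h | h
      · obtain ⟨i, hi⟩ := i
        obtain rfl := h
        exact Or.inl ⟨hs, le_rfl⟩
      · exact Or.inr ⟨(hrb i).trans (h.trans haz), h⟩
      · exact Or.inl ⟨(hzb.trans h).trans (hal i), by order⟩
  · refine ⟨b, hbF, fun q hq => ?_, fun i => ?_⟩
    · exact (hgap q hq).symm.imp (fun h => ⟨hzb.trans h, h⟩) fun h => ⟨h.trans haz, by order⟩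
    · rcases key i with h | h | h
      · obtain ⟨i, hi⟩ := i
        obtain rfl := h
        exact Or.inr ⟨hs, le_rfl⟩
      · exact Or.inr ⟨(hrb i).trans (h.trans haz), by order⟩
      · exact Or.inl ⟨(hzb.trans h).trans (hal i), h⟩

/-- The triples `(z, y, p)` such that `p ∈ F` is obtained from `z` by moving it along the cuts
`Iic (l i)`, `Ici (r i)` of the gaps `i` of `F`, where `y i` remembers the side on which `z`
lies when it belongs to both pieces. -/
def CutRelation {K : Type u} [LinearOrder K] (F : Set K)
    (l r : {i : K × K // IsGap F i.1 i.2} → K)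
    (v : {i : K × K // IsGap F i.1 i.2} → K → unitInterval)
    (z : K) (y : {i : K × K // IsGap F i.1 i.2} → unitInterval) (p : K) : Prop :=
  p ∈ F ∧ (∀ q ∈ F, (z ≤ q ∧ p ≤ q) ∨ (q ≤ z ∧ q ≤ p)) ∧
    ∀ i, (z ≤ l i ∧ y i = v i z ∧ p ≤ i.1.1) ∨ (r i ≤ z ∧ y i = 0 ∧ i.1.2 ≤ p)

namespace CutRelation

variable {K : Type u} [LinearOrder K] {F : Set K}
  {l r : {i : K × K // IsGap F i.1 i.2} → K}
  {v : {i : K × K // IsGap F i.1 i.2} → K → unitInterval}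
  {z p p' : K} {y : {i : K × K // IsGap F i.1 i.2} → unitInterval}

theorem eq_of_mem (hlb : ∀ i, l i < i.1.2) (har : ∀ i, i.1.1 < r i)
    (h : CutRelation F l r v z y p) (hz : z ∈ F) : p = z := by
  obtain ⟨hp, hq, hi⟩ := h
  rcases lt_trichotomy p z with hlt | heq | hlt
  · have hg : IsGap F p z := ⟨hp, hz, hlt, fun q hqF =>
      (hq q hqF).symm.imp (fun h => h.2) fun h => h.1⟩
    rcases hi ⟨(p, z), hg⟩ with h | h
    · exact absurd h.1 (hlb ⟨(p, z), hg⟩).not_ge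
    · exact absurd h.2.2 hlt.not_ge
  · exact heq
  · have hg : IsGap F z p := ⟨hz, hp, hlt, fun q hqF =>
      (hq q hqF).symm.imp (fun h => h.1) fun h => h.2⟩
    rcases hi ⟨(z, p), hg⟩ with h | h
    · exact absurd h.2.2 hlt.not_ge
    · exact absurd h.1 (har ⟨(z, p), hg⟩).not_ge

theorem le_of_cutRelation (hlb : ∀ i, l i < i.1.2) (har : ∀ i, i.1.1 < r i)
    (hv : ∀ i z, r i ≤ z → z ≤ l i → v i z = 1)
    (h : CutRelation F l r v z y p) (h' : CutRelation F l r v z y p') : p' ≤ p := by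
  by_contra! hlt
  have hg : IsGap F p p' := by
    refine ⟨h.1, h'.1, hlt, fun q hq => ?_⟩
    by_contra! hc
    have h1 : z ≤ q := (h.2.1 q hq).elim (fun h => h.1) fun h => absurd h.2 hc.1.not_ge
    have h2 : q ≤ z := (h'.2.1 q hq).elim (fun h => absurd h.2 hc.2.not_ge) fun h => h.1
    obtain rfl := le_antisymm h1 h2
    exact hlt.ne ((h.eq_of_mem hlb har hq).trans (h'.eq_of_mem hlb har hq).symm)
  rcases h.2.2 ⟨(p, p'), hg⟩ with ⟨h1, h2, -⟩ | ⟨-, -, h1⟩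
  · rcases h'.2.2 ⟨(p, p'), hg⟩ with ⟨-, -, h3⟩ | ⟨h3, h4, -⟩
    · exact absurd h3 hlt.not_ge
    · rw [h4, hv _ _ h3 h1] at h2
      exact zero_ne_one h2
  · exact absurd h1 hlt.not_ge

theorem subsingleton_support (hv : ∀ i z, v i z ≠ 0 → z ∈ Ioo i.1.1 i.1.2)
    (h : CutRelation F l r v z y p) : {i | y i ≠ 0}.Subsingleton := by
  have key : ∀ i, y i ≠ 0 → z ∈ Ioo i.1.1 i.1.2 := fun i hi => by
    rcases h.2.2 i with h | h
    · exact hv i z (h.2.1 ▸ hi)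
    · exact absurd h.2.1 hi
  intro i hi j hj
  obtain ⟨h1, h2⟩ := i.2.eq_of_mem_Ioo j.2 (key i hi) (key j hj)
  exact Subtype.ext (Prod.ext h1 h2)

theorem isClosed [TopologicalSpace K] [OrderTopology K] {L : Type u} [TopologicalSpace L]
    {f : L → K} (hf : Continuous f) (hF : IsClosed F) (hv : ∀ i, Continuous (v i)) :
    IsClosed {w : L × ({i : K × K // IsGap F i.1 i.2} → unitInterval) × K |
      CutRelation F l r v (f w.1) w.2.1 w.2.2} := by
  simp only [CutRelation, ofPred_and, ofPred_forall, ofPred_or]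
  have hf' : Continuous fun w : L × ({i : K × K // IsGap F i.1 i.2} → unitInterval) × K =>
      f w.1 := by fun_prop
  have hp : Continuous fun w : L × ({i : K × K // IsGap F i.1 i.2} → unitInterval) × K =>
      w.2.2 := by fun_prop
  have hy : ∀ i, Continuous fun w : L × ({i : K × K // IsGap F i.1 i.2} → unitInterval) × K =>
      w.2.1 i := fun i => by fun_prop
  refine (hF.preimage hp).inter (.inter ?_ ?_)
  · exact isClosed_iInter fun q => isClosed_iInter fun _ =>
      ((isClosed_le hf' continuous_const).inter (isClosed_le hp continuous_const)).union
      ((isClosed_le continuous_const hf').inter (isClosed_le continuous_const hp))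
  · exact isClosed_iInter fun i =>
      ((isClosed_le hf' continuous_const).inter
        ((isClosed_eq (hy i) ((hv i).comp hf')).inter (isClosed_le hp continuous_const))).union
      ((isClosed_le continuous_const hf').inter
        ((isClosed_eq (hy i) continuous_const).inter (isClosed_le continuous_const hp)))

end CutRelation

theorem isValdiviaImage_of_isEmpty (K : Type u) [TopologicalSpace K] [IsEmpty K] :
    IsValdiviaImage K :=
  ⟨K, inferInstance, inferInstance, ⟨K, fun _ _ => 0, .of_subsingleton _, fun x => isEmptyElim x⟩,
    id, continuous_id, Function.surjective_id⟩

theorem isValdiviaImage_of_closedSubset (K : Type u) [TopologicalSpace K] [LinearOrder K]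
    [OrderTopology K] [CompactSpace K] (hK : IsValdiviaImage K) (F : Set K)
    (hF : IsClosed F) : IsValdiviaImage F := by
  rcases F.eq_empty_or_nonempty with rfl | hne
  · exact isValdiviaImage_of_isEmpty _
  obtain ⟨L, tL, hL, ⟨Γ, h, hh, hdense⟩, f, hf, hsurj⟩ := hK
  have : T2Space L := hh.t2Space
  choose l r v hv hal hlb har hrb hlr hv0 hv1 using
    fun i : {i : K × K // IsGap F i.1 i.2} => exists_cut i.2.2.2.1
  let I := {i : K × K // IsGap F i.1 i.2}
  let A : Set L := {x | {γ : Γ | h x γ ≠ 0}.Countable}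
  let C : Set (L × (I → unitInterval) × K) :=
    {w | CutRelation F l r v (f w.1) w.2.1 w.2.2}
  have hC : IsClosed C := CutRelation.isClosed hf hF hv
  let M := closure (C ∩ Prod.fst ⁻¹' A)
  have hMC : M ⊆ C := hC.closure_subset_iff.2 inter_subset_left
  have hMcomp : IsCompact M := isClosed_closure.isCompact
  have : CompactSpace M := isCompact_iff_compactSpace.1 hMcomp
  have hproj : Prod.fst '' M = univ := by
    have hcl : IsClosed (Prod.fst '' M) := (hMcomp.image continuous_fst).isClosed
    refine eq_univ_of_univ_subset (hdense.closure_eq.symm.subset.trans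
      (hcl.closure_subset_iff.2 fun x hx => ?_))
    obtain ⟨p, hp, hq, hi⟩ := exists_mem_compatible_with_cuts hF hne l r hal hrb hlr (f x)
    have : ∀ i, ∃ t : unitInterval, (f x ≤ l i ∧ t = v i (f x) ∧ p ≤ i.1.1) ∨
        (r i ≤ f x ∧ t = 0 ∧ i.1.2 ≤ p) := fun i =>
      (hi i).elim (fun h => ⟨_, Or.inl ⟨h.1, rfl, h.2⟩⟩) fun h => ⟨_, Or.inr ⟨h.1, rfl, h.2⟩⟩
    choose y hy using this
    exact ⟨(x, y, p), subset_closure ⟨⟨hp, hq, hy⟩, hx⟩, rfl⟩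
  let e : M → Γ ⊕ I → ℝ := fun w => Sum.elim (h w.1.1) fun i => (w.1.2.1 i : ℝ)
  have he : Continuous e := by
    have := hh.continuous
    refine continuous_pi fun j => ?_
    cases j with
    | inl γ => exact (continuous_apply γ).comp (this.comp (by fun_prop))
    | inr i =>
      exact continuous_subtype_val.comp ((continuous_apply i).comp (by fun_prop))
  have hinj : Function.Injective e := by
    rintro ⟨⟨x, y, p⟩, hw⟩ ⟨⟨x', y', p'⟩, hw'⟩ hee
    obtain rfl : x = x' := hh.injective (funext fun γ => congrFun hee (.inl γ))
    obtain rfl : y = y' := funext fun i => Subtype.ext (congrFun hee (.inr i))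
    have h1 : CutRelation F l r v (f x) y p := hMC hw
    have h2 : CutRelation F l r v (f x) y p' := hMC hw'
    obtain rfl : p = p' := le_antisymm (h2.le_of_cutRelation hlb har hv1 h1)
      (h1.le_of_cutRelation hlb har hv1 h2)
    rfl
  refine ⟨M, inferInstance, inferInstance, ⟨Γ ⊕ I, e, (he.isClosedEmbedding hinj).isEmbedding, ?_⟩,
    fun w => ⟨w.1.2.2, (hMC w.2).1⟩, by fun_prop, ?_⟩
  · rw [Subtype.dense_iff]
    refine closure_mono fun w hw => ⟨⟨w, subset_closure hw⟩, ?_, rfl⟩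
    have hsupp := CutRelation.subsingleton_support hv0 hw.1
    refine ((hw.2.image Sum.inl).union (hsupp.countable.image Sum.inr)).mono ?_
    rintro (γ | i) hj
    · exact Or.inl ⟨γ, hj, rfl⟩
    · exact Or.inr ⟨i, fun h0 => hj (congrArg Subtype.val h0), rfl⟩
  · rintro ⟨p, hp⟩
    obtain ⟨x, rfl⟩ := hsurj p
    obtain ⟨w, hw, rfl⟩ := hproj.symm.subset (mem_univ x)
    exact ⟨⟨w, hw⟩, Subtype.ext ((hMC hw).eq_of_mem hlb har hp)⟩
end

section
/- Let K be a Valdivia compact line, L a compact line, and φ : K → L an order-preserving continuous surjection. Suppose that for each y ∈ L either φ⁻¹(y) is a singleton or φ⁻¹(y) ∩ G(K) is dense in φ⁻¹(y). Then L is Valdivia. -/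
universe u

open Set Filter Topology

/-! ### Closure under a set-valued operation on finite sets -/

/-- `S` is closed under the operation `c` when `c F ⊆ S` for every finite `F ⊆ S`. -/
def IsClosedUnder {Γ : Type*} (c : Finset Γ → Set Γ) (S : Set Γ) : Prop :=
  ∀ F : Finset Γ, (F : Set Γ) ⊆ S → c F ⊆ S

/-- The smallest set containing `X` and closed under `c`. -/
def closureUnder {Γ : Type*} (c : Finset Γ → Set Γ) (X : Set Γ) : Set Γ :=
  ⋂₀ {S | IsClosedUnder c S ∧ X ⊆ S}

section ClosureUnder

variable {Γ : Type u} {c : Finset Γ → Set Γ}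

theorem isClosedUnder_univ : IsClosedUnder c univ := fun _ _ => subset_univ _

theorem subset_closureUnder (X : Set Γ) : X ⊆ closureUnder c X :=
  subset_sInter fun _ hS => hS.2

theorem closureUnder_subset {X S : Set Γ} (hS : IsClosedUnder c S) (h : X ⊆ S) :
    closureUnder c X ⊆ S :=
  sInter_subset_of_mem ⟨hS, h⟩

theorem isClosedUnder_closureUnder (X : Set Γ) : IsClosedUnder c (closureUnder c X) :=
  fun F hF => subset_sInter fun _ hS => hS.1 F (hF.trans (sInter_subset_of_mem hS))

theorem closureUnder_mono {X Y : Set Γ} (h : X ⊆ Y) : closureUnder c X ⊆ closureUnder c Y :=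
  closureUnder_subset (isClosedUnder_closureUnder Y) (h.trans (subset_closureUnder Y))

theorem isClosedUnder_iUnion {ι : Type*} [Nonempty ι] {S : ι → Set Γ}
    (hdir : Directed (· ⊆ ·) S) (hS : ∀ i, IsClosedUnder c (S i)) :
    IsClosedUnder c (⋃ i, S i) := by
  intro F hF
  obtain ⟨i, hi⟩ := hdir.exists_mem_subset_of_finset_subset_biUnion hF
  exact (hS i F hi).trans (subset_iUnion S i)

theorem mk_closureUnder_le (hc : ∀ F, (c F).Countable) {X : Set Γ} {κ : Cardinal.{u}}
    (hκ : Cardinal.aleph0 ≤ κ) (hX : Cardinal.mk X ≤ κ) :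
    Cardinal.mk (closureUnder c X) ≤ κ := by
  let step : Set Γ → Set Γ := fun Y =>
    Y ∪ ⋃ F : Finset Y, c (F.map (Function.Embedding.subtype _))
  have hstep : ∀ Y : Set Γ, Cardinal.mk Y ≤ κ → Cardinal.mk (step Y) ≤ κ := by
    intro Y hY
    refine (Cardinal.mk_union_le _ _).trans (Cardinal.add_le_of_le hκ hY ?_)
    refine (Cardinal.mk_iUnion_le _).trans (Cardinal.mul_le_of_le hκ ?_ ?_)
    · cases finite_or_infinite Y
      · exact (Cardinal.mk_le_aleph0 (α := Finset Y)).trans hκ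
      · rwa [Cardinal.mk_finset_of_infinite]
    · exact ciSup_le' fun F => ((hc _).le_aleph0).trans hκ
  have hiter : ∀ n, Cardinal.mk (step^[n] X) ≤ κ := by
    intro n
    induction n with
    | zero => exact hX
    | succ n ih => rw [Function.iterate_succ_apply']; exact hstep _ ih
  have hmono : Monotone fun n => step^[n] X := monotone_nat_of_le_succ fun n => by
    rw [Function.iterate_succ_apply']; exact subset_union_left
  have hclosed : IsClosedUnder c (⋃ n, step^[n] X) := by
    intro F hF
    obtain ⟨n, hn⟩ := hmono.directed_le.exists_mem_subset_of_finset_subset_biUnion hF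
    refine Subset.trans ?_ (subset_iUnion (fun n => step^[n] X) (n + 1))
    simp only [Function.iterate_succ_apply']
    refine Subset.trans ?_ subset_union_right
    classical
    have hF' := Finset.subtype_map_of_mem (p := (· ∈ step^[n] X)) (s := F) fun x hx => hn hx
    conv_lhs => rw [← hF']
    exact subset_iUnion (fun F : Finset (step^[n] X) =>
      c (F.map (Function.Embedding.subtype _))) _
  have hsub : closureUnder c X ⊆ ⋃ n, step^[n] X :=
    closureUnder_subset hclosed (subset_iUnion (fun n => step^[n] X) 0)
  refine (Cardinal.mk_le_mk_of_subset hsub).trans ?_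
  have := Cardinal.mk_iUnion_le_lift (fun n : ℕ => step^[n] X)
  simp only [Cardinal.lift_uzero, Cardinal.mk_nat, Cardinal.lift_aleph0] at this
  exact this.trans (Cardinal.mul_le_of_le hκ hκ (ciSup_le' hiter))

end ClosureUnder

/-! ### Point-countable separating families -/

/-- There is a family of continuous functions on `K`, constant on the fibers of `φ` and
point-countable at the points of countable support, which determines `φ ∘ r`. -/
def HasSeparatingFamily {Γ K L : Type u} [TopologicalSpace K] (h : K → Γ → ℝ) (φ : K → L)
    (r : K → K) : Prop :=
  ∃ (T : Type u) (f : T → K → ℝ), (∀ t, Continuous (f t)) ∧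
    (∀ t x y, φ x = φ y → f t x = f t y) ∧
    (∀ x, {γ | h x γ ≠ 0}.Countable → {t | f t x ≠ 0}.Countable) ∧
    ∀ x y, (∀ t, f t x = f t y) → φ (r x) = φ (r y)

theorem exists_countable_image_subset_closure {α Y : Type*} [TopologicalSpace Y]
    [SecondCountableTopology Y] (A : Set α) (ρ : α → Y) :
    ∃ C ⊆ A, C.Countable ∧ ρ '' A ⊆ closure (ρ '' C) := by
  let ρA : A → Y := fun a => ρ a
  let : TopologicalSpace A := TopologicalSpace.induced ρA inferInstance
  have : SecondCountableTopology A := TopologicalSpace.secondCountableTopology_induced A Y ρA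
  obtain ⟨C, hC, hd⟩ := TopologicalSpace.exists_countable_dense A
  refine ⟨Subtype.val '' C, by rintro _ ⟨a, -, rfl⟩; exact a.2, hC.image _, ?_⟩
  rintro _ ⟨a, ha, rfl⟩
  have := closure_induced.1 (hd ⟨a, ha⟩)
  rwa [image_image]

theorem exists_countable_separating_comp {X L : Type*} [TopologicalSpace X] [CompactSpace X]
    [T2Space X] [SecondCountableTopology X] [TopologicalSpace L] [CompactSpace L] [T2Space L]
    (φ : C(X, L)) :
    ∃ Q : Set C(L, ℝ), Q.Countable ∧ ∀ x y, (∀ g ∈ Q, g (φ x) = g (φ y)) → φ x = φ y := by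
  obtain ⟨Q, -, hQ, hd⟩ := exists_countable_image_subset_closure (univ : Set C(L, ℝ))
    (fun g => g.comp φ)
  refine ⟨Q, hQ, fun x y hxy => ?_⟩
  by_contra hne
  obtain ⟨g, hg0, hg1, -⟩ := exists_continuous_zero_one_of_isClosed
    (isClosed_singleton (x := φ x)) (isClosed_singleton (x := φ y)) (by simpa using hne)
  have hcl : IsClosed {f : C(X, ℝ) | f x = f y} :=
    isClosed_eq (continuous_eval_const x) (continuous_eval_const y)
  have hmem : g.comp φ ∈ {f : C(X, ℝ) | f x = f y} := by
    refine closure_minimal ?_ hcl (hd ⟨g, mem_univ _, rfl⟩)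
    rintro _ ⟨q, hq, rfl⟩
    exact hxy q hq
  have h0 : g (φ x) = 0 := hg0 rfl
  have h1 : g (φ y) = 1 := hg1 rfl
  have : g (φ x) = g (φ y) := hmem
  rw [h0, h1] at this
  exact zero_ne_one this

theorem continuous_of_apply_eq_indicator {Γ K : Type*} [TopologicalSpace K] {h : K → Γ → ℝ}
    (hh : IsEmbedding h) {S : Set Γ} {r : K → K}
    (hr : ∀ x, h (r x) = S.indicator (h x)) : Continuous r := by
  refine hh.continuous_iff.2 (continuous_pi fun γ => ?_)
  simp only [Function.comp_apply, hr]
  by_cases hγ : γ ∈ S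
  · simpa [hγ, Function.comp_def] using (continuous_apply γ).comp hh.continuous
  · simpa [hγ] using continuous_const

theorem apply_iUnion_eq_of_forall_eq {Γ K L : Type*} [TopologicalSpace K] [TopologicalSpace L]
    [T2Space L] {h : K → Γ → ℝ} {φ : K → L} (hh : IsEmbedding h) (hφ : Continuous φ)
    {ι : Type*} [LinearOrder ι] [Nonempty ι] {S : ι → Set Γ} (hmono : Monotone S)
    {r : ι → K → K} {r' : K → K} (hr : ∀ i x, h (r i x) = (S i).indicator (h x))
    (hr' : ∀ x, h (r' x) = (⋃ i, S i).indicator (h x)) {x y : K}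
    (hxy : ∀ i, φ (r i x) = φ (r i y)) : φ (r' x) = φ (r' y) := by
  have key : ∀ z, Tendsto (fun i => φ (r i z)) atTop (𝓝 (φ (r' z))) := by
    intro z
    refine (hφ.tendsto _).comp (hh.tendsto_nhds_iff.2 (tendsto_pi_nhds.2 fun γ => ?_))
    have := (hmono.tendsto_indicator S (h z) γ).mono_right (pure_le_nhds _)
    simpa only [Function.comp_def, hr, hr'] using this
  refine tendsto_nhds_unique (key x) ?_
  simpa only [hxy] using key y

section Retractions

variable {Γ K L : Type u} [TopologicalSpace K] [CompactSpace K] [TopologicalSpace L]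
  [CompactSpace L] [T2Space L] {h : K → Γ → ℝ} {φ : K → L}

theorem hasSeparatingFamily_of_countable (hh : IsEmbedding h) (hφ : Continuous φ) {S : Set Γ}
    (hS : S.Countable) {r : K → K} (hr : ∀ x, h (r x) = S.indicator (h x))
    (hE : ∀ x y, φ x = φ y → φ (r x) = φ (r y)) : HasSeparatingFamily h φ r := by
  have hrc := continuous_of_apply_eq_indicator hh hr
  have : T2Space K := hh.t2Space
  have : CompactSpace (range r) := isCompact_iff_compactSpace.1 (isCompact_range hrc)
  have : Countable S := hS.to_subtype
  let ρ : range r → S → ℝ := fun x γ => h x γ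
  have hρc : Continuous ρ := continuous_pi fun γ =>
    (continuous_apply (γ : Γ)).comp (hh.continuous.comp continuous_subtype_val)
  have hρi : Function.Injective ρ := by
    rintro ⟨_, x, rfl⟩ ⟨_, y, rfl⟩ hxy
    refine Subtype.ext (hh.injective ?_)
    ext γ
    by_cases hγ : γ ∈ S
    · exact congrFun hxy ⟨γ, hγ⟩
    · simp [hr, hγ]
  have : SecondCountableTopology (range r) :=
    (hρc.isClosedEmbedding hρi).isEmbedding.secondCountableTopology
  obtain ⟨Q, hQ, hsep⟩ := exists_countable_separating_comp
    (⟨fun x : range r => φ x, hφ.comp continuous_subtype_val⟩ : C(range r, L))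
  have : Countable Q := hQ.to_subtype
  refine ⟨Q, fun g x => g.1 (φ (r x)), fun g => g.1.continuous.comp (hφ.comp hrc),
    fun g x y hxy => congrArg g.1 (hE x y hxy), fun x _ => to_countable _, fun x y hxy => ?_⟩
  exact hsep ⟨r x, x, rfl⟩ ⟨r y, y, rfl⟩ fun g hg => hxy ⟨g, hg⟩

theorem hasSeparatingFamily_of_isClosedUnder (hh : IsEmbedding h) (hφ : Continuous φ)
    {c : Finset Γ → Set Γ} (hc : ∀ F, (c F).Countable) {r : Set Γ → K → K}
    (hr : ∀ S, IsClosedUnder c S → ∀ x, h (r S x) = S.indicator (h x))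
    (hE : ∀ S, IsClosedUnder c S → ∀ x y, φ x = φ y → φ (r S x) = φ (r S y))
    (S : Set Γ) (hS : IsClosedUnder c S) : HasSeparatingFamily h φ (r S) := by
  obtain ⟨κ, hκ⟩ : ∃ κ, Cardinal.mk S = κ := ⟨_, rfl⟩
  induction κ using WellFoundedLT.induction generalizing S with
  | ind κ ih =>
  by_cases hSc : S.Countable
  · exact hasSeparatingFamily_of_countable hh hφ hSc (hr S hS) (hE S hS)
  have hκ₀ : Cardinal.aleph0 < κ := by
    rw [← hκ]; exact not_le.1 fun hle => hSc (Cardinal.le_aleph0_iff_set_countable.1 hle)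
  let I := κ.ord.ToType
  have hI : Cardinal.mk I = κ := Cardinal.mk_ord_toType κ
  obtain ⟨e⟩ : Nonempty (I ≃ S) := Cardinal.eq.1 (hI.trans hκ.symm)
  have hIne : Nonempty I := by
    rw [← Cardinal.mk_ne_zero_iff, hI]; exact (Cardinal.aleph0_pos.trans hκ₀).ne'
  let E : Set I → Set Γ := fun J => closureUnder c ((fun i => (e i : Γ)) '' J)
  have hEcl : ∀ J, IsClosedUnder c (E J) := fun J => isClosedUnder_closureUnder _
  have hEmono : Monotone E := fun J J' hJ => closureUnder_mono (image_mono hJ)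
  have hmemE : ∀ {i J}, i ∈ J → (e i : Γ) ∈ E J := fun hi =>
    subset_closureUnder _ (mem_image_of_mem _ hi)
  have hES : ∀ J, E J ⊆ S := fun J =>
    closureUnder_subset hS (by rintro _ ⟨i, -, rfl⟩; exact (e i).2)
  have hcard : ∀ J : Set I, Cardinal.mk J < κ → Cardinal.mk (E J) < κ := fun J hJ =>
    (mk_closureUnder_le hc (le_max_left _ _)
      (Cardinal.mk_image_le.trans (le_max_right _ _))).trans_lt (max_lt hκ₀ hJ)
  have hIio : ∀ i : I, Cardinal.mk (Iio i) < κ := fun i => by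
    simpa [hI] using Cardinal.mk_Iio_lt i (by simp [I])
  have hIic : ∀ i : I, Cardinal.mk (Iic i) < κ := fun i => by
    rw [← Iio_insert]
    exact Cardinal.mk_insert_le.trans_lt
      (Cardinal.add_lt_of_lt hκ₀.le (hIio i) (Cardinal.one_lt_aleph0.trans hκ₀))
  have hIicmono : Monotone fun i => E (Iic i) := fun i j hij => hEmono (Iic_subset_Iic.2 hij)
  have hUnion : ⋃ i, E (Iic i) = S := by
    refine Subset.antisymm (iUnion_subset fun i => hES _) fun γ hγ => ?_
    refine mem_iUnion.2 ⟨e.symm ⟨γ, hγ⟩, ?_⟩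
    simpa using hmemE (i := e.symm ⟨γ, hγ⟩) (self_mem_Iic)
  have hUnionIio : ∀ i : I, (Iio i).Nonempty → ⋃ j : Iio i, E (Iic j) = E (Iio i) := by
    intro i hi
    have : Nonempty (Iio i) := hi.to_subtype
    refine Subset.antisymm
      (iUnion_subset fun j => hEmono (Iic_subset_Iio.2 j.2)) ?_
    refine closureUnder_subset (isClosedUnder_iUnion ?_ fun j => hEcl _) ?_
    · exact (hIicmono.comp (Subtype.mono_coe _)).directed_le
    · rintro _ ⟨j, hj, rfl⟩
      exact mem_iUnion.2 ⟨⟨j, hj⟩, hmemE self_mem_Iic⟩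
  have hidem : ∀ J x, r (E J) (r (E J) x) = r (E J) x := fun J x => hh.injective (by
    rw [hr _ (hEcl J), hr _ (hEcl J), indicator_indicator, inter_self])
  have hrsupp : ∀ J x, {γ | h x γ ≠ 0}.Countable → {γ | h (r (E J) x) γ ≠ 0}.Countable := by
    intro J x hx
    refine hx.mono fun γ hγ => ?_
    rw [mem_ofPred_eq, hr _ (hEcl J)] at hγ
    intro h0
    exact hγ (by simp [indicator, h0])
  have hrc : ∀ J, Continuous (r (E J)) := fun J =>
    continuous_of_apply_eq_indicator hh (hr _ (hEcl J))
  have hfam : ∀ J : Set I, Cardinal.mk J < κ → HasSeparatingFamily h φ (r (E J)) := fun J hJ =>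
    ih _ (hcard J hJ) _ (hEcl J) rfl
  obtain ⟨T₀, f₀, hf₀c, hf₀φ, hf₀s, hf₀⟩ := hfam ∅ (by
    simpa using Cardinal.aleph0_pos.trans hκ₀)
  choose T f hfc hfφ hfs hf using fun i => hfam (Iic i) (hIic i)
  refine ⟨T₀ ⊕ (Σ i, T i), Sum.elim f₀ fun p x =>
    f p.1 p.2 (r (E (Iic p.1)) x) - f p.1 p.2 (r (E (Iio p.1)) x), ?_, ?_, ?_, ?_⟩
  · rintro (t | ⟨i, t⟩)
    · exact hf₀c t
    · exact ((hfc i t).comp (hrc _)).sub ((hfc i t).comp (hrc _))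
  · rintro (t | ⟨i, t⟩) x y hxy
    · exact hf₀φ t x y hxy
    · simp only [Sum.elim_inr]
      rw [hfφ i t _ _ (hE _ (hEcl (Iic i)) x y hxy), hfφ i t _ _ (hE _ (hEcl (Iio i)) x y hxy)]
  · intro x hx
    have hjump : {i | r (E (Iic i)) x ≠ r (E (Iio i)) x}.Countable := by
      refine (hx.biUnion (t := fun γ _ => {i | γ ∈ E (Iic i) \ E (Iio i)}) fun γ _ =>
        Subsingleton.countable ?_).mono ?_
      · intro i hi j hj
        by_contra hne
        rcases lt_or_gt_of_ne hne with hlt | hlt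
        · exact hj.2 (hEmono (Iic_subset_Iio.2 hlt) hi.1)
        · exact hi.2 (hEmono (Iic_subset_Iio.2 hlt) hj.1)
      · intro i hi
        by_contra hcon
        simp only [mem_iUnion, not_exists] at hcon
        refine hi (hh.injective ?_)
        rw [hr _ (hEcl _), hr _ (hEcl _)]
        ext γ
        by_cases h0 : h x γ = 0
        · simp [indicator, h0]
        · have h1 : γ ∈ E (Iic i) → γ ∈ E (Iio i) := fun h1 =>
            by_contra fun h2 => hcon γ h0 ⟨h1, h2⟩
          have h2 : γ ∈ E (Iio i) → γ ∈ E (Iic i) := fun h2 => hEmono Iio_subset_Iic_self h2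
          by_cases h3 : γ ∈ E (Iio i)
          · simp [h3, h2 h3]
          · simp [h3, mt h1 h3]
    refine (((hf₀s x hx).image Sum.inl).union (hjump.biUnion
      (t := fun i _ => (fun t => Sum.inr ⟨i, t⟩) '' ({t | f i t (r (E (Iic i)) x) ≠ 0} ∪
        {t | f i t (r (E (Iio i)) x) ≠ 0})) fun i _ => Countable.image
          ((hfs i _ (hrsupp _ x hx)).union (hfs i _ (hrsupp _ x hx))) _)).mono ?_
    rintro (t | ⟨i, t⟩) ht
    · exact Or.inl ⟨t, ht, rfl⟩
    · have ht' : f i t (r (E (Iic i)) x) - f i t (r (E (Iio i)) x) ≠ 0 := ht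
      refine Or.inr (mem_biUnion (x := i) (fun heq => ht' (by rw [heq, sub_self])) ⟨t, ?_, rfl⟩)
      by_contra hcon
      simp only [mem_union, mem_ofPred_eq, not_or, not_not] at hcon
      exact ht' (by rw [hcon.1, hcon.2, sub_self])
  · intro x y hxy
    have hstage : ∀ i, φ (r (E (Iic i)) x) = φ (r (E (Iic i)) y) := by
      intro i
      induction i using WellFoundedLT.induction with
      | ind i hi =>
      have hlt : φ (r (E (Iio i)) x) = φ (r (E (Iio i)) y) := by
        rcases (Iio i).eq_empty_or_nonempty with hemp | hne
        · rw [hemp]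
          exact hf₀ x y fun t => hxy (Sum.inl t)
        · have : Nonempty (Iio i) := hne.to_subtype
          refine apply_iUnion_eq_of_forall_eq hh hφ (hIicmono.comp (Subtype.mono_coe (· ∈ Iio i)))
            (fun j => hr _ (hEcl (Iic j.1))) ?_ fun j => hi j.1 j.2
          have := hUnionIio i hne
          simp only [Function.comp_def]
          rw [this]
          exact hr _ (hEcl _)
      rw [← hidem (Iic i) x, ← hidem (Iic i) y]
      refine hf i _ _ fun t => ?_
      have := hxy (Sum.inr ⟨i, t⟩)
      simp only [Sum.elim_inr, hfφ i t _ _ hlt] at this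
      exact sub_left_injective this
    refine apply_iUnion_eq_of_forall_eq hh hφ hIicmono (fun i => hr _ (hEcl (Iic i))) ?_ hstage
    rw [hUnion]
    exact hr S hS

end Retractions

/-! ### Retractions obtained by closing off -/

theorem exists_countable_support_operation {Γ K L : Type u} [TopologicalSpace K] [CompactSpace K]
    [TopologicalSpace L] [T2Space L] {h : K → Γ → ℝ} {φ : K → L} (hh : IsEmbedding h)
    (hφ : Continuous φ)
    (hd : ∀ x y, φ x = φ y → (x, y) ∈ closure {p : K × K | {γ | h p.1 γ ≠ 0}.Countable ∧
      {γ | h p.2 γ ≠ 0}.Countable ∧ φ p.1 = φ p.2}) :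
    ∃ c : Finset Γ → Set Γ, (∀ F, (c F).Countable) ∧ ∀ S, IsClosedUnder c S →
      ∀ x y, φ x = φ y → ∃ x' y', h x' = S.indicator (h x) ∧ h y' = S.indicator (h y) ∧
        φ x' = φ y' := by
  set A : Set (K × K) := {p : K × K | {γ | h p.1 γ ≠ 0}.Countable ∧
      {γ | h p.2 γ ≠ 0}.Countable ∧ φ p.1 = φ p.2}
  let ρ : ∀ F : Finset Γ, K × K → F → ℝ × ℝ := fun F p γ => (h p.1 γ, h p.2 γ)
  have hρ : ∀ F, Continuous (ρ F) := fun F => continuous_pi fun γ =>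
    (((continuous_apply (γ : Γ)).comp (hh.continuous.comp continuous_fst))).prodMk
      (((continuous_apply (γ : Γ)).comp (hh.continuous.comp continuous_snd)))
  choose C hCA hC hCd using fun F => exists_countable_image_subset_closure A (ρ F)
  refine ⟨fun F => ⋃ p ∈ C F, {γ | h p.1 γ ≠ 0} ∪ {γ | h p.2 γ ≠ 0}, fun F =>
    (hC F).biUnion fun p hp => (hCA F hp).1.union (hCA F hp).2.1, fun S hS x y hxy => ?_⟩
  let ψ : K × K → Γ → ℝ × ℝ := fun p γ => (h p.1 γ, h p.2 γ)
  have hψ : Continuous ψ := continuous_pi fun γ =>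
    (((continuous_apply γ).comp (hh.continuous.comp continuous_fst))).prodMk
      (((continuous_apply γ).comp (hh.continuous.comp continuous_snd)))
  have hE : IsClosed (ψ '' {p | φ p.1 = φ p.2}) :=
    ((isClosed_eq (hφ.comp continuous_fst) (hφ.comp continuous_snd)).isCompact.image hψ).isClosed
  suffices hmem : S.indicator (ψ (x, y)) ∈ ψ '' {p | φ p.1 = φ p.2} by
    obtain ⟨⟨x', y'⟩, hp, hpe⟩ := hmem
    refine ⟨x', y', ?_, ?_, hp⟩ <;> ext γ <;> have := congrFun hpe γ <;> by_cases hγ : γ ∈ S <;>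
      simp_all [ψ, Prod.ext_iff]
  rw [← hE.closure_eq, mem_closure_iff_nhds]
  intro U hU
  rw [nhds_pi, Filter.mem_pi'] at hU
  obtain ⟨F, V, hV, hVU⟩ := hU
  classical
  let F' : Finset Γ := F.filter (· ∈ S)
  have hx : ρ F' (x, y) ∈ closure (ρ F' '' C F') := by
    refine closure_minimal (hCd F') isClosed_closure ?_
    exact image_closure_subset_closure_image (hρ F') (mem_image_of_mem _ (hd x y hxy))
  have hN : univ.pi (fun γ : F' => V γ) ∈ 𝓝 (ρ F' (x, y)) := by
    refine set_pi_mem_nhds finite_univ fun γ _ => ?_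
    have := hV γ
    rwa [indicator_of_mem (Finset.mem_filter.1 γ.2).2] at this
  obtain ⟨_, hpV, p, hp, rfl⟩ := mem_closure_iff_nhds.1 hx _ hN
  refine ⟨ψ p, hVU fun γ hγ => ?_, p, (hCA F' hp).2.2, rfl⟩
  by_cases hγS : γ ∈ S
  · exact hpV ⟨γ, Finset.mem_filter.2 ⟨hγ, hγS⟩⟩ (mem_univ _)
  · have hsub := hS F' (fun γ hγ => (Finset.mem_filter.1 hγ).2)
    have h0 : ψ p γ = 0 := by
      by_contra hne
      refine hγS (hsub (mem_biUnion hp ?_))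
      by_contra hcon
      simp only [mem_union, mem_ofPred_eq, not_or, not_not] at hcon
      exact hne (Prod.ext hcon.1 hcon.2)
    rw [h0, ← indicator_of_notMem hγS (ψ (x, y))]
    exact mem_of_mem_nhds (hV γ)

theorem isValdivia_of_dense_pairs {Γ K L : Type u} [TopologicalSpace K] [CompactSpace K]
    [TopologicalSpace L] [CompactSpace L] [T2Space L] {h : K → Γ → ℝ} {φ : K → L}
    (hh : IsEmbedding h) (hD : Dense {x | {γ | h x γ ≠ 0}.Countable}) (hφ : Continuous φ)
    (hsurj : Function.Surjective φ)
    (hd : ∀ x y, φ x = φ y → (x, y) ∈ closure {p : K × K | {γ | h p.1 γ ≠ 0}.Countable ∧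
      {γ | h p.2 γ ≠ 0}.Countable ∧ φ p.1 = φ p.2}) : IsValdivia L := by
  obtain ⟨c, hc, hcS⟩ := exists_countable_support_operation hh hφ hd
  have hex : ∀ S x, ∃ x', IsClosedUnder c S → h x' = S.indicator (h x) := by
    intro S x
    by_cases hS : IsClosedUnder c S
    · obtain ⟨x', -, hx', -⟩ := hcS S hS x x rfl
      exact ⟨x', fun _ => hx'⟩
    · exact ⟨x, fun h => absurd h hS⟩
  choose r hr using hex
  have hr' : ∀ S, IsClosedUnder c S → ∀ x, h (r S x) = S.indicator (h x) :=
    fun S hS x => hr S x hS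
  have hrφ : ∀ S, IsClosedUnder c S → ∀ x y, φ x = φ y → φ (r S x) = φ (r S y) := by
    intro S hS x y hxy
    obtain ⟨x', y', hx', hy', h'⟩ := hcS S hS x y hxy
    rwa [hh.injective (hx'.trans (hr' S hS x).symm),
      hh.injective (hy'.trans (hr' S hS y).symm)] at h'
  obtain ⟨T, f, hfc, hfφ, hfs, hf⟩ :=
    hasSeparatingFamily_of_isClosedUnder hh hφ hc hr' hrφ univ isClosedUnder_univ
  have huniv : ∀ x, r univ x = x := fun x => hh.injective (by
    rw [hr' _ isClosedUnder_univ, indicator_univ])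
  have hcomp : ∀ t x, f t (Function.surjInv hsurj (φ x)) = f t x := fun t x =>
    hfφ t _ _ (Function.surjInv_eq hsurj _)
  have hquot := IsQuotientMap.of_surjective_continuous hsurj hφ
  refine ⟨T, fun y t => f t (Function.surjInv hsurj y), ?_, ?_⟩
  · refine (Continuous.isClosedEmbedding (continuous_pi fun t => ?_) ?_).isEmbedding
    · refine hquot.continuous_iff.2 ?_
      simpa only [Function.comp_def, hcomp] using hfc t
    · intro y y' hyy
      have := hf _ _ fun t => congrFun hyy t
      rwa [huniv, huniv, Function.surjInv_eq hsurj, Function.surjInv_eq hsurj] at this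
  · refine (hsurj.denseRange.dense_image hφ hD).mono ?_
    rintro _ ⟨x, hx, rfl⟩
    simpa only [mem_ofPred_eq, hcomp] using hfs x hx

/-! ### Dense countably closed subsets of lines -/

theorem mem_of_frequently_lt {K : Type*} [TopologicalSpace K] [LinearOrder K] [OrderTopology K]
    {D : Set K} (hD : Dense D) (hDc : ∀ C ⊆ D, C.Countable → closure C ⊆ D) {x : K} {f : ℕ → K}
    (hf : Tendsto f atTop (𝓝 x)) (hlt : ∃ᶠ n in atTop, f n < x) : x ∈ D := by
  have hex : ∀ n, f n < x → ∃ d ∈ D, d ∈ Ioo (f n) x := by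
    intro n hn
    obtain ⟨m, hmx, hmn⟩ := (hlt.and_eventually (hf.eventually (lt_mem_nhds hn))).exists
    obtain ⟨d, hd, hdD⟩ := hD.inter_open_nonempty _ isOpen_Ioo ⟨f m, hmn, hmx⟩
    exact ⟨d, hdD, hd⟩
  have : Nonempty K := ⟨x⟩
  choose! d hdD hd using hex
  refine hDc (d '' {n | f n < x}) ?_ ((to_countable _).image d) ?_
  · rintro _ ⟨n, hn, rfl⟩
    exact hdD n hn
  · rw [mem_closure_iff_nhds]
    intro U hU
    obtain ⟨n₀, hn₀⟩ := hlt.exists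
    obtain ⟨a, ha, haU⟩ := exists_Ioc_subset_of_mem_nhds hU ⟨f n₀, hn₀⟩
    obtain ⟨n, hn, han⟩ := (hlt.and_eventually (hf.eventually (lt_mem_nhds ha))).exists
    exact ⟨d n, haU ⟨han.trans (hd n hn).1, (hd n hn).2.le⟩, n, hn, rfl⟩

theorem gSet_subset_of_dense {K : Type u} [TopologicalSpace K] [LinearOrder K] [OrderTopology K]
    {D : Set K} (hD : Dense D) (hDc : ∀ C ⊆ D, C.Countable → closure C ⊆ D) : GSet K ⊆ D := by
  rintro x (hx | ⟨f, hinj, hf⟩)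
  · obtain ⟨y, hy, hyD⟩ := hD.inter_open_nonempty _ hx (singleton_nonempty x)
    rwa [← mem_singleton_iff.1 hy]
  · have hne : ∀ᶠ n in atTop, f n ≠ x := by
      have hfin : (f ⁻¹' {x}).Finite := (finite_singleton x).preimage hinj.injOn
      have := hfin.eventually_cofinite_notMem
      rwa [Nat.cofinite_eq_atTop] at this
    have hor : ∃ᶠ n in atTop, f n < x ∨ x < f n :=
      (hne.mono fun n hn => lt_or_gt_of_ne hn).frequently
    rcases frequently_or_distrib.1 hor with hlt | hgt
    · exact mem_of_frequently_lt hD hDc hf hlt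
    · exact mem_of_frequently_lt (K := Kᵒᵈ) hD hDc hf hgt

theorem closure_subset_of_countable_support {Γ K : Type*} [TopologicalSpace K] {h : K → Γ → ℝ}
    (hh : Continuous h) {C : Set K} (hC : C.Countable)
    (hCs : C ⊆ {x | {γ | h x γ ≠ 0}.Countable}) :
    closure C ⊆ {x | {γ | h x γ ≠ 0}.Countable} := by
  intro x hx
  refine (hC.biUnion fun y hy => hCs hy).mono fun γ hγ => ?_
  by_contra hcon
  simp only [mem_iUnion, not_exists] at hcon
  have hcl : IsClosed {y | h y γ = 0} :=
    isClosed_eq ((continuous_apply γ).comp hh) continuous_const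
  exact hγ (closure_minimal (fun y hy => not_not.1 (hcon y hy)) hcl hx)

theorem isValdivia_of_increasing_image (K L : Type u) [TopologicalSpace K] [LinearOrder K]
    [OrderTopology K] [CompactSpace K] [TopologicalSpace L] [LinearOrder L] [OrderTopology L]
    [CompactSpace L] (hK : IsValdivia K) (φ : K → L) (hmono : Monotone φ)
    (hcont : Continuous φ) (hsurj : Function.Surjective φ)
    (hfib : ∀ y : L, (∃ x : K, φ ⁻¹' {y} = {x}) ∨
      φ ⁻¹' {y} ⊆ closure (φ ⁻¹' {y} ∩ GSet K)) :
    IsValdivia L := by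
  obtain ⟨Γ, h, hh, hD⟩ := hK
  have hG : GSet K ⊆ {x : K | {γ | h x γ ≠ 0}.Countable} := gSet_subset_of_dense hD
    fun C hCs hC => closure_subset_of_countable_support hh.continuous hC hCs
  refine isValdivia_of_dense_pairs hh hD hcont hsurj fun x y hxy => ?_
  rcases hfib (φ y) with ⟨z, hz⟩ | hy
  · have hxz : x ∈ φ ⁻¹' {φ y} := hxy
    have hyz : y ∈ φ ⁻¹' {φ y} := rfl
    rw [hz, mem_singleton_iff] at hxz hyz
    rw [hxz, hyz]
    have hdiag : Continuous fun a : K => (a, a) := by fun_prop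
    refine closure_mono ?_
      (image_closure_subset_closure_image hdiag (mem_image_of_mem _ (hD z)))
    rintro _ ⟨a, ha, rfl⟩
    exact ⟨ha, ha, rfl⟩
  · have hmem : (x, y) ∈ closure ((φ ⁻¹' {φ y} ∩ GSet K) ×ˢ (φ ⁻¹' {φ y} ∩ GSet K)) := by
      rw [closure_prod_eq]
      exact ⟨hy hxy, hy rfl⟩
    refine closure_mono ?_ hmem
    rintro ⟨a, b⟩ ⟨⟨ha, haG⟩, hb, hbG⟩
    exact ⟨hG haG, hG hbG, Eq.trans ha (Eq.symm hb)⟩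
end

section
/- Let X be a linearly ordered set such that the compact line 𝕂(X) of final segments of X is Valdivia. Then every uncountable subset of X contains a subset order-isomorphic to ω₁ or a subset order-isomorphic to ω₁ with the reversed order. -/
universe u

open Set Filter Topology

/-- `𝕂(X)`: the space of final segments of a linearly ordered set `X`, identified with their
characteristic functions, as a (closed) subspace of the Cantor cube `{0,1}^X`. -/
abbrev FinalSegs (X : Type u) [LinearOrder X] : Type u :=
  {F : X → Bool // ∀ x y : X, x ≤ y → F x = true → F y = true}

/-- The first uncountable ordinal. -/
noncomputable def omega1 : Ordinal.{0} := (Cardinal.aleph 1).ord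

/-- `Y` contains a subset order-isomorphic to `ω₁` (the image of a strictly increasing
`ω₁`-sequence). -/
noncomputable def ContainsOmega1Copy {X : Type u} [LinearOrder X] (Y : Set X) : Prop :=
  ∃ f : Ordinal.{0} → X, (∀ a < omega1, f a ∈ Y) ∧
    ∀ a b : Ordinal, a < omega1 → b < omega1 → a < b → f a < f b

/-- `Y` contains a subset order-isomorphic to `ω₁` with the reversed order. -/
noncomputable def ContainsOmega1RevCopy {X : Type u} [LinearOrder X] (Y : Set X) : Prop :=
  ∃ f : Ordinal.{0} → X, (∀ a < omega1, f a ∈ Y) ∧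
    ∀ a b : Ordinal, a < omega1 → b < omega1 → a < b → f b < f a

/-- A set without copies of `ω₁` has a countable cofinal subset. -/
theorem exists_countable_cofinal {X : Type u} [LinearOrder X] {Z : Set X}
    (hZ : ¬ ContainsOmega1Copy Z) :
    ∃ C : Set X, C.Countable ∧ ∀ z ∈ Z, ∃ c ∈ C, z ≤ c ∧ c ∈ Z := by
  by_contra! hno
  have key : ∀ C : Set X, ∃ z, C.Countable → z ∈ Z ∧ ∀ c ∈ C, c ∈ Z → c < z := by
    intro C
    by_cases hC : C.Countable
    · obtain ⟨z, hz, h⟩ := hno C hC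
      refine ⟨z, fun _ => ⟨hz, fun c hc hcZ => ?_⟩⟩
      by_contra hlt
      exact h c hc (not_lt.mp hlt) hcZ
    · obtain ⟨z, -, -⟩ := hno ∅ countable_empty
      exact ⟨z, fun h => absurd h hC⟩
  choose G hG using key
  let f : Ordinal.{0} → X := (wellFounded_lt (α := Ordinal.{0})).fix
    fun a ih => G {x | ∃ b : Ordinal.{0}, ∃ hb : b < a, ih b hb = x}
  have hf : ∀ a, f a = G (f '' Iio a) := by
    intro a
    have h : f a = G {x | ∃ b : Ordinal.{0}, ∃ _ : b < a, f b = x} :=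
      WellFounded.fix_eq _ _ _
    rw [h]
    congr 1
    ext x
    simp
  have hcount : ∀ a < omega1, (f '' Iio a).Countable := by
    intro a ha
    refine Set.Countable.image ?_ f
    rw [← Cardinal.le_aleph0_iff_set_countable, Cardinal.mk_Iio_ordinal]
    rw [omega1, Cardinal.lt_ord, ← Cardinal.succ_aleph0, Order.lt_succ_iff] at ha
    exact Cardinal.lift_le_aleph0.mpr ha
  have hmem : ∀ a < omega1, f a ∈ Z := by
    intro a ha
    rw [hf]
    exact (hG _ (hcount a ha)).1
  refine hZ ⟨f, hmem, fun a b ha hb hab => ?_⟩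
  rw [hf b]
  exact (hG _ (hcount b hb)).2 _ ⟨a, hab, rfl⟩ (hmem a ha)

/-- A set without reversed copies of `ω₁` has a countable coinitial subset. -/
theorem exists_countable_coinitial {X : Type u} [LinearOrder X] {Z : Set X}
    (hZ : ¬ ContainsOmega1RevCopy Z) :
    ∃ C : Set X, C.Countable ∧ ∀ z ∈ Z, ∃ c ∈ C, c ≤ z ∧ c ∈ Z :=
  exists_countable_cofinal (X := Xᵒᵈ) (Z := Z) hZ

/-- Closing off a countable set under a countable-valued binary operation. -/
theorem exists_countable_closed {α : Type u} (G : α → α → Set α)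
    (hG : ∀ a b, (G a b).Countable) {N₀ : Set α} (h₀ : N₀.Countable) :
    ∃ N : Set α, N.Countable ∧ N₀ ⊆ N ∧ ∀ a ∈ N, ∀ b ∈ N, G a b ⊆ N := by
  let step : Set α → Set α := fun N => N ∪ ⋃ a ∈ N, ⋃ b ∈ N, G a b
  let S : ℕ → Set α := fun n => step^[n] N₀
  have hS : ∀ n, S (n + 1) = step (S n) := fun n => Function.iterate_succ_apply' _ _ _
  have hmono : Monotone S := monotone_nat_of_le_succ fun n => by
    rw [hS]
    exact subset_union_left
  have hcount : ∀ n, (S n).Countable := by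
    intro n
    induction n with
    | zero => exact h₀
    | succ n ih =>
      rw [hS]
      exact ih.union (ih.biUnion fun a _ => ih.biUnion fun b _ => hG a b)
  refine ⟨⋃ n, S n, countable_iUnion hcount, subset_iUnion S 0, ?_⟩
  intro a ha b hb x hx
  obtain ⟨m, hm⟩ := mem_iUnion.mp ha
  obtain ⟨n, hn⟩ := mem_iUnion.mp hb
  refine mem_iUnion.mpr ⟨max m n + 1, ?_⟩
  rw [hS]
  exact Or.inr (mem_biUnion (hmono (le_max_left m n) hm)
    (mem_biUnion (hmono (le_max_right m n) hn) hx))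

instance finalSegs_compactSpace (X : Type u) [LinearOrder X] : CompactSpace (FinalSegs X) := by
  refine isCompact_iff_compactSpace.mp (IsClosed.isCompact
    (s := {F : X → Bool | ∀ x y : X, x ≤ y → F x = true → F y = true}) ?_)
  have : {F : X → Bool | ∀ x y : X, x ≤ y → F x = true → F y = true}
      = ⋂ (x : X) (y : X) (_ : x ≤ y), {F | F x = false} ∪ {F | F y = true} := by
    ext F
    simp only [mem_ofPred_eq, mem_iInter, mem_union]
    refine forall_congr' fun x => forall_congr' fun y => forall_congr' fun _ => ?_
    cases F x <;> simp
  rw [this]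
  refine isClosed_iInter fun x => isClosed_iInter fun y => isClosed_iInter fun _ => ?_
  exact (isClosed_eq (continuous_apply x) continuous_const).union
    (isClosed_eq (continuous_apply y) continuous_const)

theorem FinalSegs.continuous_eval {X : Type u} [LinearOrder X] (p : X) :
    Continuous fun F : FinalSegs X => F.1 p :=
  (continuous_apply p).comp continuous_subtype_val

/-- A continuous real function on `𝕂(X)` depends on countably many coordinates. -/
theorem FinalSegs.exists_countable_dependence {X : Type u} [LinearOrder X]
    {g : FinalSegs X → ℝ} (hg : Continuous g) :
    ∃ S : Set X, S.Countable ∧ ∀ F G : FinalSegs X, g F ≠ g G → ∃ p ∈ S, F.1 p ≠ G.1 p := by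
  have hfin : ∀ n : ℕ, ∃ T : Finset X, ∀ F G : FinalSegs X,
      1 / ((n : ℝ) + 1) ≤ |g F - g G| → ∃ p ∈ T, F.1 p ≠ G.1 p := by
    intro n
    have hK : IsCompact {q : FinalSegs X × FinalSegs X |
        1 / ((n : ℝ) + 1) ≤ |g q.1 - g q.2|} :=
      (isClosed_le continuous_const (by fun_prop)).isCompact
    obtain ⟨T, hT⟩ := hK.elim_finite_subcover
      (fun p : X => {q : FinalSegs X × FinalSegs X | q.1.1 p ≠ q.2.1 p})
      (fun p => isOpen_ne_fun ((continuous_eval p).comp continuous_fst)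
        ((continuous_eval p).comp continuous_snd))
      (by
        intro q hq
        by_contra hne
        simp only [mem_iUnion, mem_ofPred_eq, not_exists, not_not] at hne
        have heq : q.1 = q.2 := Subtype.ext (funext hne)
        have hpos : (0 : ℝ) < 1 / ((n : ℝ) + 1) := by positivity
        simp only [mem_ofPred_eq, heq, sub_self, abs_zero] at hq
        linarith)
    refine ⟨T, fun F G h => ?_⟩
    simpa using hT (show (F, G) ∈ _ from h)
  choose T hT using hfin
  refine ⟨⋃ n, (T n : Set X), countable_iUnion fun n => (T n).countable_toSet, ?_⟩
  intro F G hne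
  obtain ⟨n, hn⟩ := exists_nat_one_div_lt (abs_pos.mpr (sub_ne_zero.mpr hne))
  obtain ⟨p, hp, hFG⟩ := hT n F G hn.le
  exact ⟨p, mem_iUnion.mpr ⟨n, hp⟩, hFG⟩

/-- The final segment of points above all of `A` is a limit of final segments separating
elements of `A`, provided `A` is nonempty without maximum. -/
theorem FinalSegs.exists_upper_limit {X : Type u} [LinearOrder X] {A : Set X}
    (hA : A.Nonempty) (hmax : ∀ a ∈ A, ∃ b ∈ A, a < b) {d : X → X → FinalSegs X}
    (hd : ∀ a b, a < b → (d a b).1 a = false ∧ (d a b).1 b = true) :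
    ∃ F ∈ closure {E | ∃ a ∈ A, ∃ b ∈ A, d a b = E},
      ∀ x, F.1 x = true ↔ ∀ a ∈ A, a < x := by
  classical
  let F : FinalSegs X := ⟨fun x => decide (∀ a ∈ A, a < x), by
    intro x y hxy hx
    rw [decide_eq_true_eq] at hx ⊢
    exact fun a ha => (hx a ha).trans_le hxy⟩
  have hF : ∀ x, F.1 x = true ↔ ∀ a ∈ A, a < x := fun x => decide_eq_true_iff
  refine ⟨F, ?_, hF⟩
  choose! s hsA hs using hmax
  have : Nonempty A := hA.to_subtype
  have hlim : Tendsto (fun a : A => d a (s a)) atTop (𝓝 F) := by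
    rw [tendsto_subtype_rng, tendsto_pi_nhds]
    intro x
    by_cases hx : ∀ a ∈ A, a < x
    · rw [(hF x).mpr hx]
      refine tendsto_const_nhds.congr fun a => ?_
      exact ((d a (s a)).2 _ _ (hx _ (hsA a a.2)).le (hd _ _ (hs a a.2)).2).symm
    · have hFx : F.1 x = false := by
        rw [← Bool.not_eq_true, hF]
        exact hx
      rw [hFx]
      push Not at hx
      obtain ⟨a₀, ha₀, hxa⟩ := hx
      refine tendsto_const_nhds.congr' ?_
      filter_upwards [eventually_ge_atTop (⟨a₀, ha₀⟩ : A)] with a ha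
      by_contra hne
      have htrue : (d a (s a)).1 x = true := by
        rwa [eq_comm, Bool.not_eq_false] at hne
      have := (d a (s a)).2 _ _ (hxa.trans ha) htrue
      rw [(hd _ _ (hs a a.2)).1] at this
      cases this
  exact mem_closure_of_tendsto hlim
    (Eventually.of_forall fun a => ⟨a, a.2, s a, hsA a a.2, rfl⟩)

/-- The final segment generated by `B` is a limit of final segments separating
elements of `B`, provided `B` is nonempty without minimum. -/
theorem FinalSegs.exists_lower_limit {X : Type u} [LinearOrder X] {B : Set X}
    (hB : B.Nonempty) (hmin : ∀ b ∈ B, ∃ a ∈ B, a < b) {d : X → X → FinalSegs X}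
    (hd : ∀ a b, a < b → (d a b).1 a = false ∧ (d a b).1 b = true) :
    ∃ F ∈ closure {E | ∃ a ∈ B, ∃ b ∈ B, d a b = E},
      ∀ x, F.1 x = true ↔ ∃ b ∈ B, b ≤ x := by
  classical
  let F : FinalSegs X := ⟨fun x => decide (∃ b ∈ B, b ≤ x), by
    intro x y hxy hx
    rw [decide_eq_true_eq] at hx ⊢
    obtain ⟨b, hb, hbx⟩ := hx
    exact ⟨b, hb, hbx.trans hxy⟩⟩
  have hF : ∀ x, F.1 x = true ↔ ∃ b ∈ B, b ≤ x := fun x => decide_eq_true_iff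
  refine ⟨F, ?_, hF⟩
  choose! s hsB hs using hmin
  have : Nonempty B := hB.to_subtype
  have hlim : Tendsto (fun b : B => d (s b) b) atBot (𝓝 F) := by
    rw [tendsto_subtype_rng, tendsto_pi_nhds]
    intro x
    by_cases hx : ∃ b ∈ B, b ≤ x
    · rw [(hF x).mpr hx]
      obtain ⟨b₀, hb₀, hbx⟩ := hx
      refine tendsto_const_nhds.congr' ?_
      filter_upwards [eventually_le_atBot (⟨b₀, hb₀⟩ : B)] with b hb
      exact ((d (s b) b).2 _ _ (le_trans hb hbx) (hd _ _ (hs b b.2)).2).symm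
    · have hFx : F.1 x = false := by
        rw [← Bool.not_eq_true, hF]
        exact hx
      rw [hFx]
      push Not at hx
      refine tendsto_const_nhds.congr fun b => ?_
      by_contra hne
      have htrue : (d (s b) b).1 x = true := by
        rwa [eq_comm, Bool.not_eq_false] at hne
      have := (d (s b) b).2 _ _ (hx _ (hsB b b.2)).le htrue
      rw [(hd _ _ (hs b b.2)).1] at this
      cases this
  exact mem_closure_of_tendsto hlim
    (Eventually.of_forall fun b => ⟨s b, hsB b b.2, b, b.2, rfl⟩)

/-- A dense set of final segments separates the points of `X`. -/
theorem FinalSegs.exists_separating {X : Type u} [LinearOrder X] {D : Set (FinalSegs X)}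
    (hD : Dense D) (a b : X) :
    ∃ F ∈ D, a < b → F.1 a = false ∧ F.1 b = true := by
  classical
  by_cases hab : a < b
  · have hopen : IsOpen {F : FinalSegs X | F.1 a = false ∧ F.1 b = true} :=
      ((isOpen_discrete {false}).preimage (continuous_eval a)).inter
        ((isOpen_discrete {true}).preimage (continuous_eval b))
    obtain ⟨F, hF, hFD⟩ := hD.inter_open_nonempty _ hopen
      ⟨⟨fun x => decide (b ≤ x), fun x y hxy hx => by
        rw [decide_eq_true_eq] at hx ⊢
        exact hx.trans hxy⟩, by simpa using hab⟩
    exact ⟨F, hFD, fun _ => hF⟩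
  · have : Nonempty (FinalSegs X) := ⟨⟨fun _ => true, fun _ _ _ _ => rfl⟩⟩
    obtain ⟨F, hF⟩ := hD.nonempty
    exact ⟨F, hF, fun h => absurd h hab⟩

theorem uncountable_subset_contains_omega1_copy (X : Type u) [LinearOrder X]
    (hX : IsValdivia (FinalSegs X)) :
    ∀ Y : Set X, ¬ Y.Countable → ContainsOmega1Copy Y ∨ ContainsOmega1RevCopy Y := by
  intro Y hY
  by_contra! hno
  obtain ⟨Γ, h, hemb, hdense⟩ := hX
  have hcof : ∀ Z : Set X, ∃ C : Set X, C.Countable ∧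
      (Z ⊆ Y → ∀ z ∈ Z, (∃ c ∈ C, z ≤ c ∧ c ∈ Z) ∧ ∃ c ∈ C, c ≤ z ∧ c ∈ Z) := by
    intro Z
    by_cases hZ : Z ⊆ Y
    · obtain ⟨C, hC, hCZ⟩ := exists_countable_cofinal (Z := Z)
        fun ⟨f, hf, hlt⟩ => hno.1 ⟨f, fun a ha => hZ (hf a ha), hlt⟩
      obtain ⟨C', hC', hCZ'⟩ := exists_countable_coinitial (Z := Z)
        fun ⟨f, hf, hlt⟩ => hno.2 ⟨f, fun a ha => hZ (hf a ha), hlt⟩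
      refine ⟨C ∪ C', hC.union hC', fun _ z hz => ⟨?_, ?_⟩⟩
      · obtain ⟨c, hc, hcz⟩ := hCZ z hz
        exact ⟨c, Or.inl hc, hcz⟩
      · obtain ⟨c, hc, hcz⟩ := hCZ' z hz
        exact ⟨c, Or.inr hc, hcz⟩
    · exact ⟨∅, countable_empty, fun h => absurd h hZ⟩
  choose C hC hCZ using hcof
  choose d hdD hd using FinalSegs.exists_separating hdense
  have hcont : ∀ γ, Continuous fun F => h F γ := fun γ =>
    (continuous_apply γ).comp hemb.continuous
  choose S hS hSdep using fun γ => FinalSegs.exists_countable_dependence (hcont γ)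
  obtain ⟨N, hN, hN₀, hNcl⟩ := exists_countable_closed
    (fun a b => (C (Y ∩ Ioi a) ∪ C (Y ∩ Iio a)) ∪
      ⋃ γ ∈ {γ | h (d a b) γ ≠ 0}, ⋃ p ∈ S γ, C (Y ∩ Iic p) ∪ C (Y ∩ Ici p))
    (fun a b => ((hC _).union (hC _)).union
      ((hdD a b).biUnion fun γ _ => (hS γ).biUnion fun p _ => (hC _).union (hC _)))
    (hC Y)
  obtain ⟨y, hyY, hyN⟩ : ∃ y ∈ Y, y ∉ N := by
    by_contra! hsub
    exact hY (hN.mono hsub)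
  have hlt_of_le : ∀ c ∈ N, c ≤ y → c < y := fun c hc hcy =>
    lt_of_le_of_ne hcy fun he => hyN (he ▸ hc)
  have hgt_of_ge : ∀ c ∈ N, y ≤ c → y < c := fun c hc hcy =>
    lt_of_le_of_ne hcy fun he => hyN (he ▸ hc)
  obtain ⟨⟨b₀, hb₀, hyb₀, -⟩, a₀, ha₀, hay₀, -⟩ := hCZ Y subset_rfl y hyY
  obtain ⟨F, hFcl, hF⟩ := FinalSegs.exists_upper_limit (A := N ∩ Iio y)
    ⟨a₀, hN₀ ha₀, hlt_of_le _ (hN₀ ha₀) hay₀⟩ (by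
      rintro a ⟨haN, hay⟩
      obtain ⟨-, c, hc, hcy, -, hac⟩ := hCZ (Y ∩ Ioi a) inter_subset_left y ⟨hyY, hay⟩
      have hcN : c ∈ N := hNcl a haN a haN (Or.inl (Or.inl hc))
      exact ⟨c, ⟨hcN, hlt_of_le _ hcN hcy⟩, hac⟩) hd
  obtain ⟨G, hGcl, hG⟩ := FinalSegs.exists_lower_limit (B := N ∩ Ioi y)
    ⟨b₀, hN₀ hb₀, hgt_of_ge _ (hN₀ hb₀) hyb₀⟩ (by
      rintro b ⟨hbN, hyb⟩
      obtain ⟨⟨c, hc, hyc, -, hcb⟩, -⟩ := hCZ (Y ∩ Iio b) inter_subset_left y ⟨hyY, hyb⟩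
      have hcN : c ∈ N := hNcl b hbN b hbN (Or.inl (Or.inr hc))
      exact ⟨c, ⟨hcN, hgt_of_ge _ hcN hyc⟩, hcb⟩) hd
  have hFy : F.1 y = true := (hF y).mpr fun a ha => ha.2
  have hGy : ¬ G.1 y = true := fun hy => by
    obtain ⟨b, hb, hby⟩ := (hG y).mp hy
    exact absurd hb.2 (not_lt.mpr hby)
  have hne : h F ≠ h G := fun he => hGy (hemb.injective he ▸ hFy)
  obtain ⟨γ, hγ⟩ := Function.ne_iff.mp hne
  obtain ⟨a, haN, b, hbN, hab⟩ : ∃ a ∈ N, ∃ b ∈ N, h (d a b) γ ≠ 0 := by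
    by_contra! hzero
    have hvanish : ∀ A ⊆ N, closure {E | ∃ a ∈ A, ∃ b ∈ A, d a b = E} ⊆ {E | h E γ = 0} := by
      intro A hA
      refine closure_minimal ?_ (isClosed_eq (hcont γ) continuous_const)
      rintro E ⟨a, ha, b, hb, rfl⟩
      exact hzero a (hA ha) b (hA hb)
    exact hγ ((hvanish _ inter_subset_left hFcl).trans
      (hvanish _ inter_subset_left hGcl).symm)
  obtain ⟨p, hp, hFGp⟩ := hSdep γ F G hγ
  have hpN : C (Y ∩ Iic p) ∪ C (Y ∩ Ici p) ⊆ N := fun x hx =>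
    hNcl a haN b hbN (Or.inr (mem_biUnion hab (mem_biUnion hp hx)))
  rcases le_total y p with hyp | hpy
  · obtain ⟨⟨c, hc, hyc, -, hcp⟩, -⟩ := hCZ (Y ∩ Iic p) inter_subset_left y ⟨hyY, hyp⟩
    have hcN : c ∈ N := hpN (Or.inl hc)
    exact hFGp (((F.2 _ _ hyp hFy)).trans
      ((hG p).mpr ⟨c, ⟨hcN, hgt_of_ge _ hcN hyc⟩, hcp⟩).symm)
  · obtain ⟨-, c, hc, hcy, -, hpc⟩ := hCZ (Y ∩ Ici p) inter_subset_left y ⟨hyY, hpy⟩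
    have hcN : c ∈ N := hpN (Or.inr hc)
    have hFp : F.1 p = false := Bool.eq_false_iff.mpr fun hp' =>
      absurd ((hF p).mp hp' c ⟨hcN, hlt_of_le _ hcN hcy⟩) (not_lt.mpr hpc)
    have hGp : G.1 p = false := Bool.eq_false_iff.mpr fun hp' => hGy (G.2 _ _ hpy hp')
    exact hFGp (hFp.trans hGp.symm)
end

section
/- Let X be a linearly ordered set of cardinality at most ℵ₁. Then the following are equivalent: (a) every increasing ω₁-sequence in X that is bounded above has a supremum in X and every decreasing ω₁-sequence in X that is bounded below has an infimum in X; (b) every point of the compact line 𝕂(X) whose neighborhood filter has no countable basis is isolated from one side, i.e. one of the intervals (←, x] or [x, →) is open in 𝕂(X). -/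
universe u

open Set Filter Topology

/-- Every increasing `ω₁`-sequence in `X` which is bounded above has a supremum in `X`. -/
noncomputable def HasOmega1Sups (X : Type u) [LinearOrder X] : Prop :=
  ∀ g : Ordinal.{0} → X,
    (∀ a b : Ordinal, a < omega1 → b < omega1 → a ≤ b → g a ≤ g b) →
    (∃ ub : X, ∀ a < omega1, g a ≤ ub) →
    ∃ s : X, IsLUB (g '' Set.Iio omega1) s

/-- Every decreasing `ω₁`-sequence in `X` which is bounded below has an infimum in `X`. -/
noncomputable def HasOmega1Infs (X : Type u) [LinearOrder X] : Prop :=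
  ∀ g : Ordinal.{0} → X,
    (∀ a b : Ordinal, a < omega1 → b < omega1 → a ≤ b → g b ≤ g a) →
    (∃ lb : X, ∀ a < omega1, lb ≤ g a) →
    ∃ s : X, IsGLB (g '' Set.Iio omega1) s

/-- The order of `𝕂(X)` (reverse inclusion): `F ≤ G` iff `G ⊆ F`. -/
def segLE {X : Type u} [LinearOrder X] (F G : FinalSegs X) : Prop :=
  ∀ x : X, G.1 x = true → F.1 x = true

theorem omega1_pos : 0 < omega1 := by
  rw [omega1, Cardinal.ord_aleph]
  exact Ordinal.omega_pos 1

theorem countable_Iic_of_lt_omega1 {a : Ordinal.{0}} (ha : a < omega1) : (Iic a).Countable := by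
  have hs : Order.succ a < omega1 :=
    (Cardinal.isSuccLimit_ord (Cardinal.aleph0_le_aleph 1)).succ_lt ha
  rw [← Order.Iio_succ, ← Cardinal.le_aleph0_iff_set_countable, Cardinal.mk_Iio_ordinal,
    Cardinal.lift_le_aleph0, ← Cardinal.lt_aleph_one_iff]
  exact Cardinal.lt_ord.1 hs

theorem exists_lt_omega1_forall_le (f : ℕ → Ordinal.{0}) (hf : ∀ n, f n < omega1) :
    ∃ a < omega1, ∀ n, f n ≤ a := by
  simp only [omega1, Cardinal.ord_aleph] at hf ⊢
  exact ⟨⨆ n, f n, Ordinal.iSup_lt_omega_one hf, fun n => Ordinal.le_iSup f n⟩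

/-- A nonempty set of cardinality at most `ℵ₁` is enumerated by `ω₁`. -/
theorem exists_omega1_enumeration {X : Type u} (hcard : Cardinal.mk X ≤ Cardinal.aleph 1)
    {L : Set X} (hne : L.Nonempty) :
    ∃ e : Ordinal.{0} → X, (∀ a, e a ∈ L) ∧ ∀ x ∈ L, ∃ a < omega1, e a = x := by
  obtain ⟨x₀, hx₀⟩ := hne
  have hle : Cardinal.lift.{1} (Cardinal.mk L) ≤ Cardinal.lift.{u} (Cardinal.mk (Iio omega1)) := by
    rw [Cardinal.mk_Iio_ordinal, omega1, Cardinal.card_ord]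
    simpa using (Cardinal.mk_set_le L).trans hcard
  obtain ⟨i⟩ := Cardinal.lift_mk_le'.1 hle
  classical
  refine ⟨fun a => if h : ∃ x : L, (i x : Ordinal) = a then h.choose else x₀, fun a => ?_,
    fun x hx => ⟨i ⟨x, hx⟩, (i ⟨x, hx⟩).2, ?_⟩⟩
  · by_cases h : ∃ x : L, (i x : Ordinal) = a
    · simp only [h, dite_true]
      exact h.choose.2
    · simpa only [h, dite_false] using hx₀
  · have h : ∃ y : L, (i y : Ordinal) = i ⟨x, hx⟩ := ⟨_, rfl⟩
    simp only [h, dite_true]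
    exact congrArg Subtype.val (i.injective (Subtype.ext h.choose_spec))

section CountableCofinality

variable {X : Type u} [LinearOrder X]

/-- `L` has a countable cofinal subset. -/
def CountablyCofinal (L : Set X) : Prop :=
  ∃ D : Set X, D.Countable ∧ D ⊆ L ∧ ∀ x ∈ L, ∃ d ∈ D, x ≤ d

/-- `U` has a countable coinitial subset. -/
def CountablyCoinitial (U : Set X) : Prop :=
  ∃ D : Set X, D.Countable ∧ D ⊆ U ∧ ∀ x ∈ U, ∃ d ∈ D, d ≤ x

theorem CountablyCofinal.empty : CountablyCofinal (∅ : Set X) :=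
  ⟨∅, countable_empty, subset_rfl, by simp⟩

theorem IsGreatest.countablyCofinal {L : Set X} {m : X} (h : IsGreatest L m) :
    CountablyCofinal L :=
  ⟨{m}, countable_singleton m, by simpa using h.1, fun _ hx => ⟨m, rfl, h.2 hx⟩⟩

theorem CountablyCoinitial.empty : CountablyCoinitial (∅ : Set X) :=
  CountablyCofinal.empty (X := Xᵒᵈ)

theorem IsLeast.countablyCoinitial {U : Set X} {m : X} (h : IsLeast U m) :
    CountablyCoinitial U :=
  IsGreatest.countablyCofinal (X := Xᵒᵈ) h

/-- A set of cardinality at most `ℵ₁` without countable cofinal subsets has a cofinal increasing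
`ω₁`-sequence. -/
theorem exists_omega1_cofinal (hcard : Cardinal.mk X ≤ Cardinal.aleph 1) {L : Set X}
    (hL : ¬ CountablyCofinal L) :
    ∃ g : Ordinal.{0} → X, (∀ a b : Ordinal, a < omega1 → b < omega1 → a ≤ b → g a ≤ g b) ∧
      (∀ a, g a ∈ L) ∧ ∀ x ∈ L, ∃ a < omega1, x ≤ g a := by
  have hne : L.Nonempty := by
    rw [nonempty_iff_ne_empty]
    rintro rfl
    exact hL .empty
  obtain ⟨e, heL, hesurj⟩ := exists_omega1_enumeration hcard hne
  have hbound : ∀ a < omega1, ∃ c, ∀ b ≤ a, e b ≤ e c := by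
    intro a ha
    by_contra! h
    refine hL ⟨e '' Iic a, (countable_Iic_of_lt_omega1 ha).image e,
      image_subset_iff.2 fun b _ => heL b, fun x hx => ?_⟩
    obtain ⟨c, -, rfl⟩ := hesurj x hx
    obtain ⟨b, hb, hlt⟩ := h c
    exact ⟨e b, ⟨b, hb, rfl⟩, hlt.le⟩
  let c : Ordinal.{0} → Ordinal.{0} := fun a => sInf {c | ∀ b ≤ a, e b ≤ e c}
  have hc : ∀ a < omega1, ∀ b ≤ a, e b ≤ e (c a) := fun a ha => csInf_mem (hbound a ha)
  refine ⟨fun a => e (c a), fun a b ha hb hab => ?_, fun a => heL _, fun x hx => ?_⟩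
  · have hcab : c a ≤ c b := csInf_le' fun d hd => hc b hb d (hd.trans hab)
    rcases hcab.eq_or_lt with heq | hlt
    · exact (congrArg e heq).le
    · have : ¬ ∀ d ≤ b, e d ≤ e (c a) := notMem_of_lt_csInf' hlt
      push Not at this
      obtain ⟨d, hd, hlt'⟩ := this
      exact hlt'.le.trans (hc b hb d hd)
  · obtain ⟨a, ha, rfl⟩ := hesurj x hx
    exact ⟨a, ha, hc a ha a le_rfl⟩

theorem hasOmega1Sups_iff (hcard : Cardinal.mk X ≤ Cardinal.aleph 1) :
    HasOmega1Sups X ↔ ∀ L : Set X, IsLowerSet L → Lᶜ.Nonempty → ¬ CountablyCofinal L →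
      ∃ m, IsLeast Lᶜ m := by
  constructor
  · rintro h L hlow ⟨u, hu⟩ hL
    obtain ⟨g, hmono, hgL, hcof⟩ := exists_omega1_cofinal hcard hL
    have hub : ∀ y ∉ L, ∀ x ∈ L, x ≤ y := fun y hy x hx =>
      (le_total x y).resolve_right fun hyx => hy (hlow hyx hx)
    obtain ⟨s, hs⟩ := h g hmono ⟨u, fun a _ => hub u hu _ (hgL a)⟩
    refine ⟨s, fun hsL => hL ?_, fun y hy => hs.2 ?_⟩
    · refine IsGreatest.countablyCofinal (m := s) ⟨hsL, fun x hx => ?_⟩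
      obtain ⟨a, ha, hxa⟩ := hcof x hx
      exact hxa.trans (hs.1 ⟨a, ha, rfl⟩)
    · rintro _ ⟨a, -, rfl⟩
      exact hub y hy _ (hgL a)
  · rintro h g hmono ⟨u, hu⟩
    let L : Set X := {x | ∃ a < omega1, x ≤ g a}
    have hgL : ∀ a < omega1, g a ∈ L := fun a ha => ⟨a, ha, le_rfl⟩
    have hlow : IsLowerSet L := fun x y hyx ⟨a, ha, hxa⟩ => ⟨a, ha, hyx.trans hxa⟩
    by_cases hmax : ∃ m, IsGreatest L m
    · obtain ⟨m, ⟨a, ha, hma⟩, hm⟩ := hmax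
      refine ⟨m, ?_, fun v hv => hma.trans (hv ⟨a, ha, rfl⟩)⟩
      rintro _ ⟨b, hb, rfl⟩
      exact hm (hgL b hb)
    have hout : ∀ v ∈ upperBounds (g '' Iio omega1), v ∉ L := fun v hv hvL =>
      hmax ⟨v, hvL, fun x ⟨a, ha, hxa⟩ => hxa.trans (hv ⟨a, ha, rfl⟩)⟩
    have hL : ¬ CountablyCofinal L := by
      rintro ⟨D, hD, hDL, hcof⟩
      obtain ⟨d₀, hd₀, -⟩ := hcof _ (hgL 0 omega1_pos)
      obtain ⟨d, rfl⟩ := hD.exists_eq_range ⟨d₀, hd₀⟩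
      choose f hf hdf using fun n => hDL (mem_range_self n)
      obtain ⟨a, ha, hfa⟩ := exists_lt_omega1_forall_le f hf
      refine hmax ⟨g a, hgL a ha, fun x hx => ?_⟩
      obtain ⟨_, ⟨n, rfl⟩, hxn⟩ := hcof x hx
      exact hxn.trans ((hdf n).trans (hmono _ _ (hf n) ha (hfa n)))
    obtain ⟨m, hm, hleast⟩ := h L hlow
      ⟨u, hout u (by rintro _ ⟨a, ha, rfl⟩; exact hu a ha)⟩ hL
    refine ⟨m, ?_, fun v hv => hleast (hout v hv)⟩
    rintro _ ⟨a, ha, rfl⟩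
    exact le_of_not_ge fun hle => hm ⟨a, ha, hle⟩

theorem hasOmega1Infs_iff (hcard : Cardinal.mk X ≤ Cardinal.aleph 1) :
    HasOmega1Infs X ↔ ∀ U : Set X, IsUpperSet U → Uᶜ.Nonempty → ¬ CountablyCoinitial U →
      ∃ m, IsGreatest Uᶜ m :=
  hasOmega1Sups_iff (X := Xᵒᵈ) hcard

end CountableCofinality

namespace FinalSegs

variable {X : Type u} [LinearOrder X]

/-- The set of elements of a final segment. -/
def carrier (F : FinalSegs X) : Set X := {x | F.1 x = true}

theorem mem_carrier {F : FinalSegs X} {x : X} : x ∈ carrier F ↔ F.1 x = true := Iff.rfl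

theorem isUpperSet_carrier (F : FinalSegs X) : IsUpperSet (carrier F) := F.2

open Classical in
/-- The final segment with a given upper set of elements. -/
noncomputable def ofUpperSet (U : Set X) (hU : IsUpperSet U) : FinalSegs X :=
  ⟨fun x => decide (x ∈ U), fun x y hxy hx => by simpa using hU hxy (by simpa using hx)⟩

@[simp]
theorem carrier_ofUpperSet (U : Set X) (hU : IsUpperSet U) : carrier (ofUpperSet U hU) = U := by
  ext x
  simp [carrier, ofUpperSet]

theorem apply_eq_iff {F G : FinalSegs X} {x : X} :
    G.1 x = F.1 x ↔ (x ∈ carrier G ↔ x ∈ carrier F) :=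
  Bool.eq_iff_iff

theorem nhds_eq_iInf (F : FinalSegs X) : 𝓝 F = ⨅ x, 𝓟 {G : FinalSegs X | G.1 x = F.1 x} := by
  rw [nhds_subtype_eq_comap, nhds_pi, Filter.pi, comap_iInf]
  refine iInf_congr fun x => ?_
  rw [nhds_discrete, comap_comap, ← principal_singleton, comap_principal]
  rfl

theorem eventually_mem_carrier {F : FinalSegs X} {x : X} (hx : x ∈ carrier F) :
    {G : FinalSegs X | x ∈ carrier G} ∈ 𝓝 F := by
  rw [nhds_eq_iInf]
  exact mem_iInf_of_mem x fun G hG => (apply_eq_iff.1 hG).2 hx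

theorem eventually_notMem_carrier {F : FinalSegs X} {x : X} (hx : x ∉ carrier F) :
    {G : FinalSegs X | x ∉ carrier G} ∈ 𝓝 F := by
  rw [nhds_eq_iInf]
  exact mem_iInf_of_mem x fun G hG => mt (apply_eq_iff.1 hG).1 hx

/-- Every neighborhood of `F` contains all final segments agreeing with `F` on some finite set. -/
theorem exists_finset_of_mem_nhds {F : FinalSegs X} {U : Set (FinalSegs X)} (hU : U ∈ 𝓝 F) :
    ∃ T : Finset X, ∀ G : FinalSegs X, (∀ x ∈ T, x ∈ carrier G ↔ x ∈ carrier F) → G ∈ U := by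
  rw [nhds_eq_iInf, mem_iInf_finite] at hU
  obtain ⟨T, hT⟩ := hU
  rw [iInf_principal_finset, mem_principal] at hT
  exact ⟨T, fun G hG => hT (mem_iInter₂.2 fun x hx => apply_eq_iff.2 (hG x hx))⟩

/-- If all final segments agreeing with `F` on `T` contain `x`, then `x` lies above an element
of `T` in `F`. -/
theorem exists_mem_le_of_agree {F : FinalSegs X} {T : Set X} {x : X}
    (h : ∀ G : FinalSegs X, (∀ y ∈ T, y ∈ carrier G ↔ y ∈ carrier F) → x ∈ carrier G) :
    ∃ d ∈ T, d ∈ carrier F ∧ d ≤ x := by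
  by_contra! hT
  have := h (ofUpperSet (carrier F ∩ Ioi x) ((isUpperSet_carrier F).inter (isUpperSet_Ioi x)))
    fun y hy => by simpa using hT y hy
  simp at this

/-- If no final segment agreeing with `F` on `T` contains `x`, then `x` lies below an element
of `T` outside `F`. -/
theorem exists_notMem_ge_of_agree {F : FinalSegs X} {T : Set X} {x : X}
    (h : ∀ G : FinalSegs X, (∀ y ∈ T, y ∈ carrier G ↔ y ∈ carrier F) → x ∉ carrier G) :
    ∃ d ∈ T, d ∉ carrier F ∧ x ≤ d := by
  by_contra! hT
  have := h (ofUpperSet (carrier F ∪ Ici x) ((isUpperSet_carrier F).union (isUpperSet_Ici x)))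
    fun y hy => by
      have := hT y hy
      by_cases hyF : y ∈ carrier F <;> simp_all
  simp at this

theorem isCountablyGenerated_nhds_iff (F : FinalSegs X) :
    (𝓝 F).IsCountablyGenerated ↔
      CountablyCofinal (carrier F)ᶜ ∧ CountablyCoinitial (carrier F) := by
  constructor
  · intro hF
    obtain ⟨s, hs⟩ := (𝓝 F).exists_antitone_basis
    choose T hT using fun n => exists_finset_of_mem_nhds (hs.mem n)
    have hcount : (⋃ n, (T n : Set X)).Countable := countable_iUnion fun n => (T n).countable_toSet
    constructor
    · refine ⟨(⋃ n, (T n : Set X)) ∩ (carrier F)ᶜ, hcount.mono inter_subset_left,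
        inter_subset_right, fun x hx => ?_⟩
      obtain ⟨n, hn⟩ := hs.mem_iff.1 (eventually_notMem_carrier hx)
      obtain ⟨d, hdT, hdF, hd⟩ := exists_notMem_ge_of_agree fun G hG => hn (hT n G hG)
      exact ⟨d, ⟨mem_iUnion_of_mem n hdT, hdF⟩, hd⟩
    · refine ⟨(⋃ n, (T n : Set X)) ∩ carrier F, hcount.mono inter_subset_left,
        inter_subset_right, fun x hx => ?_⟩
      obtain ⟨n, hn⟩ := hs.mem_iff.1 (eventually_mem_carrier hx)
      obtain ⟨d, hdT, hdF, hd⟩ := exists_mem_le_of_agree fun G hG => hn (hT n G hG)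
      exact ⟨d, ⟨mem_iUnion_of_mem n hdT, hdF⟩, hd⟩
  · rintro ⟨⟨D, hD, hDF, hDcof⟩, E, hE, hEF, hEcoi⟩
    have : 𝓝 F = ⨅ d : ↥(D ∪ E), 𝓟 {G : FinalSegs X | G.1 d = F.1 d} := by
      rw [nhds_eq_iInf]
      refine le_antisymm (le_iInf fun d => iInf_le _ d.1) (le_iInf fun x => ?_)
      by_cases hx : x ∈ carrier F
      · obtain ⟨d, hd, hdx⟩ := hEcoi x hx
        refine iInf_le_of_le ⟨d, Or.inr hd⟩ (principal_mono.2 fun G hG => apply_eq_iff.2 ?_)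
        exact iff_of_true (isUpperSet_carrier G hdx ((apply_eq_iff.1 hG).2 (hEF hd))) hx
      · obtain ⟨d, hd, hxd⟩ := hDcof x hx
        refine iInf_le_of_le ⟨d, Or.inl hd⟩ (principal_mono.2 fun G hG => apply_eq_iff.2 ?_)
        exact iff_of_false (fun hxG => hDF hd ((apply_eq_iff.1 hG).1
          (isUpperSet_carrier G hxd hxG))) hx
    have : Countable ↥(D ∪ E) := (hD.union hE).to_subtype
    rw [‹𝓝 F = _›]
    infer_instance

theorem isOpen_setOf_mem_carrier (x : X) : IsOpen {G : FinalSegs X | x ∈ carrier G} :=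
  isOpen_iff_mem_nhds.2 fun _ h => eventually_mem_carrier h

theorem isOpen_setOf_notMem_carrier (x : X) : IsOpen {G : FinalSegs X | x ∉ carrier G} :=
  isOpen_iff_mem_nhds.2 fun _ h => eventually_notMem_carrier h

theorem isOpen_setOf_segLE_left_iff (F : FinalSegs X) :
    IsOpen {G : FinalSegs X | segLE G F} ↔ carrier F = ∅ ∨ ∃ m, IsLeast (carrier F) m := by
  constructor
  · intro h
    obtain ⟨T, hT⟩ := exists_finset_of_mem_nhds (h.mem_nhds (x := F) fun _ hx => hx)
    have hkey : ∀ x ∈ carrier F, ∃ d ∈ (T : Set X), d ∈ carrier F ∧ d ≤ x := fun x hx =>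
      exists_mem_le_of_agree fun G hG => hT G hG x hx
    refine (carrier F).eq_empty_or_nonempty.imp_right fun ⟨x, hx⟩ => ?_
    obtain ⟨d, hdT, hdF, -⟩ := hkey x hx
    obtain ⟨m, hm, hmin⟩ := exists_min_image ((T : Set X) ∩ carrier F) id
      (T.finite_toSet.inter_of_left _) ⟨d, hdT, hdF⟩
    refine ⟨m, hm.2, fun y hy => ?_⟩
    obtain ⟨e, heT, heF, hey⟩ := hkey y hy
    exact (hmin e ⟨heT, heF⟩).trans hey
  · rintro (h | ⟨m, hm⟩)
    · have : {G : FinalSegs X | segLE G F} = univ :=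
        eq_univ_of_forall fun G x hx => absurd (mem_carrier.2 hx) (h ▸ notMem_empty x)
      exact this ▸ isOpen_univ
    · convert isOpen_setOf_mem_carrier m using 1
      ext G
      exact ⟨fun h => h m hm.1, fun h x hx => isUpperSet_carrier G (hm.2 hx) h⟩

theorem isOpen_setOf_segLE_right_iff (F : FinalSegs X) :
    IsOpen {G : FinalSegs X | segLE F G} ↔
      (carrier F)ᶜ = ∅ ∨ ∃ m, IsGreatest (carrier F)ᶜ m := by
  constructor
  · intro h
    obtain ⟨T, hT⟩ := exists_finset_of_mem_nhds (h.mem_nhds (x := F) fun _ hx => hx)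
    have hkey : ∀ x ∉ carrier F, ∃ d ∈ (T : Set X), d ∉ carrier F ∧ x ≤ d := fun x hx =>
      exists_notMem_ge_of_agree fun G hG hxG => hx (hT G hG x hxG)
    refine (carrier F)ᶜ.eq_empty_or_nonempty.imp_right fun ⟨x, hx⟩ => ?_
    obtain ⟨d, hdT, hdF, -⟩ := hkey x hx
    obtain ⟨m, hm, hmax⟩ := exists_max_image ((T : Set X) ∩ (carrier F)ᶜ) id
      (T.finite_toSet.inter_of_left _) ⟨d, hdT, hdF⟩
    refine ⟨m, hm.2, fun y hy => ?_⟩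
    obtain ⟨e, heT, heF, hye⟩ := hkey y hy
    exact hye.trans (hmax e ⟨heT, heF⟩)
  · rintro (h | ⟨m, hm⟩)
    · have : {G : FinalSegs X | segLE F G} = univ :=
        eq_univ_of_forall fun G x _ => mem_carrier.1 (compl_empty_iff.1 h ▸ mem_univ x)
      exact this ▸ isOpen_univ
    · convert isOpen_setOf_notMem_carrier m using 1
      ext G
      refine ⟨fun h hmG => hm.1 (h m hmG), fun h x hxG => ?_⟩
      by_contra hxF
      exact h (isUpperSet_carrier G (hm.2 hxF) hxG)

end FinalSegs

theorem omega1_limits_iff_uncountable_char_isolated (X : Type u) [LinearOrder X]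
    (hcard : Cardinal.mk X ≤ Cardinal.aleph 1) :
    (HasOmega1Sups X ∧ HasOmega1Infs X) ↔
      ∀ F : FinalSegs X, ¬ (𝓝 F).IsCountablyGenerated →
        IsOpen {G : FinalSegs X | segLE G F} ∨ IsOpen {G : FinalSegs X | segLE F G} := by
  rw [hasOmega1Sups_iff hcard, hasOmega1Infs_iff hcard]
  simp only [FinalSegs.isCountablyGenerated_nhds_iff, FinalSegs.isOpen_setOf_segLE_left_iff,
    FinalSegs.isOpen_setOf_segLE_right_iff]
  constructor
  · rintro ⟨hsup, hinf⟩ F hF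
    rcases not_and_or.1 hF with hcof | hcoi
    · refine .inl ((FinalSegs.carrier F).eq_empty_or_nonempty.imp_right fun hne => ?_)
      simpa using hsup _ (FinalSegs.isUpperSet_carrier F).compl (by simpa using hne) hcof
    · exact .inr ((FinalSegs.carrier F)ᶜ.eq_empty_or_nonempty.imp_right fun hne =>
        hinf _ (FinalSegs.isUpperSet_carrier F) hne hcoi)
  · refine fun h => ⟨fun L hL hne hcof => ?_, fun U hU hne hcoi => ?_⟩
    · have := h (FinalSegs.ofUpperSet Lᶜ hL.compl) (by simp [hcof])
      simp only [FinalSegs.carrier_ofUpperSet, compl_compl] at this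
      rcases this with (h0 | hm) | (rfl | ⟨m, hm⟩)
      · exact absurd h0 hne.ne_empty
      · exact hm
      · exact absurd .empty hcof
      · exact absurd hm.countablyCofinal hcof
    · have := h (FinalSegs.ofUpperSet U hU) (by simp [hcoi])
      simp only [FinalSegs.carrier_ofUpperSet] at this
      rcases this with (rfl | ⟨m, hm⟩) | (h0 | hm)
      · exact absurd .empty hcoi
      · exact absurd hm.countablyCoinitial hcoi
      · exact absurd h0 hne.ne_empty
      · exact hm
end

section
/- Let X be a linearly ordered set such that for every stationary set S ⊆ ω₁ and every map f : S → X there is a stationary set T ⊆ S such that the restriction of f to T is monotone. Then every uncountable subset of X contains a subset order-isomorphic to ω₁ or a subset order-isomorphic to ω₁ with the reversed order. -/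
universe u

open Set Filter Topology

/-- `C` is a closed unbounded subset of `ω₁`. -/
noncomputable def IsClubInOmega1 (C : Set Ordinal.{0}) : Prop :=
  C ⊆ Set.Iio omega1 ∧ (∀ a < omega1, ∃ b ∈ C, a < b) ∧
    ∀ a < omega1, (C ∩ Set.Iio a).Nonempty → sSup (C ∩ Set.Iio a) = a → a ∈ C

/-- `S` is a stationary subset of `ω₁`: it meets every closed unbounded subset of `ω₁`. -/
noncomputable def IsStationaryInOmega1 (S : Set Ordinal.{0}) : Prop :=
  S ⊆ Set.Iio omega1 ∧ ∀ C : Set Ordinal.{0}, IsClubInOmega1 C → (S ∩ C).Nonempty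

/-- For every stationary `S ⊆ ω₁` and every map `f : S → X` there is a stationary `T ⊆ S`
on which `f` is monotone. -/
noncomputable def StationaryMonotoneProperty (X : Type u) [LinearOrder X] : Prop :=
  ∀ S : Set Ordinal.{0}, IsStationaryInOmega1 S → ∀ f : Ordinal.{0} → X,
    ∃ T : Set Ordinal.{0}, T ⊆ S ∧ IsStationaryInOmega1 T ∧
      (MonotoneOn f T ∨ AntitoneOn f T)

theorem omega1_eq : omega1 = Ordinal.omega 1 := Cardinal.ord_aleph 1

theorem isSuccLimit_omega1 : Order.IsSuccLimit omega1 :=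
  omega1_eq ▸ Cardinal.isSuccLimit_omega 1

theorem countable_Iio_of_lt_omega1 {a : Ordinal.{0}} (ha : a < omega1) : (Set.Iio a).Countable := by
  rw [← Cardinal.le_aleph0_iff_set_countable, Cardinal.mk_Iio_ordinal, Cardinal.lift_le_aleph0,
    ← Cardinal.lt_aleph_one_iff]
  exact Cardinal.lt_ord.1 ha

theorem isClubInOmega1_Ioo {a : Ordinal.{0}} (ha : a < omega1) :
    IsClubInOmega1 (Set.Ioo a omega1) := by
  refine ⟨fun _ hx => hx.2, fun b hb => ?_, fun b hb ⟨c, hc, hcb⟩ _ => ⟨hc.1.trans hcb, hb⟩⟩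
  exact ⟨Order.succ (max a b),
    ⟨Order.lt_succ_of_le (le_max_left a b), isSuccLimit_omega1.succ_lt (max_lt ha hb)⟩,
    Order.lt_succ_of_le (le_max_right a b)⟩

theorem IsStationaryInOmega1.exists_gt {T : Set Ordinal.{0}} (hT : IsStationaryInOmega1 T)
    {a : Ordinal.{0}} (ha : a < omega1) : ∃ t ∈ T, a < t := by
  obtain ⟨t, ht, hat⟩ := hT.2 _ (isClubInOmega1_Ioo ha)
  exact ⟨t, ht, hat.1⟩

theorem isStationaryInOmega1_Iio : IsStationaryInOmega1 (Set.Iio omega1) := by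
  refine ⟨subset_rfl, fun C hC => ?_⟩
  obtain ⟨b, hb, -⟩ := hC.2.1 0 isSuccLimit_omega1.bot_lt
  exact ⟨b, hC.1 hb, hb⟩

/-- A stationary set contains the range of a strictly increasing `ω₁`-sequence. -/
theorem IsStationaryInOmega1.exists_strictMonoOn {T : Set Ordinal.{0}}
    (hT : IsStationaryInOmega1 T) :
    ∃ g : Ordinal.{0} → Ordinal.{0}, StrictMono g ∧ ∀ a < omega1, g a ∈ T := by
  have hs : ¬ BddAbove (T ∪ Set.Ici omega1) := fun hb =>
    not_bddAbove_Ici _ (hb.mono Set.subset_union_right)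
  refine ⟨Ordinal.enumOrd (T ∪ Set.Ici omega1), Ordinal.enumOrd_strictMono hs, fun a ha => ?_⟩
  suffices hlt : Ordinal.enumOrd (T ∪ Set.Ici omega1) a < omega1 from
    (Ordinal.enumOrd_mem hs a).resolve_right hlt.not_ge
  induction a using WellFoundedLT.induction with
  | ind a ih =>
    have : Countable (Set.Iio a) := (countable_Iio_of_lt_omega1 ha).to_subtype
    have hsup : ⨆ b : Set.Iio a, Ordinal.enumOrd (T ∪ Set.Ici omega1) b < omega1 := by
      rw [omega1_eq]
      exact Ordinal.iSup_lt_omega_one fun b => omega1_eq ▸ ih b b.2 (b.2.trans ha)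
    obtain ⟨t, ht, hlt⟩ := hT.exists_gt hsup
    refine (Ordinal.enumOrd_le_of_forall_lt (.inl ht) fun b hb => ?_).trans_lt (hT.1 ht)
    exact (Ordinal.le_iSup (fun b : Set.Iio a => Ordinal.enumOrd (T ∪ Set.Ici omega1) b)
      ⟨b, hb⟩).trans_lt hlt

theorem exists_injOn_omega1 {X : Type u} {Y : Set X} (hY : ¬ Y.Countable) :
    ∃ f : Ordinal.{0} → X, Set.InjOn f (Set.Iio omega1) ∧ ∀ a < omega1, f a ∈ Y := by
  have hcard : Cardinal.lift.{u} (Cardinal.mk (Set.Iio omega1)) ≤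
      Cardinal.lift.{1} (Cardinal.mk Y) := by
    rw [Cardinal.mk_Iio_ordinal, omega1, Cardinal.card_ord, Cardinal.lift_aleph,
      Cardinal.lift_aleph, Ordinal.lift_one, Ordinal.lift_one, Cardinal.aleph_one_le_iff,
      Cardinal.aleph0_lt_lift]
    rwa [← Cardinal.le_aleph0_iff_set_countable, not_le] at hY
  obtain ⟨e⟩ := Cardinal.lift_mk_le'.1 hcard
  obtain ⟨y, -⟩ : Y.Nonempty := Set.nonempty_iff_ne_empty.2 fun hY' => hY (hY' ▸ Set.countable_empty)
  classical
  refine ⟨fun a => if ha : a < omega1 then e ⟨a, ha⟩ else y, fun a ha b hb hab => ?_,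
    fun a ha => ?_⟩
  · simp only [Set.mem_Iio.1 ha, Set.mem_Iio.1 hb, dite_true] at hab
    exact congrArg Subtype.val (e.injective (Subtype.val_injective hab))
  · simp [ha]

theorem containsOmega1Copy_of_stationaryMonotone (X : Type u) [LinearOrder X]
    (h : StationaryMonotoneProperty X) :
    ∀ Y : Set X, ¬ Y.Countable → ContainsOmega1Copy Y ∨ ContainsOmega1RevCopy Y := by
  intro Y hY
  obtain ⟨f, hinj, hfY⟩ := exists_injOn_omega1 hY
  obtain ⟨T, -, hT, hf⟩ := h _ isStationaryInOmega1_Iio f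
  obtain ⟨g, hg, hgT⟩ := hT.exists_strictMonoOn
  have hne : ∀ a b, a < omega1 → b < omega1 → a < b → f (g a) ≠ f (g b) := fun a b ha hb hab =>
    hinj.ne (hT.1 (hgT a ha)) (hT.1 (hgT b hb)) (hg hab).ne
  have hY' : ∀ a < omega1, f (g a) ∈ Y := fun a ha => hfY _ (hT.1 (hgT a ha))
  refine hf.imp (fun hm => ⟨f ∘ g, hY', fun a b ha hb hab => ?_⟩)
    (fun hm => ⟨f ∘ g, hY', fun a b ha hb hab => ?_⟩)
  · exact (hm (hgT a ha) (hgT b hb) (hg hab).le).lt_of_ne (hne a b ha hb hab)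
  · exact (hm (hgT a ha) (hgT b hb) (hg hab).le).lt_of_ne (hne a b ha hb hab).symm
end

section
/- Let X be a linearly ordered set such that every uncountable subset of X contains a subset order-isomorphic to ω₁ or a subset order-isomorphic to ω₁ with the reversed order. Then every closed first countable subspace of the compact line 𝕂(X) is metrizable. -/
universe u

open Set Filter Topology

/-- Countably many elements of `ω₁` have a common upper bound in `ω₁`. -/
theorem exists_omega1_upper_bound (a : ℕ → Set.Iio omega1) : ∃ b, ∀ n, a n ≤ b := by
  have key : ⨆ n, (a n : Ordinal.{0}) < omega1 := by
    have h1 : omega1 = Ordinal.omega 1 := Cardinal.ord_aleph 1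
    exact (Ordinal.iSup_lt_omega_one fun n => (a n).2.trans_eq h1).trans_eq h1.symm
  exact ⟨⟨_, key⟩, fun n => Ordinal.le_iSup (fun n => (a n : Ordinal.{0})) n⟩

theorem succ_lt_omega1 {a : Ordinal.{0}} (ha : a < omega1) : Order.succ a < omega1 :=
  (Cardinal.isSuccLimit_ord (Cardinal.aleph0_le_aleph 1)).succ_lt ha

instance : Nonempty (Set.Iio omega1) :=
  ⟨⟨0, (Cardinal.isSuccLimit_ord (Cardinal.aleph0_le_aleph 1)).bot_lt⟩⟩

/-- A convergent `ω₁`-sequence in a first countable `T₁` space is eventually constant. -/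
theorem eventually_eq_of_tendsto_omega1 {Z : Type*} [TopologicalSpace Z] [T1Space Z]
    [FirstCountableTopology Z] {p : Set.Iio omega1 → Z} {q : Z} (hp : Tendsto p atTop (𝓝 q)) :
    ∀ᶠ a in atTop, p a = q := by
  obtain ⟨V, hV⟩ := (𝓝 q).exists_antitone_basis
  have hev : ∀ n, ∃ a, ∀ b ≥ a, p b ∈ V n := fun n =>
    eventually_atTop.1 (hp (hV.1.mem_of_mem trivial))
  choose a ha using hev
  obtain ⟨b, hb⟩ := exists_omega1_upper_bound a
  filter_upwards [eventually_ge_atTop b] with c hc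
  by_contra hne
  obtain ⟨n, -, hn⟩ := hV.1.mem_iff.1 (isOpen_compl_singleton.mem_nhds (Ne.symm hne))
  exact hn (ha n c ((hb n).trans hc)) rfl

/-- In a first countable closed set of final segments, an `ω₁`-sequence all of whose coordinates
are eventually constant is itself eventually constant. -/
theorem eventually_const_of_coordinates {X : Type u} [LinearOrder X] {L : Set (FinalSegs X)}
    (hL : IsClosed L) (hfc : FirstCountableTopology L) (p : Set.Iio omega1 → L)
    (hp : ∀ x, ∃ c, ∀ᶠ a in atTop, (p a).1.1 x = c) : ∃ q, ∀ᶠ a in atTop, p a = q := by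
  choose q hq using hp
  have hqF : ∀ x y : X, x ≤ y → q x = true → q y = true := by
    intro x y hxy hx
    obtain ⟨a, h1, h2⟩ := ((hq x).and (hq y)).exists
    rw [← h2]
    exact (p a).1.2 x y hxy (h1.trans hx)
  have ht : Tendsto (fun a => (p a).1) atTop (𝓝 (⟨q, hqF⟩ : FinalSegs X)) := by
    rw [tendsto_subtype_rng, tendsto_pi_nhds]
    exact fun x => tendsto_nhds_of_eventually_eq (hq x)
  have hqL : (⟨q, hqF⟩ : FinalSegs X) ∈ L :=
    hL.mem_of_tendsto ht (Eventually.of_forall fun a => (p a).2)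
  exact ⟨⟨_, hqL⟩, eventually_eq_of_tendsto_omega1 (tendsto_subtype_rng.2 ht)⟩

theorem FinalSegs.imp_of_separated {X : Type u} [LinearOrder X] {F G : FinalSegs X} {y : X}
    (hF : F.1 y = true) (hG : G.1 y = false) (x : X) (hx : G.1 x = true) : F.1 x = true := by
  refine F.2 y x (le_of_not_gt fun hlt => ?_) hF
  have := G.2 x y hlt.le hx
  simp_all

/-- An `ω₁`-sequence in a first countable closed set of final segments cannot be separated by
points `g a`, with later terms taking the value `!c` at `g a` and the `a`-th term the value `c`. -/
theorem not_separated_omega1 {X : Type u} [LinearOrder X] {L : Set (FinalSegs X)}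
    (hL : IsClosed L) (hfc : FirstCountableTopology L) (p : Set.Iio omega1 → L)
    (g : Set.Iio omega1 → X) (c : Bool) (hc : ∀ a, (p a).1.1 (g a) = c)
    (hgt : ∀ a b, a < b → (p b).1.1 (g a) = !c) : False := by
  have hmono : ∀ a b, a ≤ b → ∀ x, (p a).1.1 x = !c → (p b).1.1 x = !c := by
    intro a b hab x hx
    rcases hab.eq_or_lt with rfl | hlt
    · exact hx
    have h1 := hc a
    have h2 := hgt a b hlt
    cases c
    · exact FinalSegs.imp_of_separated h2 h1 x hx
    · by_contra hne
      have := FinalSegs.imp_of_separated h1 h2 x (by simpa using hne)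
      simp_all
  obtain ⟨q, hq⟩ := eventually_const_of_coordinates hL hfc p fun x => by
    by_cases hx : ∃ a, (p a).1.1 x = !c
    · obtain ⟨a, ha⟩ := hx
      exact ⟨!c, (eventually_ge_atTop a).mono fun b hb => hmono a b hb x ha⟩
    · refine ⟨c, Eventually.of_forall fun a => ?_⟩
      have := not_exists.1 hx a
      simpa using this
  obtain ⟨a, ha⟩ := eventually_atTop.1 hq
  let b : Set.Iio omega1 := ⟨Order.succ a.1, succ_lt_omega1 a.2⟩
  have hab : a < b := Order.lt_succ a.1
  have h1 := hgt a b hab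
  rw [ha b hab.le, ← ha a le_rfl, hc a] at h1
  simp at h1

theorem exists_separating_point {X : Type u} [LinearOrder X] {L : Set (FinalSegs X)} {x y : X}
    (hxy : x ≤ y) (hne : (fun F : L => F.1.1 x) ≠ fun F : L => F.1.1 y) :
    ∃ F : L, F.1.1 x = false ∧ F.1.1 y = true := by
  obtain ⟨F, hF⟩ := Function.ne_iff.1 hne
  have := F.1.2 x y hxy
  refine ⟨F, ?_⟩
  cases hx : F.1.1 x <;> cases hy : F.1.1 y <;> simp_all

/-- If points of `Y` induce distinct evaluations on a first countable closed set of final segments,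
then `Y` contains no copy of `ω₁`. -/
theorem not_containsOmega1Copy {X : Type u} [LinearOrder X] {L : Set (FinalSegs X)}
    (hL : IsClosed L) (hfc : FirstCountableTopology L) {Y : Set X}
    (hY : Y.InjOn fun x (F : L) => F.1.1 x) : ¬ ContainsOmega1Copy Y := by
  rintro ⟨f, hfY, hf⟩
  have hex : ∀ a : Set.Iio omega1, ∃ F : L,
      F.1.1 (f a) = false ∧ F.1.1 (f (Order.succ a.1)) = true := fun a => by
    have hlt := hf _ _ a.2 (succ_lt_omega1 a.2) (Order.lt_succ a.1)
    exact exists_separating_point hlt.le fun he =>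
      hlt.ne (hY (hfY _ a.2) (hfY _ (succ_lt_omega1 a.2)) he)
  choose p hp0 hp1 using hex
  refine not_separated_omega1 hL hfc p (fun a => f (Order.succ a.1)) true hp1 fun a b hab => ?_
  by_contra hne
  have hle : f (Order.succ a.1) ≤ f b := by
    rcases (Order.succ_le_of_lt (show a.1 < b.1 from hab)).eq_or_lt with he | hlt
    · rw [he]
    · exact (hf _ _ (succ_lt_omega1 a.2) b.2 hlt).le
  have htrue := (p b).1.2 _ _ hle (by simpa using hne)
  exact Bool.false_ne_true ((hp0 b).symm.trans htrue)

/-- If points of `Y` induce distinct evaluations on a first countable closed set of final segments,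
then `Y` contains no reversed copy of `ω₁`. -/
theorem not_containsOmega1RevCopy {X : Type u} [LinearOrder X] {L : Set (FinalSegs X)}
    (hL : IsClosed L) (hfc : FirstCountableTopology L) {Y : Set X}
    (hY : Y.InjOn fun x (F : L) => F.1.1 x) : ¬ ContainsOmega1RevCopy Y := by
  rintro ⟨f, hfY, hf⟩
  have hex : ∀ a : Set.Iio omega1, ∃ F : L,
      F.1.1 (f (Order.succ a.1)) = false ∧ F.1.1 (f a) = true := fun a => by
    have hlt := hf _ _ a.2 (succ_lt_omega1 a.2) (Order.lt_succ a.1)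
    exact exists_separating_point hlt.le fun he =>
      hlt.ne (hY (hfY _ (succ_lt_omega1 a.2)) (hfY _ a.2) he)
  choose p hp0 hp1 using hex
  refine not_separated_omega1 hL hfc p (fun a => f (Order.succ a.1)) false hp0 fun a b hab => ?_
  have hle : f b ≤ f (Order.succ a.1) := by
    rcases (Order.succ_le_of_lt (show a.1 < b.1 from hab)).eq_or_lt with he | hlt
    · rw [he]
    · exact (hf _ _ (succ_lt_omega1 a.2) b.2 hlt).le
  exact (p b).1.2 _ _ hle (hp1 b)

instance FinalSegs.instCompactSpace (X : Type u) [LinearOrder X] : CompactSpace (FinalSegs X) := by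
  suffices hclosed : IsClosed {F : X → Bool | ∀ x y : X, x ≤ y → F x = true → F y = true} from
      isCompact_iff_compactSpace.1 hclosed.isCompact
  simp only [Set.ofPred_forall]
  refine isClosed_iInter fun x => isClosed_iInter fun y => isClosed_iInter fun _ => ?_
  have hclopen : ∀ z : X, IsClopen {F : X → Bool | F z = true} := fun z =>
    (isClopen_discrete {true}).preimage (continuous_apply z)
  exact isClosed_imp (hclopen x).isOpen (hclopen y).isClosed

theorem metrizableSpace_of_countable_evaluations {X : Type u} [LinearOrder X]
    {L : Set (FinalSegs X)} (hL : IsClosed L) {Y : Set X} (hYc : Y.Countable)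
    (hY : ∀ x, ∃ y ∈ Y, (fun F : L => F.1.1 x) = fun F : L => F.1.1 y) :
    TopologicalSpace.MetrizableSpace L := by
  have := hYc.to_subtype
  have : CompactSpace L := isCompact_iff_compactSpace.1 hL.isCompact
  have : TopologicalSpace.MetrizableSpace (Y → Bool) :=
    TopologicalSpace.metrizableSpace_of_t3_secondCountable _
  have hcont : Continuous fun (F : L) (y : Y) => F.1.1 y :=
    continuous_pi fun y => (continuous_apply y.1).comp
      (continuous_subtype_val.comp continuous_subtype_val)
  refine (hcont.isClosedEmbedding fun F G hFG => ?_).isEmbedding.metrizableSpace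
  refine Subtype.ext (Subtype.ext (funext fun x => ?_))
  obtain ⟨y, hy, he⟩ := hY x
  exact (congrFun he F).trans ((congrFun hFG ⟨y, hy⟩).trans (congrFun he G).symm)

theorem closed_firstCountable_metrizable (X : Type u) [LinearOrder X]
    (h : ∀ Y : Set X, ¬ Y.Countable → ContainsOmega1Copy Y ∨ ContainsOmega1RevCopy Y)
    (L : Set (FinalSegs X)) (hL : IsClosed L)
    (hfc : FirstCountableTopology L) :
    TopologicalSpace.MetrizableSpace L := by
  obtain ⟨Y, -, hY⟩ := (Set.surjOn_image (fun x (F : L) => F.1.1 x) Set.univ).exists_bijOn_subset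
  refine metrizableSpace_of_countable_evaluations hL (Y := Y) ?_ fun x => ?_
  · by_contra hYc
    exact (h Y hYc).elim (not_containsOmega1Copy hL hfc hY.injOn)
      (not_containsOmega1RevCopy hL hfc hY.injOn)
  · obtain ⟨y, hy, he⟩ := hY.surjOn (Set.mem_image_of_mem _ (Set.mem_univ x))
    exact ⟨y, hy, he.symm⟩
end

section
/- Let X be a linearly ordered set and Y ⊆ X. Then the following are equivalent: (b) there exists an increasing map p : conv(Y) → Y with p(y) = y for every y ∈ Y, where conv(Y) = {x ∈ X : ∃ y₁, y₂ ∈ Y, y₁ ≤ x ≤ y₂}; (c) every proper gap of Y remains a gap in X, i.e. whenever A, B ⊆ Y are nonempty sets with A ∪ B = Y, a < b for all a ∈ A and b ∈ B, A has no maximum and B has no minimum, then there is no x ∈ X with a < x < b for all a ∈ A and b ∈ B. -/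
universe u

open Set Filter Topology

/-- Every proper gap `⟨A, B⟩` of `Y` remains a gap in `X`: no point of `X` lies strictly
between `A` and `B`. -/
def GapsRemain (X : Type u) [LinearOrder X] (Y : Set X) : Prop :=
  ∀ A B : Set X, A ⊆ Y → B ⊆ Y → A.Nonempty → B.Nonempty → A ∪ B = Y →
    (∀ a ∈ A, ∀ b ∈ B, a < b) →
    (∀ a ∈ A, ∃ a' ∈ A, a < a') →
    (∀ b ∈ B, ∃ b' ∈ B, b' < b) →
    ¬ ∃ x : X, (∀ a ∈ A, a < x) ∧ (∀ b ∈ B, x < b)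

/-- If every proper gap of `Y` remains a gap in `X`, then a point `x` between two elements of `Y`
has a nearest element of `Y` from below or from above. -/
theorem GapsRemain.exists_isGreatest_or_isLeast {X : Type u} [LinearOrder X] {Y : Set X}
    (h : GapsRemain X Y) {x : X} (hx : ∃ y₁ ∈ Y, ∃ y₂ ∈ Y, y₁ ≤ x ∧ x ≤ y₂) :
    (∃ g, IsGreatest (Y ∩ Iic x) g) ∨ ∃ l, IsLeast (Y ∩ Ici x) l := by
  by_contra! hcon
  obtain ⟨hg, hl⟩ := hcon
  have hxY : x ∉ Y := fun hY => hg x ⟨⟨hY, le_rfl⟩, fun _ hy => hy.2⟩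
  obtain ⟨y₁, hy₁, y₂, hy₂, h₁, h₂⟩ := hx
  have ltx : ∀ a ∈ Y ∩ Iic x, a < x := fun a ha =>
    lt_of_le_of_ne ha.2 fun e => hxY (e ▸ ha.1)
  have xlt : ∀ b ∈ Y ∩ Ici x, x < b := fun b hb =>
    lt_of_le_of_ne hb.2 fun e => hxY (e ▸ hb.1)
  refine h (Y ∩ Iic x) (Y ∩ Ici x) inter_subset_left inter_subset_left ⟨y₁, hy₁, h₁⟩
    ⟨y₂, hy₂, h₂⟩ ?_ (fun a ha b hb => (ltx a ha).trans (xlt b hb)) ?_ ?_ ⟨x, ltx, xlt⟩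
  · rw [← inter_union_distrib_left, Iic_union_Ici, inter_univ]
  · intro a ha
    by_contra! hmax
    exact hg a ⟨ha, hmax⟩
  · intro b hb
    by_contra! hmin
    exact hl b ⟨hb, hmin⟩

/-- Rounding down to the nearest element of `Y` when there is one, and up otherwise,
is increasing. -/
theorem le_of_isGreatest_or_isLeast {X : Type u} [LinearOrder X] {Y : Set X} {x₁ x₂ q₁ q₂ : X}
    (h₁ : IsGreatest (Y ∩ Iic x₁) q₁ ∨
      (¬ ∃ g, IsGreatest (Y ∩ Iic x₁) g) ∧ IsLeast (Y ∩ Ici x₁) q₁)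
    (h₂ : IsGreatest (Y ∩ Iic x₂) q₂ ∨ IsLeast (Y ∩ Ici x₂) q₂)
    (h : x₁ ≤ x₂) : q₁ ≤ q₂ := by
  rcases h₁ with h₁ | ⟨hn, h₁⟩ <;> rcases h₂ with h₂ | h₂
  · exact h₂.2 ⟨h₁.1.1, le_trans h₁.1.2 h⟩
  · exact le_trans h₁.1.2 (le_trans h h₂.1.2)
  · rcases le_or_gt q₁ x₂ with hq | hq
    · exact h₂.2 ⟨h₁.1.1, hq⟩
    · refine absurd ⟨q₂, ⟨h₂.1.1, ?_⟩, fun y hy => h₂.2 ⟨hy.1, le_trans hy.2 h⟩⟩ hn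
      by_contra hlt
      exact (lt_of_le_of_lt h₂.1.2 hq).not_ge (h₁.2 ⟨h₂.1.1, (not_le.mp hlt).le⟩)
  · exact h₁.2 ⟨h₂.1.1, le_trans h h₂.1.2⟩

theorem increasing_retraction_iff_gaps_remain (X : Type u) [LinearOrder X] (Y : Set X) :
    (∃ p : X → X,
        (∀ x : X, (∃ y₁ ∈ Y, ∃ y₂ ∈ Y, y₁ ≤ x ∧ x ≤ y₂) → p x ∈ Y) ∧
        (∀ x₁ x₂ : X, (∃ y₁ ∈ Y, ∃ y₂ ∈ Y, y₁ ≤ x₁ ∧ x₁ ≤ y₂) →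
          (∃ y₁ ∈ Y, ∃ y₂ ∈ Y, y₁ ≤ x₂ ∧ x₂ ≤ y₂) → x₁ ≤ x₂ → p x₁ ≤ p x₂) ∧
        (∀ y ∈ Y, p y = y)) ↔
      GapsRemain X Y := by
  constructor
  · rintro ⟨p, hpY, hmono, hid⟩ A B hA hB ⟨a₀, ha₀⟩ ⟨b₀, hb₀⟩ hAB - hmax hmin ⟨x, hax, hxb⟩
    have conv : ∀ y ∈ Y, ∃ y₁ ∈ Y, ∃ y₂ ∈ Y, y₁ ≤ y ∧ y ≤ y₂ :=
      fun y hy => ⟨y, hy, y, hy, le_rfl, le_rfl⟩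
    have hx : ∃ y₁ ∈ Y, ∃ y₂ ∈ Y, y₁ ≤ x ∧ x ≤ y₂ :=
      ⟨a₀, hA ha₀, b₀, hB hb₀, (hax a₀ ha₀).le, (hxb b₀ hb₀).le⟩
    have hpx : p x ∈ A ∪ B := hAB ▸ hpY x hx
    rcases hpx with hp | hp
    · obtain ⟨a, ha, hlt⟩ := hmax _ hp
      have hle := hmono a x (conv a (hA ha)) hx (hax a ha).le
      rw [hid a (hA ha)] at hle
      exact hlt.not_ge hle
    · obtain ⟨b, hb, hlt⟩ := hmin _ hp
      have hle := hmono x b hx (conv b (hB hb)) (hxb b hb).le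
      rw [hid b (hB hb)] at hle
      exact hlt.not_ge hle
  · intro h
    have key : ∀ x : X, ∃ q : X, (∃ y₁ ∈ Y, ∃ y₂ ∈ Y, y₁ ≤ x ∧ x ≤ y₂) →
        (IsGreatest (Y ∩ Iic x) q ∨
          (¬ ∃ g, IsGreatest (Y ∩ Iic x) g) ∧ IsLeast (Y ∩ Ici x) q) := by
      intro x
      by_cases hx : ∃ y₁ ∈ Y, ∃ y₂ ∈ Y, y₁ ≤ x ∧ x ≤ y₂
      · by_cases hg : ∃ g, IsGreatest (Y ∩ Iic x) g
        · exact hg.imp fun g hg _ => Or.inl hg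
        · obtain ⟨l, hl⟩ := (h.exists_isGreatest_or_isLeast hx).resolve_left hg
          exact ⟨l, fun _ => Or.inr ⟨hg, hl⟩⟩
      · exact ⟨x, fun hx' => absurd hx' hx⟩
    choose p hp using key
    refine ⟨p, fun x hx => ?_, fun x₁ x₂ hx₁ hx₂ hle => ?_, fun y hy => ?_⟩
    · rcases hp x hx with hg | ⟨-, hl⟩
      exacts [hg.1.1, hl.1.1]
    · exact le_of_isGreatest_or_isLeast (hp x₁ hx₁) ((hp x₂ hx₂).imp_right And.right) hle
    · have hy' : IsGreatest (Y ∩ Iic y) y := ⟨⟨hy, le_rfl⟩, fun _ hz => hz.2⟩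
      rcases hp y ⟨y, hy, y, hy, le_rfl, le_rfl⟩ with hg | ⟨hn, -⟩
      exacts [hg.unique hy', absurd ⟨y, hy'⟩ hn]
end

section
/- Let X be a linearly ordered set, Y ⊆ X, and let f : 𝕂(X) → 𝕂(Y) be the map f(F) = F ∩ Y (the dual of the inclusion Y ⊆ X; f is an increasing continuous surjection). Then f admits a continuous right inverse (a continuous map g : 𝕂(Y) → 𝕂(X) with f ∘ g = id) if and only if every proper gap of Y remains a gap in X, i.e. whenever A, B ⊆ Y are nonempty sets with A ∪ B = Y, a < b for all a ∈ A and b ∈ B, A has no maximum and B has no minimum, then there is no x ∈ X with a < x < b for all a ∈ A and b ∈ B. -/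
universe u

open Set Filter Topology

/-- The dual map to the inclusion `Y ⊆ X`, sending a final segment `F` of `X` to `F ∩ Y`. -/
def restrictSeg {X : Type u} [LinearOrder X] (Y : Set X) (F : FinalSegs X) : FinalSegs Y :=
  ⟨fun y => F.1 y.1, fun a b hab h => F.2 a.1 b.1 (Subtype.coe_le_coe.mpr hab) h⟩

namespace FinalSegs

variable {X : Type u} [LinearOrder X]

/-- A final segment that is empty or has a least element. -/
def IsEmptyOrHasMin (F : FinalSegs X) : Prop :=
  ∀ y, F.1 y = true → ∃ m, F.1 m = true ∧ ∀ z, F.1 z = true → m ≤ z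

/-- The principal final segment `{y | a ≤ y}`. -/
def principal (a : X) : FinalSegs X :=
  ⟨fun y => decide (a ≤ y), fun x y hxy h => by
    simp only [decide_eq_true_eq] at h ⊢
    exact h.trans hxy⟩

/-- Points of the chosen extension of a final segment of `Y` to `X`: the largest extension when
the segment is empty or has a minimum, the smallest one otherwise. -/
def MemExtend {Y : Set X} (F : FinalSegs Y) (x : X) : Prop :=
  (∃ y : Y, F.1 y = true ∧ y.1 ≤ x) ∨ (F.IsEmptyOrHasMin ∧ ∀ y : Y, F.1 y = false → y.1 < x)

open Classical in
/-- The final segment of `X` with the points described by `MemExtend`. -/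
noncomputable def extend {Y : Set X} (F : FinalSegs Y) : FinalSegs X :=
  ⟨fun x => decide (F.MemExtend x), fun x x' hx h => by
    simp only [decide_eq_true_eq] at h ⊢
    rcases h with ⟨y, hy, hyx⟩ | ⟨hF, h⟩
    · exact Or.inl ⟨y, hy, hyx.trans hx⟩
    · exact Or.inr ⟨hF, fun y hy => (h y hy).trans_le hx⟩⟩

theorem extend_eq_true {Y : Set X} (F : FinalSegs Y) (x : X) :
    (extend F).1 x = true ↔ F.MemExtend x := by
  simp [extend]

theorem extend_coe {Y : Set X} (F : FinalSegs Y) (y : Y) : (extend F).1 y.1 = F.1 y := by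
  rw [Bool.eq_iff_iff, extend_eq_true]
  constructor
  · rintro (⟨z, hz, hzy⟩ | ⟨-, h⟩)
    · exact F.2 z y hzy hz
    · by_contra hy
      exact lt_irrefl _ (h y (by simpa using hy))
  · exact fun h => Or.inl ⟨y, h, le_rfl⟩

theorem restrictSeg_comp_extend (Y : Set X) :
    restrictSeg Y ∘ (extend : FinalSegs Y → FinalSegs X) = id := by
  funext F
  exact Subtype.ext (funext fun y => extend_coe F y)

/-- The final segment of `Y` cut out by a point `x`. -/
def above (Y : Set X) (x : X) : FinalSegs Y :=
  ⟨fun y => decide (x < y.1), fun a b hab h => by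
    simp only [decide_eq_true_eq] at h ⊢
    exact h.trans_le hab⟩

theorem above_eq_true {Y : Set X} {x : X} {y : Y} : (above Y x).1 y = true ↔ x < y.1 := by
  simp [above]

theorem eq_above {Y : Set X} {F : FinalSegs Y} {x : X}
    (h₁ : ∀ y : Y, F.1 y = true → x < y.1) (h₂ : ∀ y : Y, F.1 y = false → y.1 < x) :
    F = above Y x := by
  refine Subtype.ext (funext fun y => ?_)
  rw [Bool.eq_iff_iff, above_eq_true]
  refine ⟨h₁ y, fun h => ?_⟩
  by_contra hy
  exact lt_asymm h (h₂ y (by simpa using hy))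

theorem memExtend_iff {Y : Set X} {x : X} (hx : x ∉ Y) (F : FinalSegs Y) :
    F.MemExtend x ↔ (∃ y : Y, F.1 y = true ∧ y.1 < x) ∨
      (F = above Y x ∧ (above Y x).IsEmptyOrHasMin) := by
  have hne : ∀ y : Y, y.1 ≠ x := fun y h => hx (h ▸ y.2)
  constructor
  · intro h
    by_cases hF : ∃ y : Y, F.1 y = true ∧ y.1 < x
    · exact Or.inl hF
    · have h₁ : ∀ y : Y, F.1 y = true → x < y.1 := fun y hy =>
        lt_of_le_of_ne (not_lt.1 fun h => hF ⟨y, hy, h⟩) (hne y).symm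
      rcases h with ⟨y, hy, hyx⟩ | ⟨hm, h₂⟩
      · exact absurd (h₁ y hy) hyx.not_gt
      · have := eq_above h₁ h₂
        exact Or.inr ⟨this, this ▸ hm⟩
  · rintro (⟨y, hy, hyx⟩ | ⟨rfl, hm⟩)
    · exact Or.inl ⟨y, hy, hyx.le⟩
    · refine Or.inr ⟨hm, fun y hy => lt_of_le_of_ne (not_lt.1 fun h => ?_) (hne y)⟩
      simp [above_eq_true.2 h] at hy

/-- If gaps remain, each coordinate of `extend` is constant or a coordinate projection. -/
theorem extend_apply_eq_const_or_eval {Y : Set X} (hY : GapsRemain X Y) (x : X) :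
    (∃ c : Bool, ∀ F : FinalSegs Y, (extend F).1 x = c) ∨
      ∃ m : Y, ∀ F : FinalSegs Y, (extend F).1 x = F.1 m := by
  by_cases hx : x ∈ Y
  · exact Or.inr ⟨⟨x, hx⟩, fun F => extend_coe F ⟨x, hx⟩⟩
  have hne : ∀ y : Y, y.1 ≠ x := fun y h => hx (h ▸ y.2)
  by_cases hm : (above Y x).IsEmptyOrHasMin
  · by_cases he : ∃ y : Y, x < y.1
    · obtain ⟨y, hy⟩ := he
      obtain ⟨m, hxm, hmin⟩ := hm y (above_eq_true.2 hy)
      refine Or.inr ⟨m, fun F => ?_⟩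
      rw [Bool.eq_iff_iff, extend_eq_true]
      constructor
      · rintro (⟨z, hz, hzx⟩ | ⟨-, h⟩)
        · exact F.2 z m (hzx.trans (above_eq_true.1 hxm).le) hz
        · by_contra hFm
          exact lt_asymm (above_eq_true.1 hxm) (h m (by simpa using hFm))
      · intro hFm
        rw [memExtend_iff hx]
        by_cases hF : ∃ y : Y, F.1 y = true ∧ y.1 < x
        · exact Or.inl hF
        · refine Or.inr ⟨eq_above (fun y hy => ?_) (fun y hy => ?_), hm⟩
          · exact lt_of_le_of_ne (not_lt.1 fun h => hF ⟨y, hy, h⟩) (hne y).symm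
          · refine lt_of_le_of_ne (not_lt.1 fun h => ?_) (hne y)
            simp [F.2 m y (hmin y (above_eq_true.2 h)) hFm] at hy
    · refine Or.inl ⟨true, fun F => ?_⟩
      have hlt : ∀ y : Y, y.1 < x := fun y =>
        lt_of_le_of_ne (not_lt.1 fun h => he ⟨y, h⟩) (hne y)
      rw [extend_eq_true, memExtend_iff hx]
      by_cases hF : ∃ y : Y, F.1 y = true
      · obtain ⟨y, hy⟩ := hF
        exact Or.inl ⟨y, hy, hlt y⟩
      · exact Or.inr ⟨eq_above (fun y hy => (hF ⟨y, hy⟩).elim) (fun y _ => hlt y), hm⟩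
  · have hmem : ∀ F : FinalSegs Y, F.MemExtend x ↔ ∃ y : Y, F.1 y = true ∧ y.1 < x :=
      fun F => by simp [memExtend_iff hx, hm]
    by_cases he : ∃ y : Y, y.1 < x
    · obtain ⟨y₀, hy₀⟩ := he
      by_cases hmax : ∃ m : Y, m.1 < x ∧ ∀ z : Y, z.1 < x → z ≤ m
      · obtain ⟨m, hmx, hmax⟩ := hmax
        refine Or.inr ⟨m, fun F => ?_⟩
        rw [Bool.eq_iff_iff, extend_eq_true, hmem]
        exact ⟨fun ⟨y, hy, hyx⟩ => F.2 y m (hmax y hyx) hy, fun h => ⟨m, h, hmx⟩⟩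
      · exfalso
        unfold IsEmptyOrHasMin at hm
        simp only [above_eq_true] at hm
        push Not at hm hmax
        obtain ⟨y₁, hy₁, hmin⟩ := hm
        refine hY {y | y ∈ Y ∧ y < x} {y | y ∈ Y ∧ x < y} (fun y hy => hy.1) (fun y hy => hy.1)
          ⟨y₀, y₀.2, hy₀⟩ ⟨y₁, y₁.2, hy₁⟩ ?_ (fun a ha b hb => ha.2.trans hb.2) ?_ ?_
          ⟨x, fun a ha => ha.2, fun b hb => hb.2⟩
        · ext y
          constructor
          · rintro (h | h) <;> exact h.1
          · intro h
            exact (lt_or_gt_of_ne (hne ⟨y, h⟩)).imp (fun h' => ⟨h, h'⟩) (fun h' => ⟨h, h'⟩)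
        · rintro a ⟨ha, hax⟩
          obtain ⟨z, hz, haz⟩ := hmax ⟨a, ha⟩ hax
          exact ⟨z, ⟨z.2, hz⟩, haz⟩
        · rintro b ⟨hb, hxb⟩
          obtain ⟨z, hz, hzb⟩ := hmin ⟨b, hb⟩ hxb
          exact ⟨z, ⟨z.2, hz⟩, hzb⟩
    · refine Or.inl ⟨false, fun F => ?_⟩
      rw [Bool.eq_false_iff, ne_eq, extend_eq_true, hmem]
      exact fun ⟨y, _, hy⟩ => he ⟨y, hy⟩

theorem continuous_extend {Y : Set X} (hY : GapsRemain X Y) :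
    Continuous (extend : FinalSegs Y → FinalSegs X) := by
  refine Continuous.subtype_mk (continuous_pi fun x => ?_) _
  rcases extend_apply_eq_const_or_eval hY x with ⟨c, hc⟩ | ⟨m, hm⟩
  · exact continuous_const.congr fun F => (hc F).symm
  · exact ((continuous_apply m).comp continuous_subtype_val).congr fun F => (hm F).symm

theorem tendsto_iff {ι : Type*} {l : Filter ι} {u : ι → FinalSegs X} {F : FinalSegs X} :
    Tendsto u l (𝓝 F) ↔ ∀ x, ∀ᶠ i in l, (u i).1 x = F.1 x := by
  rw [tendsto_subtype_rng, tendsto_pi_nhds]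
  simp [nhds_discrete]

theorem gapsRemain_of_rightInverse {Y : Set X} {g : FinalSegs Y → FinalSegs X}
    (hg : Continuous g) (hfg : restrictSeg Y ∘ g = id) : GapsRemain X Y := by
  rintro A B hA hB hAne hBne hAB hlt hmax hmin ⟨x, hAx, hxB⟩
  have hcoe : ∀ (F : FinalSegs Y) (y : Y), (g F).1 y.1 = F.1 y := fun F y =>
    congrFun (congrArg Subtype.val (congrFun hfg F)) y
  set F₀ : FinalSegs Y := above Y x
  have hF₀A : ∀ y : Y, y.1 ∈ A → F₀.1 y = false := fun y hy => by
    rw [Bool.eq_false_iff, ne_eq, above_eq_true]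
    exact (hAx y hy).not_gt
  have hF₀B : ∀ y : Y, y.1 ∈ B → F₀.1 y = true := fun y hy => above_eq_true.2 (hxB y hy)
  have hmem : ∀ y : Y, y.1 ∈ A ∨ y.1 ∈ B := fun y => hAB.ge y.2
  have : Nonempty A := hAne.to_subtype
  have : Nonempty B := hBne.to_subtype
  have hlim : ∀ {ι : Type u} {l : Filter ι} {u : ι → FinalSegs Y}, Tendsto u l (𝓝 F₀) →
      ∀ᶠ i in l, (g (u i)).1 x = (g F₀).1 x := fun hu =>
    tendsto_iff.1 ((hg.tendsto F₀).comp hu) x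
  have hTA : Tendsto (fun a : A => principal (⟨a.1, hA a.2⟩ : Y)) atTop (𝓝 F₀) := by
    refine tendsto_iff.2 fun y => ?_
    rcases hmem y with hy | hy
    · obtain ⟨a', ha', hya'⟩ := hmax y hy
      filter_upwards [eventually_ge_atTop (⟨a', ha'⟩ : A)] with a ha
      rw [hF₀A y hy]
      exact decide_eq_false (not_le.2 (hya'.trans_le ha))
    · refine Eventually.of_forall fun a => ?_
      rw [hF₀B y hy]
      exact decide_eq_true (hlt a a.2 y hy).le
  have hTB : Tendsto (fun b : B => principal (⟨b.1, hB b.2⟩ : Y)) atBot (𝓝 F₀) := by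
    refine tendsto_iff.2 fun y => ?_
    rcases hmem y with hy | hy
    · refine Eventually.of_forall fun b => ?_
      rw [hF₀A y hy]
      exact decide_eq_false (not_le.2 (hlt y hy b b.2))
    · filter_upwards [eventually_le_atBot (⟨y.1, hy⟩ : B)] with b hb
      rw [hF₀B y hy]
      exact decide_eq_true hb
  obtain ⟨a, ha⟩ := (hlim hTA).exists
  obtain ⟨b, hb⟩ := (hlim hTB).exists
  have htrue : (g F₀).1 x = true := by
    rw [← ha]
    refine (g _).2 a.1 x (hAx a a.2).le ?_
    rw [hcoe _ ⟨a.1, hA a.2⟩]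
    exact decide_eq_true le_rfl
  rw [htrue] at hb
  obtain ⟨b', hb', hlt'⟩ := hmin b b.2
  have := (g _).2 x b' (hxB b' hb').le hb
  rw [hcoe _ ⟨b', hB hb'⟩] at this
  exact hlt'.not_ge (of_decide_eq_true this)

end FinalSegs

theorem right_invertible_iff_gaps_remain (X : Type u) [LinearOrder X] (Y : Set X) :
    (∃ g : FinalSegs Y → FinalSegs X, Continuous g ∧ restrictSeg Y ∘ g = id) ↔
      GapsRemain X Y :=
  ⟨fun ⟨_, hg, hfg⟩ => FinalSegs.gapsRemain_of_rightInverse hg hfg, fun hY =>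
    ⟨FinalSegs.extend, FinalSegs.continuous_extend hY, FinalSegs.restrictSeg_comp_extend Y⟩⟩
end
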